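/- For every positive integer m: (i) J_{4*,m}(O_K) := ⊕_{k ≥ 0, k ≡ 0 mod 4} J_{k,m}(O_K) is a free module of rank m² + 2 over the ring ℂ[E₄, E₆²]; (ii) J_{2*,m}(O_K) := ⊕_{k ≥ 0, k even} J_{k,m}(O_K) is a free module of rank 2(m² + 1) over ℂ[E₄, E₆²]. -/

import Mathlib

noncomputable section

open Complex

/-- `τ` lies in the upper half plane. -/
def UHP (τ : ℂ) : Prop := 0 < τ.im

/-- `eC w = exp(2 π i w)`. -/
def eC (w : ℂ) : ℂ := Complex.exp (2 * (Real.pi : ℂ) * Complex.I * w)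

/-- Entries of a matrix in `SL(2, ℤ)`, as complex numbers. -/
def Ma (M : Matrix.SpecialLinearGroup (Fin 2) ℤ) : ℂ := ((M.1 0 0 : ℤ) : ℂ)
def Mb (M : Matrix.SpecialLinearGroup (Fin 2) ℤ) : ℂ := ((M.1 0 1 : ℤ) : ℂ)
def Mc (M : Matrix.SpecialLinearGroup (Fin 2) ℤ) : ℂ := ((M.1 1 0 : ℤ) : ℂ)
def Md (M : Matrix.SpecialLinearGroup (Fin 2) ℤ) : ℂ := ((M.1 1 1 : ℤ) : ℂ)

/-- Hermitian Jacobi form of weight `k` and index `m` for the Hermitian Jacobi group over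
`ℤ[i]`.  A form is a function `φ : ℂ → ℂ → ℂ → ℂ`, all conditions being imposed for `τ`
in the upper half plane.  Units `ε ∈ ℤ[i]ˣ = {1, -1, i, -i}`, and the elliptic variables
`λ = p + q i`, `μ = u + v i` range over `ℤ[i]`.  The Fourier expansion is indexed by
`n ∈ ℕ` and `r = (a + b i)/2 ∈ O_K^♯ = (i/2)ℤ[i]`, supported on `N(r) ≤ n m`,
i.e. `a² + b² ≤ 4 n m`. -/
structure IsHJF (k m : ℕ) (φ : ℂ → ℂ → ℂ → ℂ) : Prop where
  holo : DifferentiableOn ℂ (fun p : ℂ × ℂ × ℂ => φ p.1 p.2.1 p.2.2) {p | UHP p.1}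
  transf : ∀ ε : ℂ, ε ∈ ({1, -1, Complex.I, -Complex.I} : Set ℂ) →
    ∀ M : Matrix.SpecialLinearGroup (Fin 2) ℤ, ∀ τ z₁ z₂ : ℂ, UHP τ →
      φ ((Ma M * τ + Mb M) / (Mc M * τ + Md M))
        (ε * z₁ / (Mc M * τ + Md M))
        ((starRingEnd ℂ) ε * z₂ / (Mc M * τ + Md M))
      = ε ^ k * (Mc M * τ + Md M) ^ k *
          eC ((m : ℂ) * Mc M * z₁ * z₂ / (Mc M * τ + Md M)) * φ τ z₁ z₂
  ellip : ∀ p q u v : ℤ, ∀ τ z₁ z₂ : ℂ, UHP τ →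
      φ τ (z₁ + ((p : ℂ) + (q : ℂ) * Complex.I) * τ + ((u : ℂ) + (v : ℂ) * Complex.I))
          (z₂ + ((p : ℂ) - (q : ℂ) * Complex.I) * τ + ((u : ℂ) - (v : ℂ) * Complex.I))
      = eC (-(m : ℂ) * (((p : ℂ) ^ 2 + (q : ℂ) ^ 2) * τ
          + ((p : ℂ) - (q : ℂ) * Complex.I) * z₁
          + ((p : ℂ) + (q : ℂ) * Complex.I) * z₂)) * φ τ z₁ z₂
  fourier : ∃ c : ℕ → ℤ → ℤ → ℂ,
      (∀ (n : ℕ) (a b : ℤ), 4 * (n : ℤ) * m < a ^ 2 + b ^ 2 → c n a b = 0) ∧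
      ∀ τ z₁ z₂ : ℂ, UHP τ →
        HasSum (fun p : ℕ × ℤ × ℤ => c p.1 p.2.1 p.2.2 *
          eC ((p.1 : ℂ) * τ + (((p.2.1 : ℂ) + (p.2.2 : ℂ) * Complex.I) / 2) * z₁
            + (((p.2.1 : ℂ) - (p.2.2 : ℂ) * Complex.I) / 2) * z₂)) (φ τ z₁ z₂)

/-- Classical Jacobi form of weight `k` and index `m` for `SL(2,ℤ) ⋉ ℤ²`. -/
structure IsJF (k m : ℕ) (φ : ℂ → ℂ → ℂ) : Prop where
  holo : DifferentiableOn ℂ (fun p : ℂ × ℂ => φ p.1 p.2) {p | UHP p.1}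
  transf : ∀ M : Matrix.SpecialLinearGroup (Fin 2) ℤ, ∀ τ z : ℂ, UHP τ →
      φ ((Ma M * τ + Mb M) / (Mc M * τ + Md M)) (z / (Mc M * τ + Md M))
      = (Mc M * τ + Md M) ^ k *
          eC ((m : ℂ) * Mc M * z ^ 2 / (Mc M * τ + Md M)) * φ τ z
  ellip : ∀ p q : ℤ, ∀ τ z : ℂ, UHP τ →
      φ τ (z + (p : ℂ) * τ + (q : ℂ))
      = eC (-(m : ℂ) * ((p : ℂ) ^ 2 * τ + 2 * (p : ℂ) * z)) * φ τ z
  fourier : ∃ c : ℕ → ℤ → ℂ,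
      (∀ (n : ℕ) (r : ℤ), 4 * (n : ℤ) * m < r ^ 2 → c n r = 0) ∧
      ∀ τ z : ℂ, UHP τ →
        HasSum (fun p : ℕ × ℤ => c p.1 p.2 * eC ((p.1 : ℂ) * τ + (p.2 : ℂ) * z)) (φ τ z)

/-- Modular form of weight `k` for `SL(2,ℤ)`. -/
structure IsMF (k : ℕ) (f : ℂ → ℂ) : Prop where
  holo : DifferentiableOn ℂ f {τ | UHP τ}
  transf : ∀ M : Matrix.SpecialLinearGroup (Fin 2) ℤ, ∀ τ : ℂ, UHP τ →
      f ((Ma M * τ + Mb M) / (Mc M * τ + Md M)) = (Mc M * τ + Md M) ^ k * f τ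
  bounded : ∃ A B : ℝ, ∀ τ : ℂ, B ≤ τ.im → ‖f τ‖ ≤ A

/-- Cusp form of weight `k` for `SL(2,ℤ)`. -/
structure IsCF (k : ℕ) (f : ℂ → ℂ) : Prop where
  holo : DifferentiableOn ℂ f {τ | UHP τ}
  transf : ∀ M : Matrix.SpecialLinearGroup (Fin 2) ℤ, ∀ τ : ℂ, UHP τ →
      f ((Ma M * τ + Mb M) / (Mc M * τ + Md M)) = (Mc M * τ + Md M) ^ k * f τ
  decay : ∀ ε : ℝ, 0 < ε → ∃ B : ℝ, ∀ τ : ℂ, B ≤ τ.im → ‖f τ‖ ≤ ε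

/-- `M_w(SL(2,ℤ), ω̄)` for the character `ω` of `SL(2,ℤ)` with `ω(T) = ω(S) = i`:
holomorphic functions on the upper half plane, bounded at infinity, with
`f|_w T = -i f` and `f|_w S = -i f`. -/
structure IsMFOmegaBar (w : ℕ) (f : ℂ → ℂ) : Prop where
  holo : DifferentiableOn ℂ f {τ | UHP τ}
  transT : ∀ τ : ℂ, UHP τ → f (τ + 1) = -Complex.I * f τ
  transS : ∀ τ : ℂ, UHP τ → f (-1 / τ) = -Complex.I * τ ^ w * f τ
  bounded : ∃ A B : ℝ, ∀ τ : ℂ, B ≤ τ.im → ‖f τ‖ ≤ A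

/-- Hermitian theta function `θ^H_{m,s}` of index `m` with characteristic
`s = (a + b i)/2 ∈ O_K^♯`; the sum is over `r = s + m (g₁ + g₂ i) ∈ s + m ℤ[i]`. -/
def thetaH (m : ℕ) (a b : ℤ) (τ z₁ z₂ : ℂ) : ℂ :=
  ∑' g : ℤ × ℤ,
    eC ((((a : ℂ) + 2 * m * g.1) ^ 2 + ((b : ℂ) + 2 * m * g.2) ^ 2) / (4 * m) * τ
      + (((a : ℂ) + 2 * m * g.1) + ((b : ℂ) + 2 * m * g.2) * Complex.I) / 2 * z₁
      + (((a : ℂ) + 2 * m * g.1) - ((b : ℂ) + 2 * m * g.2) * Complex.I) / 2 * z₂)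

/-- Classical theta function `θ_{m,μ}(τ,z) = Σ_{r ≡ μ mod 2m} e(r²τ/(4m) + r z)`. -/
def thetaJ (m : ℕ) (μ : ℤ) (τ z : ℂ) : ℂ :=
  ∑' g : ℤ, eC (((μ : ℂ) + 2 * m * g) ^ 2 / (4 * m) * τ + ((μ : ℂ) + 2 * m * g) * z)

/-- `h` is the family of theta components of `φ` (for index `m`): the `h_{a,b}` depend
only on `(a, b) mod 2m` and `φ = Σ_{s ∈ O_K^♯ / m O_K} h_s θ^H_{m,s}`. -/
def HasThetaDecomp (m : ℕ) (φ : ℂ → ℂ → ℂ → ℂ) (h : ℤ → ℤ → ℂ → ℂ) : Prop :=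
  (∀ (a b : ℤ) (τ : ℂ), h (a + 2 * m) b τ = h a b τ ∧ h a (b + 2 * m) τ = h a b τ) ∧
  ∀ τ z₁ z₂ : ℂ, UHP τ →
    φ τ z₁ z₂ = ∑ a ∈ Finset.range (2 * m), ∑ b ∈ Finset.range (2 * m),
      h (a : ℤ) (b : ℤ) τ * thetaH m (a : ℤ) (b : ℤ) τ z₁ z₂

/-- `ϑ₀(τ) = Σ_{r ∈ ℤ} e(r² τ)`. -/
def theta0C (τ : ℂ) : ℂ := ∑' r : ℤ, eC ((r : ℂ) ^ 2 * τ)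

/-- `ϑ₁(τ) = Σ_{r odd} e(r² τ / 4)`. -/
def theta1C (τ : ℂ) : ℂ := ∑' r : ℤ, eC ((2 * (r : ℂ) + 1) ^ 2 * τ / 4)

/-- `ξ = ϑ₁ ϑ₀' − ϑ₀ ϑ₁'`. -/
def xiC (τ : ℂ) : ℂ := theta1C τ * deriv theta0C τ - theta0C τ * deriv theta1C τ

/-- Taylor coefficient `χ_{α,β}(τ)` of `φ(τ, z₁, z₂)` around `z₁ = z₂ = 0`. -/
def chiHJF (φ : ℂ → ℂ → ℂ → ℂ) (α β : ℕ) (τ : ℂ) : ℂ :=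
  (1 / ((α.factorial : ℂ) * (β.factorial : ℂ))) *
    iteratedDeriv α (fun z₁ => iteratedDeriv β (fun z₂ => φ τ z₁ z₂) 0) 0

/-- `D₀ : J_{k,m} → M_k`, `ψ ↦ ψ(·, 0)`. -/
def D0J (ψ : ℂ → ℂ → ℂ) : ℂ → ℂ := fun τ => ψ τ 0

/-- `D₂ : J_{k,m} → S_{k+2}`, `D₂ψ = (2k/(2πi)²) ψ₂ − (2m/(2πi)) ψ₀'`, where `ψ_ν` are
the Taylor coefficients of `ψ` around `z = 0`. -/
def D2J (k m : ℕ) (ψ : ℂ → ℂ → ℂ) : ℂ → ℂ := fun τ =>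
  (2 * (k : ℂ) / (2 * (Real.pi : ℂ) * Complex.I) ^ 2) *
      ((1 / 2) * iteratedDeriv 2 (fun z => ψ τ z) 0)
    - (2 * (m : ℂ) / (2 * (Real.pi : ℂ) * Complex.I)) * deriv (fun t => ψ t 0) τ

/-- Normalized Eisenstein series `E₄`. -/
def E4C (τ : ℂ) : ℂ :=
  1 + 240 * ∑' n : ℕ, ((ArithmeticFunction.sigma 3) n : ℂ) * eC ((n : ℂ) * τ)

/-- Normalized Eisenstein series `E₆`. -/
def E6C (τ : ℂ) : ℂ :=
  1 - 504 * ∑' n : ℕ, ((ArithmeticFunction.sigma 5) n : ℂ) * eC ((n : ℂ) * τ)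

/-- `f` agrees on the upper half plane with a polynomial in `E₄` and `E₆²` that is
homogeneous of weight `k - v`, i.e. supported on `4a + 12b + v = k`. -/
def IsE4E6sqPoly (v k : ℕ) (f : ℂ → ℂ) : Prop :=
  ∃ lam : ℕ × ℕ → ℂ, ∀ τ : ℂ, UHP τ →
    f τ = ∑ p ∈ (Finset.range (k + 1) ×ˢ Finset.range (k + 1)).filter
        (fun p => 4 * p.1 + 12 * p.2 + v = k),
      lam p * E4C τ ^ p.1 * E6C τ ^ (2 * p.2)

/-- The slash action `φ|_{k,m} M` of `M ∈ SL(2,ℤ)` on functions `ℂ → ℂ → ℂ → ℂ`. -/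
def slashHJF (k m : ℕ) (φ : ℂ → ℂ → ℂ → ℂ) (M : Matrix.SpecialLinearGroup (Fin 2) ℤ)
    (τ z₁ z₂ : ℂ) : ℂ :=
  ((Mc M * τ + Md M) ^ k)⁻¹ *
    eC (-(m : ℂ) * Mc M * z₁ * z₂ / (Mc M * τ + Md M)) *
    φ ((Ma M * τ + Mb M) / (Mc M * τ + Md M)) (z₁ / (Mc M * τ + Md M)) (z₂ / (Mc M * τ + Md M))

/-- Hermitian Jacobi form of weight `k` and index `m` for the congruence subgroup `Γ₀(N)`,
with at each cusp a Fourier expansion supported on `(n, r) ∈ ℚ_{≥0} × O_K^♯`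
with `N(r) ≤ n m`. -/
structure IsHJFLevel (k m N : ℕ) (φ : ℂ → ℂ → ℂ → ℂ) : Prop where
  holo : DifferentiableOn ℂ (fun p : ℂ × ℂ × ℂ => φ p.1 p.2.1 p.2.2) {p | UHP p.1}
  transf : ∀ ε : ℂ, ε ∈ ({1, -1, Complex.I, -Complex.I} : Set ℂ) →
    ∀ M : Matrix.SpecialLinearGroup (Fin 2) ℤ, (N : ℤ) ∣ M.1 1 0 →
    ∀ τ z₁ z₂ : ℂ, UHP τ →
      φ ((Ma M * τ + Mb M) / (Mc M * τ + Md M))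
        (ε * z₁ / (Mc M * τ + Md M))
        ((starRingEnd ℂ) ε * z₂ / (Mc M * τ + Md M))
      = ε ^ k * (Mc M * τ + Md M) ^ k *
          eC ((m : ℂ) * Mc M * z₁ * z₂ / (Mc M * τ + Md M)) * φ τ z₁ z₂
  ellip : ∀ p q u v : ℤ, ∀ τ z₁ z₂ : ℂ, UHP τ →
      φ τ (z₁ + ((p : ℂ) + (q : ℂ) * Complex.I) * τ + ((u : ℂ) + (v : ℂ) * Complex.I))
          (z₂ + ((p : ℂ) - (q : ℂ) * Complex.I) * τ + ((u : ℂ) - (v : ℂ) * Complex.I))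
      = eC (-(m : ℂ) * (((p : ℂ) ^ 2 + (q : ℂ) ^ 2) * τ
          + ((p : ℂ) - (q : ℂ) * Complex.I) * z₁
          + ((p : ℂ) + (q : ℂ) * Complex.I) * z₂)) * φ τ z₁ z₂
  cusp : ∀ M : Matrix.SpecialLinearGroup (Fin 2) ℤ,
      ∃ c : ℚ → ℤ → ℤ → ℂ,
        (∀ (n : ℚ) (a b : ℤ),
          ¬ (0 ≤ n ∧ ((a : ℚ) ^ 2 + (b : ℚ) ^ 2) ≤ 4 * n * m) → c n a b = 0) ∧
        ∀ τ z₁ z₂ : ℂ, UHP τ →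
          HasSum (fun p : ℚ × ℤ × ℤ => c p.1 p.2.1 p.2.2 *
            eC ((p.1 : ℂ) * τ + (((p.2.1 : ℂ) + (p.2.2 : ℂ) * Complex.I) / 2) * z₁
              + (((p.2.1 : ℂ) - (p.2.2 : ℂ) * Complex.I) / 2) * z₂))
            (slashHJF k m φ M τ z₁ z₂)

/-- Theta constant `x`. -/
def thConstX (τ : ℂ) : ℂ := ∑' n : ℤ, eC ((n : ℂ) ^ 2 * τ / 2)

/-- Theta constant `y`. -/
def thConstY (τ : ℂ) : ℂ := ∑' n : ℤ, (-1 : ℂ) ^ n * eC ((n : ℂ) ^ 2 * τ / 2)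

/-- Theta constant `z`. -/
def thConstZ (τ : ℂ) : ℂ := ∑' n : ℤ, eC (((n : ℂ) + 1 / 2) ^ 2 * τ / 2)

lemma eC_add (a b : ℂ) : eC (a + b) = eC a * eC b := by
  simp [eC, mul_add, Complex.exp_add]

lemma eC_zero : eC 0 = 1 := by simp [eC]

lemma eC_ne (a : ℂ) : eC a ≠ 0 := Complex.exp_ne_zero _

lemma eC_neg (a : ℂ) : eC (-a) = (eC a)⁻¹ := by
  simp [eC, Complex.exp_neg]

lemma eC_sub (a b : ℂ) : eC (a - b) = eC a / eC b := by
  rw [sub_eq_add_neg, eC_add, eC_neg, div_eq_mul_inv]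

lemma eC_int (n : ℤ) : eC n = 1 := by
  unfold eC
  rw [mul_comm]
  exact Complex.exp_int_mul_two_pi_mul_I n

lemma eC_nat_mul (n : ℕ) (a : ℂ) : eC (n * a) = eC a ^ n := by
  unfold eC
  rw [← Complex.exp_nat_mul]; congr 1; ring

lemma norm_eC (w : ℂ) : ‖eC w‖ = Real.exp (-2 * Real.pi * w.im) := by
  unfold eC
  rw [Complex.norm_exp]
  congr 1
  simp [Complex.mul_re]

lemma differentiable_eC : Differentiable ℂ eC := by
  unfold eC; fun_prop

lemma isOpen_UHP : IsOpen {τ : ℂ | UHP τ} := isOpen_lt continuous_const Complex.continuous_im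

lemma M_den_ne (M : Matrix.SpecialLinearGroup (Fin 2) ℤ) {τ : ℂ} (h : UHP τ) :
    Mc M * τ + Md M ≠ 0 := by
  have := UpperHalfPlane.denom_ne_zero M ⟨τ, h⟩
  simpa [UpperHalfPlane.denom, Mc, Md] using this

lemma UHP_smul (M : Matrix.SpecialLinearGroup (Fin 2) ℤ) {τ : ℂ} (h : UHP τ) :
    UHP ((Ma M * τ + Mb M) / (Mc M * τ + Md M)) := by
  have := (M • (⟨τ, h⟩ : UpperHalfPlane)).2
  rw [UpperHalfPlane.specialLinearGroup_apply] at this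
  simpa [Ma, Mb, Mc, Md, UHP] using this

structure MFS (w : ℕ) (f0 : ℂ) (f : ℂ → ℂ) : Prop where
  holo : DifferentiableOn ℂ f {τ | UHP τ}
  transf : ∀ M : Matrix.SpecialLinearGroup (Fin 2) ℤ, ∀ τ : ℂ, UHP τ →
      f ((Ma M * τ + Mb M) / (Mc M * τ + Md M)) = (Mc M * τ + Md M) ^ w * f τ
  ser : ∃ c : ℕ → ℂ, c 0 = f0 ∧ ∀ τ, UHP τ → HasSum (fun n => c n * eC (n * τ)) (f τ)

lemma MFS.mul {w w' : ℕ} {a b : ℂ} {f g : ℂ → ℂ} (hf : MFS w a f) (hg : MFS w' b g) :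
    MFS (w + w') (a * b) (fun τ => f τ * g τ) := by
  refine ⟨hf.holo.mul hg.holo, fun M τ h => ?_, ?_⟩
  · rw [hf.transf M τ h, hg.transf M τ h]; ring
  · obtain ⟨c, c0, hc⟩ := hf.ser
    obtain ⟨d, d0, hd⟩ := hg.ser
    refine ⟨fun n => ∑ p ∈ Finset.HasAntidiagonal.antidiagonal n, c p.1 * d p.2, by simp [c0, d0], fun τ h => ?_⟩
    have h1 := (hc τ h).summable.norm
    have h2 := (hd τ h).summable.norm
    have h3 := (summable_norm_sum_mul_antidiagonal_of_summable_norm h1 h2).of_norm.hasSum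
    rw [← tsum_mul_tsum_eq_tsum_sum_antidiagonal_of_summable_norm h1 h2, (hc τ h).tsum_eq,
      (hd τ h).tsum_eq] at h3
    refine h3.congr_fun ?_
    intro n
    rw [Finset.sum_mul]
    refine Finset.sum_congr rfl fun p hp => ?_
    rw [← Finset.HasAntidiagonal.mem_antidiagonal.1 hp]
    push_cast
    rw [add_mul, eC_add]; ring

lemma MFS.sub {w : ℕ} {a b : ℂ} {f g : ℂ → ℂ} (hf : MFS w a f) (hg : MFS w b g) :
    MFS w (a - b) (fun τ => f τ - g τ) := by
  refine ⟨hf.holo.sub hg.holo, fun M τ h => ?_, ?_⟩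
  · rw [hf.transf M τ h, hg.transf M τ h]; ring
  · obtain ⟨c, c0, hc⟩ := hf.ser
    obtain ⟨d, d0, hd⟩ := hg.ser
    refine ⟨fun n => c n - d n, by simp [c0, d0], fun τ h => ?_⟩
    simpa [sub_mul] using (hc τ h).sub (hd τ h)

lemma E_transf {k : ℕ} (hk : 3 ≤ k) (f : ℂ → ℂ)
    (hf : ∀ z : UpperHalfPlane, f z = ModularForm.E hk z)
    (M : Matrix.SpecialLinearGroup (Fin 2) ℤ) (τ : ℂ) (h : UHP τ) :
      f ((Ma M * τ + Mb M) / (Mc M * τ + Md M)) = (Mc M * τ + Md M) ^ k * f τ := by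
  have h1 := hf (M • (⟨τ, h⟩ : UpperHalfPlane))
  rw [UpperHalfPlane.specialLinearGroup_apply] at h1
  have h2 := SlashInvariantForm.slash_action_eqn' (ModularForm.E hk)
    (show Matrix.SpecialLinearGroup.mapGL ℝ M ∈ (Matrix.SpecialLinearGroup.mapGL ℝ).range from ⟨M, rfl⟩) ⟨τ, h⟩
  have h3 := hf ⟨τ, h⟩
  have h4 : (Matrix.SpecialLinearGroup.mapGL ℝ M) • (⟨τ, h⟩ : UpperHalfPlane) = M • (⟨τ, h⟩ : UpperHalfPlane) := rfl
  rw [h4, ← hf, ← hf, UpperHalfPlane.specialLinearGroup_apply] at h2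
  simpa [Ma, Mb, Mc, Md] using h2

lemma E_holo {k : ℕ} (hk : 3 ≤ k) (f : ℂ → ℂ)
    (hf : ∀ z : UpperHalfPlane, f z = ModularForm.E hk z) :
    DifferentiableOn ℂ f {τ | UHP τ} := by
  have h1 := UpperHalfPlane.mdifferentiable_iff.1 (ModularFormClass.holo (ModularForm.E hk))
  refine h1.congr ?_
  intro z hz
  have := hf ⟨z, hz⟩
  simp only [Function.comp]
  rw [UpperHalfPlane.ofComplex_apply_of_im_pos hz]
  exact this

lemma sig_summable {k : ℕ} (hk : 1 ≤ k) (z : ℂ) (hz : UHP z) :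
    Summable fun n : ℕ => ((ArithmeticFunction.sigma (k-1)) n : ℂ) * eC ((n : ℂ) * z) := by
  have := EisensteinSeries.summable_sigma_mul_cexp_pow hk ⟨z, hz⟩
  refine this.congr fun n => ?_
  rw [eC_nat_mul]; rfl

lemma E_ser {k : ℕ} (hk : 3 ≤ k) (hk2 : Even k) (z : UpperHalfPlane) (C : ℂ) (hC : C = - (2 * k / bernoulli k)) :
    ModularForm.E hk z = 1 + C * ∑' n : ℕ, ((ArithmeticFunction.sigma (k-1)) n : ℂ) * eC ((n : ℂ) * z) := by
  rw [EisensteinSeries.q_expansion_bernoulli hk hk2, hC, ← tsum_zero_pnat_eq_tsum_nat]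
  · simp [eC_nat_mul]
    simp [eC]
    ring
  · exact sig_summable (by omega) _ z.2

lemma E4C_eq (z : UpperHalfPlane) : E4C z = ModularForm.E₄ z := by
  have := E_ser (k := 4) (by norm_num) ⟨2, rfl⟩ z 240
    (by rw [show bernoulli 4 = -1 / 30 by decide +kernel]; norm_num)
  rw [this]; rfl

lemma E6C_eq (z : UpperHalfPlane) : E6C z = ModularForm.E₆ z := by
  have := E_ser (k := 6) (by norm_num) ⟨3, rfl⟩ z (-504)
    (by rw [show bernoulli 6 = 1 / 42 by decide +kernel]; norm_num)
  rw [this]; simp [E6C, sub_eq_add_neg]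

lemma one_add_ser (C : ℂ) (s : ℕ → ℂ) (s0 : s 0 = 0) (τ : ℂ) (h : Summable fun n : ℕ => s n * eC (n * τ)) :
    HasSum (fun n : ℕ => (if n = 0 then 1 else C * s n) * eC (n * τ)) (1 + C * ∑' n, s n * eC (n * τ)) := by
  have h1 := (hasSum_ite_eq (0:ℕ) (1:ℂ)).add (h.hasSum.mul_left C)
  refine h1.congr_fun fun n => ?_
  by_cases hn : n = 0
  · subst hn; simp [s0, eC_zero]
  · simp [hn, mul_assoc]

lemma E4C_MFS : MFS 4 1 E4C := by
  refine ⟨E_holo _ _ E4C_eq, E_transf _ _ E4C_eq, _, ?_, fun τ h => one_add_ser _ _ ?_ τ (sig_summable (k := 4) (by norm_num) τ h)⟩ <;> simp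

lemma E6C_MFS : MFS 6 1 E6C := by
  refine ⟨E_holo _ _ E6C_eq, E_transf _ _ E6C_eq, fun n => if n = 0 then 1 else (-504) * ((ArithmeticFunction.sigma 5) n : ℂ), ?_, fun τ h => ?_⟩
  rotate_left
  · have := one_add_ser (-504) (fun n => ((ArithmeticFunction.sigma 5) n : ℂ)) (by simp) τ (sig_summable (k := 6) (by norm_num) τ h)
    rw [neg_mul, ← sub_eq_add_neg] at this
    exact this
  · simp

/-- The cusp form `E₄³ - E₆²`. -/
def DD (τ : ℂ) : ℂ := E4C τ * (E4C τ * E4C τ) - E6C τ * E6C τ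

lemma DD_MFS : MFS 12 0 DD := by
  have := (E4C_MFS.mul (E4C_MFS.mul E4C_MFS)).sub (E6C_MFS.mul E6C_MFS)
  norm_num at this
  exact this

lemma DD_eq (z : UpperHalfPlane) : DD z = 1728 * ModularForm.discriminant z := by
  rw [ModularForm.discriminant_eq_E₄_cube_sub_E₆_sq, DD, E4C_eq, E6C_eq]; ring

lemma DD_ne {τ : ℂ} (h : UHP τ) : DD τ ≠ 0 := by
  have := DD_eq ⟨τ, h⟩
  change DD τ = _ at this
  rw [this]
  exact mul_ne_zero (by norm_num) (ModularForm.discriminant_ne_zero _)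

lemma DD_add_one {τ : ℂ} (h : UHP τ) : DD (τ + 1) = DD τ := by
  have := DD_MFS.transf ModularGroup.T τ h
  simpa [Ma, Mb, Mc, Md, ModularGroup.T] using this

lemma eC_add_one (τ : ℂ) : eC (τ + 1) = eC τ := by
  rw [eC_add]; have := eC_int 1; simp at this; simp [this]

lemma DD_low : ∃ C Y : ℝ, 0 < C ∧ ∀ τ : ℂ, UHP τ → Y ≤ τ.im → Real.exp (-2 * Real.pi * τ.im) ≤ C * ‖DD τ‖ := by
  obtain ⟨C, hC, h⟩ := (ModularForm.exp_isBigO_discriminant).exists_pos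
  rw [Asymptotics.IsBigOWith, Filter.Eventually, UpperHalfPlane.atImInfty_mem] at h
  obtain ⟨Y, hY⟩ := h
  refine ⟨C, Y, hC, fun τ hτ hy => ?_⟩
  have := hY ⟨τ, hτ⟩ hy
  have h2 := DD_eq ⟨τ, hτ⟩
  change DD τ = _ at h2
  rw [h2, norm_mul]
  simp only [Set.mem_ofPred_eq, Real.norm_eq_abs, Real.abs_exp] at this
  refine this.trans ?_
  gcongr
  rw [show ‖(1728:ℂ)‖ = 1728 by norm_num]
  nlinarith [norm_nonneg (ModularForm.discriminant ⟨τ, hτ⟩)]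

/-- The `q`-expansion of `q/DD`. -/
lemma DD_inv_ser : ∃ g : ℕ → ℂ, ∀ τ, UHP τ → HasSum (fun n => g n * eC (n * τ)) (eC τ / DD τ) := by
  let f : UpperHalfPlane → ℂ := fun z => eC z / DD z
  have hper : Function.Periodic (f ∘ UpperHalfPlane.ofComplex) ((1:ℝ):ℂ) := by
    intro w
    by_cases hw : 0 < w.im
    · have h2 : 0 < (w + (1:ℝ)).im := by simpa using hw
      simp only [Function.comp, UpperHalfPlane.ofComplex_apply_of_im_pos hw, UpperHalfPlane.ofComplex_apply_of_im_pos h2, f]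
      simp [eC_add_one, DD_add_one hw]
    · have h2 : (w + (1:ℝ)).im ≤ 0 := by simpa using hw
      simp only [Function.comp, UpperHalfPlane.ofComplex_apply_of_im_nonpos h2, UpperHalfPlane.ofComplex_apply_of_im_nonpos (not_lt.1 hw)]
  have hhol : DifferentiableOn ℂ (f ∘ UpperHalfPlane.ofComplex) {z | 0 < z.im} := by
    have : DifferentiableOn ℂ (fun z => eC z / DD z) {z | UHP z} :=
      differentiable_eC.differentiableOn.div DD_MFS.holo (fun z hz => DD_ne hz)
    refine this.congr fun z hz => ?_
    simp only [Function.comp, f]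
    rw [UpperHalfPlane.ofComplex_apply_of_im_pos hz]
  have hbd : UpperHalfPlane.IsBoundedAtImInfty f := by
    rw [UpperHalfPlane.isBoundedAtImInfty_iff]
    obtain ⟨C, Y, hC, h⟩ := DD_low
    refine ⟨C, Y, fun z hz => ?_⟩
    have := h z z.2 hz
    simp only [f, norm_div, norm_eC]
    rw [div_le_iff₀ (norm_pos_iff.2 (DD_ne z.2))]
    exact this
  refine ⟨fun n => (UpperHalfPlane.qExpansion 1 f).coeff n, fun τ hτ => ?_⟩
  have := UpperHalfPlane.hasSum_qExpansion one_pos hper (UpperHalfPlane.mdifferentiable_iff.2 hhol) hbd ⟨τ, hτ⟩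
  refine this.congr_fun fun n => ?_
  rw [eC_nat_mul]
  simp [Function.Periodic.qParam, eC]

lemma int_eC (N : ℤ) : ∫ x in (0:ℝ)..1, eC (N * x) = if N = 0 then 1 else 0 := by
  split_ifs with h
  · subst h; simp [eC_zero]
  · have h2 : (2 * (Real.pi : ℂ) * I * N) ≠ 0 := by
      have : (N:ℂ) ≠ 0 := by exact_mod_cast h
      simp [Real.pi_ne_zero, this]
    have := integral_exp_mul_complex (a := 0) (b := 1) h2
    unfold eC
    simp_rw [← mul_assoc]
    rw [this]
    have h3 := eC_int N
    unfold eC at h3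
    simp [h3]

lemma ext1 {ι : Type} [Countable ι] (c : ι → ℂ) (hc : Summable c) (ν : ι → ℤ) (F : ℝ → ℂ)
    (h : ∀ x : ℝ, HasSum (fun i => c i * eC (ν i * x)) (F x)) (N : ℤ) :
    HasSum (fun i => if ν i = N then c i else 0) (∫ x in (0:ℝ)..1, F x * eC (-N * x)) := by
  let f : ι → C(ℝ, ℂ) := fun i => ⟨fun x => c i * eC ((ν i - N : ℤ) * x), by
    have := differentiable_eC.continuous; fun_prop⟩
  have hs : Summable fun i => ‖(f i).restrict (⟨Set.uIcc (0:ℝ) 1, isCompact_uIcc⟩ : TopologicalSpace.Compacts ℝ)‖ := by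
    refine Summable.of_nonneg_of_le (fun _ => norm_nonneg _) (fun i => ?_) hc.norm
    rw [ContinuousMap.norm_le _ (norm_nonneg _)]
    intro x
    simp [f, norm_eC]
  have h1 := intervalIntegral.hasSum_intervalIntegral_of_summable_norm hs
  have h2 : ∀ i, ∫ x in (0:ℝ)..1, f i x = if ν i = N then c i else 0 := by
    intro i
    simp only [f, ContinuousMap.coe_mk, intervalIntegral.integral_const_mul, int_eC]
    simp [sub_eq_zero]
  simp_rw [h2] at h1
  convert! h1 using 3 with x
  refine (((h x).mul_right (eC (-N * x))).congr_fun fun i => ?_).tsum_eq.symm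
  simp only [f, ContinuousMap.coe_mk]
  rw [mul_assoc, ← eC_add]; push_cast; ring_nf

/-- `Φ` is the sum of the family of exponentials. -/
def FS {ι : Type} (c : ι → ℂ) (n a b : ι → ℤ) (Φ : ℂ → ℂ → ℂ → ℂ) : Prop :=
  ∀ τ u v : ℂ, UHP τ → HasSum (fun i => c i * eC (n i * τ + a i * u + b i * v)) (Φ τ u v)

/-- Fourier coefficients by integration. -/
def coef (Φ : ℂ → ℂ → ℂ → ℂ) (n a b : ℤ) : ℂ :=
  (∫ x in (0:ℝ)..1, (∫ y in (0:ℝ)..1, (∫ z in (0:ℝ)..1, Φ (x + I) y z * eC (-b * z)) * eC (-a * y)) * eC (-n * x))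
    * eC (-n * I)

lemma FS.coef {ι : Type} [Countable ι] {c : ι → ℂ} {n a b : ι → ℤ} {Φ : ℂ → ℂ → ℂ → ℂ}
    (h : FS c n a b Φ) (n' a' b' : ℤ) :
    HasSum (fun i => if n i = n' ∧ a i = a' ∧ b i = b' then c i else 0) (coef Φ n' a' b') := by
  have hx : ∀ x : ℝ, UHP (x + I) := fun x => by simp [UHP]
  have h1 : ∀ x y : ℝ, HasSum (fun i => (if b i = b' then c i * eC (n i * (x + I)) else 0) * eC (a i * y))
      (∫ z in (0:ℝ)..1, Φ (x + I) y z * eC (-b' * z)) := by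
    intro x y
    have := ext1 (fun i => c i * eC (n i * (x + I) + a i * y)) (by
      simpa using (h (x + I) y 0 (hx x)).summable) b (fun z => Φ (x + I) y z) (fun z => by
        refine (h (x + I) y z (hx x)).congr_fun fun i => ?_
        rw [mul_assoc, ← eC_add]) b'
    refine this.congr_fun fun i => ?_
    split_ifs
    · rw [eC_add]; ring
    · simp
  have h2 : ∀ x : ℝ, HasSum (fun i => (if a i = a' ∧ b i = b' then c i * eC (n i * I) else 0) * eC (n i * x))
      (∫ y in (0:ℝ)..1, (∫ z in (0:ℝ)..1, Φ (x + I) y z * eC (-b' * z)) * eC (-a' * y)) := by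
    intro x
    have := ext1 (fun i => (if b i = b' then c i * eC (n i * (x + I)) else 0)) (by
      simpa [eC_zero] using (h1 x 0).summable) a _ (h1 x) a'
    refine this.congr_fun fun i => ?_
    by_cases h1 : a i = a' <;> by_cases h2 : b i = b' <;> simp [h1, h2]
    rw [mul_add, eC_add]; ring
  have h3 := ext1 _ (by simpa [eC_zero] using (h2 0).summable) n _ h2 n'
  have h4 := h3.mul_right (eC (-n' * I))
  refine h4.congr_fun fun i => ?_
  by_cases h1 : a i = a' <;> by_cases h2 : b i = b' <;> by_cases h3 : n i = n' <;> simp [h1, h2, h3]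
  rw [mul_assoc, ← eC_add]; simp [eC_zero]

/-- Hermitian Jacobi forms in the coordinates `u, v`. -/
structure IsK (k m : ℕ) (Φ : ℂ → ℂ → ℂ → ℂ) : Prop where
  holo : DifferentiableOn ℂ (fun p : ℂ × ℂ × ℂ => Φ p.1 p.2.1 p.2.2) {p | UHP p.1}
  modu : ∀ M : Matrix.SpecialLinearGroup (Fin 2) ℤ, ∀ τ u v : ℂ, UHP τ →
      Φ ((Ma M * τ + Mb M) / (Mc M * τ + Md M)) (u / (Mc M * τ + Md M)) (v / (Mc M * τ + Md M))
      = (Mc M * τ + Md M) ^ k * eC ((m : ℂ) * Mc M * (u ^ 2 + v ^ 2) / (Mc M * τ + Md M)) * Φ τ u v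
  rot : ∀ τ u v : ℂ, UHP τ → Φ τ v (-u) = I ^ k * Φ τ u v
  ell : ∀ p p' q q' : ℤ, ∀ τ u v : ℂ, UHP τ →
      Φ τ (u + p * τ + p') (v + q * τ + q')
      = eC (-(m : ℂ) * (((p : ℂ) ^ 2 + (q : ℂ) ^ 2) * τ + 2 * p * u + 2 * q * v)) * Φ τ u v
  four : ∃ c : ℕ → ℤ → ℤ → ℂ,
      (∀ (n : ℕ) (a b : ℤ), 4 * (n : ℤ) * m < a ^ 2 + b ^ 2 → c n a b = 0) ∧
      FS (fun p : ℕ × ℤ × ℤ => c p.1 p.2.1 p.2.2) (fun p => p.1) (fun p => p.2.1) (fun p => p.2.2) Φ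

def toK (φ : ℂ → ℂ → ℂ → ℂ) : ℂ → ℂ → ℂ → ℂ := fun τ u v => φ τ (u - I * v) (u + I * v)
def ofK (Φ : ℂ → ℂ → ℂ → ℂ) : ℂ → ℂ → ℂ → ℂ := fun τ z₁ z₂ => Φ τ ((z₁ + z₂) / 2) (I * (z₁ - z₂) / 2)

lemma cI2 (u v : ℂ) : (u - I * v) * (u + I * v) = u ^ 2 + v ^ 2 := by
  ring_nf; simp

lemma toK_ofK (Φ : ℂ → ℂ → ℂ → ℂ) : toK (ofK Φ) = Φ := by
  funext τ u v
  simp only [toK, ofK]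
  congr 1
  · ring
  · ring_nf; simp

lemma ofK_toK (Φ : ℂ → ℂ → ℂ → ℂ) : ofK (toK Φ) = Φ := by
  funext τ u v
  simp only [toK, ofK]
  congr 1
  · ring_nf; simp; ring
  · ring_nf; simp; ring

lemma IsHJF.toK {k m : ℕ} {φ : ℂ → ℂ → ℂ → ℂ} (h : IsHJF k m φ) : IsK k m (toK φ) where
  holo := by
    have h1 : Differentiable ℂ (fun p : ℂ × ℂ × ℂ => (p.1, p.2.1 - I * p.2.2, p.2.1 + I * p.2.2)) := by fun_prop
    exact h.holo.comp h1.differentiableOn (fun p hp => hp)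
  modu M τ u v hτ := by
    have := h.transf 1 (by simp) M τ (u - I * v) (u + I * v) hτ
    simp only [_root_.toK]
    simp only [one_mul, map_one, one_pow] at this
    convert! this using 2
    · ring
    · ring
    · rw [← cI2]; ring_nf
  rot τ u v hτ := by
    have := h.transf I (by simp) 1 τ (u - I * v) (u + I * v) hτ
    simp [Ma, Mb, Mc, Md, eC_zero] at this
    simp only [_root_.toK]
    rw [← this]
    congr 1
    · ring_nf; simp
    · ring_nf; simp
  ell p p' q q' τ u v hτ := by
    have := h.ellip p (-q) p' (-q') τ (u - I * v) (u + I * v) hτ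
    simp only [_root_.toK]
    convert! this using 2
    · push_cast; ring
    · push_cast; ring
    · congr 1; push_cast; ring_nf; simp; ring
  four := by
    obtain ⟨c, h0, hc⟩ := h.fourier
    refine ⟨c, h0, fun τ u v hτ => (hc τ _ _ hτ).congr_fun fun i => ?_⟩
    congr 2
    push_cast; ring_nf; simp

lemma IsK.ofK {k m : ℕ} {Φ : ℂ → ℂ → ℂ → ℂ} (h : IsK k m Φ) : IsHJF k m (ofK Φ) where
  holo := by
    have h1 : Differentiable ℂ (fun p : ℂ × ℂ × ℂ => (p.1, (p.2.1 + p.2.2)/2, I * (p.2.1 - p.2.2)/2)) := by fun_prop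
    exact h.holo.comp h1.differentiableOn (fun p hp => hp)
  transf := by
    have h1 : ∀ M : Matrix.SpecialLinearGroup (Fin 2) ℤ, ∀ τ z₁ z₂ : ℂ, UHP τ →
        _root_.ofK Φ ((Ma M * τ + Mb M) / (Mc M * τ + Md M)) (z₁ / (Mc M * τ + Md M)) (z₂ / (Mc M * τ + Md M))
          = (Mc M * τ + Md M) ^ k * eC ((m : ℂ) * Mc M * z₁ * z₂ / (Mc M * τ + Md M)) * _root_.ofK Φ τ z₁ z₂ := by
      intro M τ z₁ z₂ hτ
      have := h.modu M τ ((z₁ + z₂) / 2) (I * (z₁ - z₂) / 2) hτ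
      simp only [_root_.ofK]
      convert! this using 2
      · ring
      · ring
      · congr 2; ring_nf; simp; ring
    have h2 : ∀ τ z₁ z₂, UHP τ → _root_.ofK Φ τ (I * z₁) (-I * z₂) = I ^ k * _root_.ofK Φ τ z₁ z₂ := by
      intro τ z₁ z₂ hτ
      have := h.rot τ ((z₁ + z₂) / 2) (I * (z₁ - z₂) / 2) hτ
      simp only [_root_.ofK]
      rw [← this]
      congr 1
      · ring
      · ring_nf; simp; ring
    have h3 : ∀ τ z₁ z₂, UHP τ → _root_.ofK Φ τ (-1 * z₁) (-1 * z₂) = (-1) ^ k * _root_.ofK Φ τ z₁ z₂ := by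
      intro τ z₁ z₂ hτ
      have := h2 τ (I * z₁) (-I * z₂) hτ
      rw [h2 τ z₁ z₂ hτ, ← mul_assoc, ← mul_assoc, ← mul_assoc, ← mul_pow] at this
      simpa using this
    have h4 : ∀ τ z₁ z₂, UHP τ → _root_.ofK Φ τ (-I * z₁) (I * z₂) = (-I) ^ k * _root_.ofK Φ τ z₁ z₂ := by
      intro τ z₁ z₂ hτ
      have := h3 τ (I * z₁) (-I * z₂) hτ
      rw [h2 τ z₁ z₂ hτ, ← mul_assoc, ← mul_assoc, ← mul_assoc, ← mul_pow] at this
      simpa using this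
    intro ε hε M τ z₁ z₂ hτ
    rw [h1 M τ _ _ hτ]
    simp only [Set.mem_insert_iff, Set.mem_singleton_iff] at hε
    rcases hε with rfl | rfl | rfl | rfl
    · simp
    · simp only [map_neg, map_one]
      rw [h3 _ _ _ hτ]; ring_nf
    · simp only [conj_I]
      rw [h2 _ _ _ hτ]; ring_nf; simp; left; ring
    · simp only [map_neg, conj_I, neg_neg]
      rw [h4 _ _ _ hτ]; ring_nf; simp; left; ring
  ellip p q u v τ z₁ z₂ hτ := by
    have := h.ell p u (-q) (-v) τ ((z₁ + z₂) / 2) (I * (z₁ - z₂) / 2) hτ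
    simp only [_root_.ofK]
    convert! this using 2
    · ring
    · push_cast; ring_nf; simp; ring
    · push_cast; congr 1; ring_nf
  fourier := by
    obtain ⟨c, h0, hc⟩ := h.four
    refine ⟨c, h0, fun τ u v hτ => (hc τ _ _ hτ).congr_fun fun i => ?_⟩
    congr 2
    push_cast; ring_nf

abbrev Z3 := ℤ × ℤ × ℤ

/-- full Fourier series with coefficients `c`. -/
abbrev FZ (c : ℤ → ℤ → ℤ → ℂ) (Φ : ℂ → ℂ → ℂ → ℂ) : Prop :=
  FS (fun p : Z3 => c p.1 p.2.1 p.2.2) (fun p => p.1) (fun p => p.2.1) (fun p => p.2.2) Φ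

lemma FS.coef_eq_single {ι : Type} [Countable ι] {c : ι → ℂ} {n a b : ι → ℤ} {Φ : ℂ → ℂ → ℂ → ℂ}
    (h : FS c n a b Φ) (i₀ : ι) (hi : ∀ i, n i = n i₀ → a i = a i₀ → b i = b i₀ → c i ≠ 0 → i = i₀) :
    _root_.coef Φ (n i₀) (a i₀) (b i₀) = c i₀ := by
  have h1 := h.coef (n i₀) (a i₀) (b i₀)
  have h2 := hasSum_single (f := fun i => if n i = n i₀ ∧ a i = a i₀ ∧ b i = b i₀ then c i else 0) i₀ (by
    intro i hne
    by_contra h3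
    rw [ite_eq_right_iff] at h3
    push Not at h3
    exact hne (hi i h3.1.1 h3.1.2.1 h3.1.2.2 h3.2))
  have := h1.unique h2
  simpa using this

lemma FS.coef_eq_zero {ι : Type} [Countable ι] {c : ι → ℂ} {n a b : ι → ℤ} {Φ : ℂ → ℂ → ℂ → ℂ}
    (h : FS c n a b Φ) {n' a' b' : ℤ} (hi : ∀ i, c i ≠ 0 → ¬ (n i = n' ∧ a i = a' ∧ b i = b')) :
    _root_.coef Φ n' a' b' = 0 := by
  have h1 := h.coef n' a' b'
  refine h1.unique ?_
  convert! hasSum_zero with i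
  rw [ite_eq_right_iff]
  intro h2
  by_contra h3
  exact hi i h3 h2

lemma FZ.coef {c : ℤ → ℤ → ℤ → ℂ} {Φ : ℂ → ℂ → ℂ → ℂ} (h : FZ c Φ) (n a b : ℤ) :
    _root_.coef Φ n a b = c n a b :=
  FS.coef_eq_single h (n, a, b) (by rintro ⟨x, y, z⟩ h1 h2 h3 _; simp_all)

lemma FS.toFZ {ι : Type} [Countable ι] {c : ι → ℂ} {n a b : ι → ℤ} {Φ : ℂ → ℂ → ℂ → ℂ}
    (h : FS c n a b Φ) : FZ (_root_.coef Φ) Φ := by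
  intro τ u v hτ
  let ν : ι → Z3 := fun i => (n i, a i, b i)
  have h1 := h τ u v hτ
  rw [← (Equiv.sigmaFiberEquiv ν).hasSum_iff] at h1
  refine h1.sigma ?_
  rintro ⟨n', a', b'⟩
  have h2 := (h.coef n' a' b').mul_right (eC (n' * τ + a' * u + b' * v))
  have h3 := (hasSum_subtype_iff_indicator (f := fun i => c i * eC (n i * τ + a i * u + b i * v))
    (s := {i | ν i = (n', a', b')}) (a := _root_.coef Φ n' a' b' * eC (n' * τ + a' * u + b' * v))).2 (by
      refine h2.congr_fun fun i => ?_
      simp only [Set.indicator, Set.mem_ofPred_eq, ν, Prod.mk.injEq]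
      split_ifs with hi
      · rw [hi.1, hi.2.1, hi.2.2]
      · simp)
  exact h3

lemma four_of {ι : Type} [Countable ι] {c : ι → ℂ} {n a b : ι → ℤ} {Φ : ℂ → ℂ → ℂ → ℂ} {m : ℕ} (hm : 0 < m)
    (h : FS c n a b Φ) (hs : ∀ i, c i ≠ 0 → a i ^ 2 + b i ^ 2 ≤ 4 * n i * m) :
    ∃ c : ℕ → ℤ → ℤ → ℂ,
      (∀ (n : ℕ) (a b : ℤ), 4 * (n : ℤ) * m < a ^ 2 + b ^ 2 → c n a b = 0) ∧
      FS (fun p : ℕ × ℤ × ℤ => c p.1 p.2.1 p.2.2) (fun p => p.1) (fun p => p.2.1) (fun p => p.2.2) Φ := by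
  refine ⟨fun n a b => coef Φ n a b, fun n' a' b' h1 => h.coef_eq_zero fun i hi => ?_, fun τ u v hτ => ?_⟩
  · rintro ⟨rfl', rfl, rfl⟩
    have := hs i hi
    rw [rfl'] at this
    omega
  · have h1 := h.toFZ τ u v hτ
    have hinj : Function.Injective (fun p : ℕ × ℤ × ℤ => ((p.1 : ℤ), p.2.1, p.2.2)) := by
      rintro ⟨x, y, z⟩ ⟨x', y', z'⟩ h; simpa using h
    rw [← hinj.hasSum_iff] at h1
    · exact h1
    · rintro ⟨n', a', b'⟩ h2
      have : coef Φ n' a' b' = 0 := h.coef_eq_zero fun i hi => by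
        rintro ⟨rfl, rfl, rfl⟩
        have h3 := hs i hi
        have h4 : 0 ≤ n i := by
          have : (0:ℤ) < m := by exact_mod_cast hm
          by_contra h5
          nlinarith [sq_nonneg (a i), sq_nonneg (b i)]
        exact h2 ⟨((n i).toNat, a i, b i), by simp [h4]⟩
      simp [this]

lemma IsK.fz {k m : ℕ} {Φ : ℂ → ℂ → ℂ → ℂ} (h : IsK k m Φ) : FZ (coef Φ) Φ := by
  obtain ⟨c, _, h2⟩ := h.four
  exact h2.toFZ

lemma IsK.supp {k m : ℕ} {Φ : ℂ → ℂ → ℂ → ℂ} (h : IsK k m Φ) {n a b : ℤ}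
    (hn : 4 * n * m < a ^ 2 + b ^ 2) : coef Φ n a b = 0 := by
  obtain ⟨c, h1, h2⟩ := h.four
  refine h2.coef_eq_zero ?_
  rintro ⟨n', a', b'⟩ hc ⟨rfl, rfl, rfl⟩
  exact hc (h1 _ _ _ hn)

lemma IsK.supp' {k m : ℕ} {Φ : ℂ → ℂ → ℂ → ℂ} (h : IsK k m Φ) {n a b : ℤ}
    (hn : coef Φ n a b ≠ 0) : a ^ 2 + b ^ 2 ≤ 4 * n * m := by
  by_contra h1
  exact hn (h.supp (not_le.1 h1))

lemma IsK.coef_shift {k m : ℕ} {Φ : ℂ → ℂ → ℂ → ℂ} (h : IsK k m Φ) (p q n a b : ℤ) :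
    coef Φ (n + p * a + q * b + m * (p ^ 2 + q ^ 2)) (a + 2 * m * p) (b + 2 * m * q) = coef Φ n a b := by
  have h1 : FS (fun x : Z3 => coef Φ x.1 x.2.1 x.2.2)
      (fun x => x.1 + p * x.2.1 + q * x.2.2 + m * (p ^ 2 + q ^ 2)) (fun x => x.2.1 + 2 * m * p)
      (fun x => x.2.2 + 2 * m * q) Φ := by
    intro τ u v hτ
    have h2 := h.fz τ (u + p * τ) (v + q * τ) hτ
    have h3 := h.ell p 0 q 0 τ u v hτ
    simp only [Int.cast_zero, add_zero] at h3
    rw [h3] at h2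
    have h4 := h2.mul_left (eC ((m : ℂ) * (((p : ℂ) ^ 2 + (q : ℂ) ^ 2) * τ + 2 * p * u + 2 * q * v)))
    rw [← mul_assoc, ← eC_add, neg_mul, add_neg_cancel, eC_zero, one_mul] at h4
    refine h4.congr_fun fun x => ?_
    rw [mul_left_comm, ← eC_add]
    congr 2
    push_cast; ring
  refine h1.coef_eq_single (n, a, b) ?_
  rintro ⟨x, y, z⟩ h2 h3 h4 _
  simp at h2 h3 h4
  subst h3 h4
  simp at h2
  simp [h2]

lemma IsK.coef_rot {k m : ℕ} {Φ : ℂ → ℂ → ℂ → ℂ} (h : IsK k m Φ) (n a b : ℤ) :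
    I ^ k * coef Φ n (-b) a = coef Φ n a b := by
  have h1 : FZ (fun n a b => I ^ k * coef Φ n a b) (fun τ u v => I ^ k * Φ τ u v) := by
    intro τ u v hτ
    simpa [mul_assoc] using (h.fz τ u v hτ).mul_left (I ^ k)
  have h2 : FS (fun x : Z3 => coef Φ x.1 x.2.1 x.2.2) (fun x => x.1) (fun x => -x.2.2) (fun x => x.2.1)
      (fun τ u v => I ^ k * Φ τ u v) := by
    intro τ u v hτ
    have h2 := h.fz τ v (-u) hτ
    rw [h.rot τ u v hτ] at h2
    refine h2.congr_fun fun x => ?_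
    congr 2
    push_cast; ring
  rw [← FZ.coef h1]
  refine h2.coef_eq_single (n, a, b) ?_
  rintro ⟨x, y, z⟩ h2 h3 h4 _
  simp at h2 h3 h4
  simp [*]

lemma FS.mulser {ι : Type} {c : ι → ℂ} {n a b : ι → ℤ} {Φ : ℂ → ℂ → ℂ → ℂ} (h : FS c n a b Φ)
    {f : ℂ → ℂ} {g : ℕ → ℂ} (hg : ∀ τ, UHP τ → HasSum (fun j : ℕ => g j * eC (j * τ)) (f τ)) :
    FS (fun x : ℕ × ι => g x.1 * c x.2) (fun x => x.1 + n x.2) (fun x => a x.2) (fun x => b x.2)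
      (fun τ u v => f τ * Φ τ u v) := by
  intro τ u v hτ
  have h1 := hg τ hτ
  have h2 := h τ u v hτ
  have h3 := summable_mul_of_summable_norm h1.summable.norm h2.summable.norm
  refine (h1.mul h2 h3).congr_fun fun x => ?_
  push_cast
  rw [add_mul, add_assoc, add_assoc, eC_add, ← add_assoc]; ring

lemma IsK.mul {k m w : ℕ} (hm : 0 < m) {f0 : ℂ} {f : ℂ → ℂ} {Φ : ℂ → ℂ → ℂ → ℂ} (h : IsK k m Φ)
    (hf : MFS w f0 f) (hw : I ^ w = 1) : IsK (k + w) m (fun τ u v => f τ * Φ τ u v) where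
  holo := by
    have : DifferentiableOn ℂ (fun p : ℂ × ℂ × ℂ => f p.1) {p | UHP p.1} :=
      hf.holo.comp (differentiable_fst.differentiableOn) (fun p hp => hp)
    exact this.mul h.holo
  modu M τ u v hτ := by rw [hf.transf M τ hτ, h.modu M τ u v hτ]; ring
  rot τ u v hτ := by rw [h.rot τ u v hτ, pow_add, hw]; ring
  ell p p' q q' τ u v hτ := by rw [h.ell p p' q q' τ u v hτ]; ring
  four := by
    obtain ⟨g, _, hg⟩ := hf.ser
    refine four_of hm (h.fz.mulser hg) ?_
    rintro ⟨j, n, a, b⟩ hc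
    have := h.supp' (right_ne_zero_of_mul hc)
    have h2 : (0:ℤ) ≤ 4 * j * m := by positivity
    simp only at this ⊢
    nlinarith

lemma IsK.coef_mul {k m w : ℕ} {f0 : ℂ} {f : ℂ → ℂ} {Φ : ℂ → ℂ → ℂ → ℂ} (h : IsK k m Φ)
    (hf : MFS w f0 f) {n a b : ℤ} (hn : ∀ n' < n, coef Φ n' a b = 0) :
    coef (fun τ u v => f τ * Φ τ u v) n a b = f0 * coef Φ n a b := by
  obtain ⟨g, hg0, hg⟩ := hf.ser
  have h1 := (h.fz.mulser hg)
  have h2 := h1.coef_eq_single (0, n, a, b) ?_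
  · simpa [hg0] using h2
  · rintro ⟨j, n', a', b'⟩ h3 h4 h5 hc
    simp at h3 h4 h5 hc
    subst h4 h5
    have : j = 0 := by
      by_contra hj
      exact hc.2 (hn n' (by omega))
    subst this
    simp at h3
    simp [h3]

lemma IsK.div {k m : ℕ} (hm : 0 < m) {Φ : ℂ → ℂ → ℂ → ℂ} (h : IsK (k + 12) m Φ)
    (hc : ∀ n a b : ℤ, 4 * (n - 1) * m < a ^ 2 + b ^ 2 → coef Φ n a b = 0) :
    IsK k m (fun τ u v => Φ τ u v / DD τ) where
  holo := by
    have : DifferentiableOn ℂ (fun p : ℂ × ℂ × ℂ => DD p.1) {p | UHP p.1} :=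
      DD_MFS.holo.comp (differentiable_fst.differentiableOn) (fun p hp => hp)
    simp_rw [div_eq_mul_inv]
    exact h.holo.mul (this.inv (fun p hp => DD_ne hp))
  modu M τ u v hτ := by
    rw [DD_MFS.transf M τ hτ, h.modu M τ u v hτ]
    have h1 := M_den_ne M hτ
    have h2 := DD_ne hτ
    field_simp
    ring
  rot τ u v hτ := by
    rw [h.rot τ u v hτ, pow_add, show I ^ 12 = 1 by rw [show 12 = 4 * 3 by rfl, pow_mul, I_pow_four, one_pow]]; ring
  ell p p' q q' τ u v hτ := by rw [h.ell p p' q q' τ u v hτ]; ring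
  four := by
    obtain ⟨g, hg⟩ := DD_inv_ser
    have h1 : FS (fun p : Z3 => coef Φ p.1 p.2.1 p.2.2) (fun p => p.1 - 1) (fun p => p.2.1) (fun p => p.2.2)
        (fun τ u v => eC (-τ) * Φ τ u v) := by
      intro τ u v hτ
      refine ((h.fz τ u v hτ).mul_left (eC (-τ))).congr_fun fun x => ?_
      rw [mul_left_comm, ← eC_add]; congr 2; push_cast; ring
    have h2 := h1.mulser hg
    have h3 : (fun τ u v => eC τ / DD τ * (eC (-τ) * Φ τ u v)) = (fun τ u v => Φ τ u v / DD τ) := by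
      funext τ u v
      rw [eC_neg]
      have := eC_ne τ
      field_simp
    rw [h3] at h2
    refine four_of hm h2 ?_
    rintro ⟨j, n, a, b⟩ hc'
    have := right_ne_zero_of_mul hc'
    have h4 : a ^ 2 + b ^ 2 ≤ 4 * (n - 1) * m := by
      by_contra h5
      exact this (hc _ _ _ (not_le.1 h5))
    have h2 : (0:ℤ) ≤ 4 * j * m := by positivity
    simp only at this ⊢
    nlinarith

lemma IsK.add {k m : ℕ} (hm : 0 < m) {Φ Ψ : ℂ → ℂ → ℂ → ℂ} (h : IsK k m Φ) (h' : IsK k m Ψ) :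
    IsK k m (Φ + Ψ) where
  holo := h.holo.add h'.holo
  modu M τ u v hτ := by simp only [Pi.add_apply]; rw [h.modu M τ u v hτ, h'.modu M τ u v hτ]; ring
  rot τ u v hτ := by simp only [Pi.add_apply]; rw [h.rot τ u v hτ, h'.rot τ u v hτ]; ring
  ell p p' q q' τ u v hτ := by
    simp only [Pi.add_apply]; rw [h.ell p p' q q' τ u v hτ, h'.ell p p' q q' τ u v hτ]; ring
  four := by
    have : FZ (fun n a b => coef Φ n a b + coef Ψ n a b) (Φ + Ψ) := fun τ u v hτ => by
      simpa [add_mul] using (h.fz τ u v hτ).add (h'.fz τ u v hτ)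
    refine four_of hm this ?_
    rintro ⟨n, a, b⟩ hc
    by_contra h1
    simp only [not_le] at h1
    simp [h.supp h1, h'.supp h1] at hc

lemma IsK.smul {k m : ℕ} (hm : 0 < m) {Φ : ℂ → ℂ → ℂ → ℂ} (t : ℂ) (h : IsK k m Φ) :
    IsK k m (t • Φ) where
  holo := h.holo.const_smul t
  modu M τ u v hτ := by simp only [Pi.smul_apply, smul_eq_mul]; rw [h.modu M τ u v hτ]; ring
  rot τ u v hτ := by simp only [Pi.smul_apply, smul_eq_mul]; rw [h.rot τ u v hτ]; ring
  ell p p' q q' τ u v hτ := by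
    simp only [Pi.smul_apply, smul_eq_mul]; rw [h.ell p p' q q' τ u v hτ]; ring
  four := by
    have : FZ (fun n a b => t * coef Φ n a b) (t • Φ) := fun τ u v hτ => by
      simpa [mul_assoc] using (h.fz τ u v hτ).mul_left t
    refine four_of hm this ?_
    rintro ⟨n, a, b⟩ hc
    exact h.supp' (right_ne_zero_of_mul hc)

lemma IsK.coef_add {k k' m : ℕ} {Φ Ψ : ℂ → ℂ → ℂ → ℂ} (h : IsK k m Φ) (h' : IsK k' m Ψ) (n a b : ℤ) :
    coef (Φ + Ψ) n a b = coef Φ n a b + coef Ψ n a b := by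
  have : FZ (fun n a b => coef Φ n a b + coef Ψ n a b) (Φ + Ψ) := fun τ u v hτ => by
      simpa [add_mul] using (h.fz τ u v hτ).add (h'.fz τ u v hτ)
  exact FZ.coef this n a b

lemma IsK.coef_smul {k m : ℕ} {Φ : ℂ → ℂ → ℂ → ℂ} (t : ℂ) (h : IsK k m Φ) (n a b : ℤ) :
    coef (t • Φ) n a b = t * coef Φ n a b := by
  have : FZ (fun n a b => t * coef Φ n a b) (t • Φ) := fun τ u v hτ => by
      simpa [mul_assoc] using (h.fz τ u v hτ).mul_left t
  exact FZ.coef this n a b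

lemma IsK.zero {k m : ℕ} (hm : 0 < m) : IsK k m 0 where
  holo := differentiableOn_const 0
  modu M τ u v hτ := by simp
  rot τ u v hτ := by simp
  ell p p' q q' τ u v hτ := by simp
  four := ⟨fun _ _ _ => 0, by simp, fun τ u v _ => by simp [hasSum_zero]⟩

/-- The space of forms of weight `k`. -/
def WK (m : ℕ) (hm : 0 < m) (k : ℕ) : Submodule ℂ (ℂ → ℂ → ℂ → ℂ) where
  carrier := {Φ | IsK k m Φ}
  add_mem' h h' := IsK.add hm h h'
  zero_mem' := IsK.zero hm
  smul_mem' t _ h := IsK.smul hm t h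

lemma mem_WK {m : ℕ} {hm : 0 < m} {k : ℕ} {Φ : ℂ → ℂ → ℂ → ℂ} : Φ ∈ WK m hm k ↔ IsK k m Φ := Iff.rfl

/-- The auxiliary function `e(m|x|²τ) Φ(τ, xτ+y)`. -/
def FV (m : ℕ) (Φ : ℂ → ℂ → ℂ → ℂ) (τ : ℂ) (x₁ x₂ y₁ y₂ : ℝ) : ℂ :=
  eC (m * (x₁ ^ 2 + x₂ ^ 2) * τ) * Φ τ (x₁ * τ + y₁) (x₂ * τ + y₂)

def hV (k m : ℕ) (Φ : ℂ → ℂ → ℂ → ℂ) (τ : ℂ) (x₁ x₂ y₁ y₂ : ℝ) : ℝ :=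
  ‖FV m Φ τ x₁ x₂ y₁ y₂‖ ^ 12 / ‖DD τ‖ ^ k

lemma norm_eC_real (r : ℝ) : ‖eC r‖ = 1 := by simp [norm_eC]

lemma hV_shift {k m : ℕ} {Φ : ℂ → ℂ → ℂ → ℂ} (h : IsK k m Φ) {τ : ℂ} (hτ : UHP τ) (x₁ x₂ y₁ y₂ : ℝ)
    (p q p' q' : ℤ) : hV k m Φ τ (x₁ + p) (x₂ + q) (y₁ + p') (y₂ + q') = hV k m Φ τ x₁ x₂ y₁ y₂ := by
  unfold hV
  congr 2
  unfold FV
  have h1 := h.ell p p' q q' τ (x₁ * τ + y₁) (x₂ * τ + y₂) hτ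
  have h2 : Φ τ (((x₁ + p : ℝ) : ℂ) * τ + ((y₁ + p' : ℝ) : ℂ)) (((x₂ + q : ℝ) : ℂ) * τ + ((y₂ + q' : ℝ) : ℂ))
    = Φ τ (x₁ * τ + y₁ + p * τ + p') (x₂ * τ + y₂ + q * τ + q') := by
    congr 1 <;> push_cast <;> ring
  rw [h2, h1, ← mul_assoc, ← eC_add]
  have h3 : (m:ℂ) * (((x₁ + p : ℝ) : ℂ) ^ 2 + ((x₂ + q : ℝ) : ℂ) ^ 2) * τ + -m * ((((p:ℂ) ^ 2 + (q:ℂ) ^ 2) * τ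
     + 2 * p * (x₁ * τ + y₁) + 2 * q * (x₂ * τ + y₂))) = m * (x₁ ^ 2 + x₂ ^ 2) * τ + ((-m * (2 * p * y₁ + 2 * q * y₂) : ℝ) : ℂ) := by
    push_cast; ring
  rw [h3, eC_add, norm_mul, norm_mul, norm_mul, norm_eC_real, mul_one]

lemma det_M (M : Matrix.SpecialLinearGroup (Fin 2) ℤ) : Ma M * Md M - Mb M * Mc M = 1 := by
  have := M.det_coe
  rw [Matrix.det_fin_two] at this
  unfold Ma Mb Mc Md
  exact_mod_cast this

lemma hV_mod {k m : ℕ} {Φ : ℂ → ℂ → ℂ → ℂ} (h : IsK k m Φ) {τ : ℂ} (hτ : UHP τ) (x₁ x₂ y₁ y₂ : ℝ)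
    (M : Matrix.SpecialLinearGroup (Fin 2) ℤ) :
    hV k m Φ ((Ma M * τ + Mb M) / (Mc M * τ + Md M))
      (M.1 1 1 * x₁ - M.1 1 0 * y₁) (M.1 1 1 * x₂ - M.1 1 0 * y₂)
      (-M.1 0 1 * x₁ + M.1 0 0 * y₁) (-M.1 0 1 * x₂ + M.1 0 0 * y₂) = hV k m Φ τ x₁ x₂ y₁ y₂ := by
  have hj := M_den_ne M hτ
  have hdet := det_M M
  have key : ‖FV m Φ ((Ma M * τ + Mb M) / (Mc M * τ + Md M))
      (M.1 1 1 * x₁ - M.1 1 0 * y₁) (M.1 1 1 * x₂ - M.1 1 0 * y₂)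
      (-M.1 0 1 * x₁ + M.1 0 0 * y₁) (-M.1 0 1 * x₂ + M.1 0 0 * y₂)‖ = ‖Mc M * τ + Md M‖ ^ k * ‖FV m Φ τ x₁ x₂ y₁ y₂‖ := by
    unfold FV
    have h1 := h.modu M τ (x₁ * τ + y₁) (x₂ * τ + y₂) hτ
    have e : ∀ x y : ℝ, ((M.1 1 1 * x - M.1 1 0 * y : ℝ) : ℂ) * ((Ma M * τ + Mb M) / (Mc M * τ + Md M))
        + ((-M.1 0 1 * x + M.1 0 0 * y : ℝ) : ℂ) = (x * τ + y) / (Mc M * τ + Md M) := by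
      intro x y
      push_cast
      change (Md M * x - Mc M * y) * ((Ma M*τ+Mb M)/(Mc M*τ+Md M)) + (-Mb M * x + Ma M * y) = (x*τ+y)/(Mc M*τ+Md M)
      field_simp
      linear_combination (x * τ + y) * hdet
    rw [e, e, h1]
    have e2 : (m : ℂ) * (((M.1 1 1 * x₁ - M.1 1 0 * y₁ : ℝ) : ℂ) ^ 2 + ((M.1 1 1 * x₂ - M.1 1 0 * y₂ : ℝ) : ℂ) ^ 2)
         * ((Ma M * τ + Mb M) / (Mc M * τ + Md M)) + m * Mc M * ((x₁ * τ + y₁) ^ 2 + (x₂ * τ + y₂) ^ 2) / (Mc M * τ + Md M)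
        = m * (x₁ ^ 2 + x₂ ^ 2) * τ + ((m * ((M.1 0 1 * M.1 1 1 * x₁ ^ 2 - 2 * M.1 0 1 * M.1 1 0 * x₁ * y₁ + M.1 0 0 * M.1 1 0 * y₁ ^ 2)
          + (M.1 0 1 * M.1 1 1 * x₂ ^ 2 - 2 * M.1 0 1 * M.1 1 0 * x₂ * y₂ + M.1 0 0 * M.1 1 0 * y₂ ^ 2)) : ℝ) : ℂ) := by
      push_cast
      change (m : ℂ) * ((Md M * x₁ - Mc M * y₁) ^ 2 + (Md M * x₂ - Mc M * y₂) ^ 2)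
         * ((Ma M * τ + Mb M) / (Mc M * τ + Md M)) + m * Mc M * ((x₁ * τ + y₁) ^ 2 + (x₂ * τ + y₂) ^ 2) / (Mc M * τ + Md M)
         = m * (x₁ ^ 2 + x₂ ^ 2) * τ + (m * ((Mb M * Md M * x₁ ^ 2 - 2 * Mb M * Mc M * x₁ * y₁ + Ma M * Mc M * y₁ ^ 2)
          + (Mb M * Md M * x₂ ^ 2 - 2 * Mb M * Mc M * x₂ * y₂ + Ma M * Mc M * y₂ ^ 2)))
      have hd : Mb M * Mc M = Ma M * Md M - 1 := by linear_combination -hdet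
      field_simp
      linear_combination (m:ℂ) * (τ * (Md M * (x₁^2+x₂^2) - 2 * Mc M * (x₁ * y₁ + x₂ * y₂)) - Mc M * (y₁^2+y₂^2)) * hdet
    rw [mul_comm (_ ^ k) (eC _), mul_assoc (eC _), ← mul_assoc, ← eC_add, e2, eC_add, norm_mul, norm_mul, norm_mul,
      norm_mul, norm_eC_real, norm_pow]
    ring
  unfold hV
  rw [key, DD_MFS.transf M τ hτ]
  simp only [norm_mul, norm_pow]
  have : ‖Mc M * τ + Md M‖ ≠ 0 := norm_ne_zero_iff.2 hj
  rw [mul_pow, mul_pow, ← pow_mul, ← pow_mul, mul_comm k 12, mul_div_mul_left]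
  exact pow_ne_zero _ this

lemma FV_decay {k m : ℕ} {Φ : ℂ → ℂ → ℂ → ℂ} (hm : 0 < m) (h : IsK k m Φ)
    (hc : ∀ n a b : ℤ, 4 * (n - 1) * m < a ^ 2 + b ^ 2 → coef Φ n a b = 0) :
    ∃ S : ℝ, 0 ≤ S ∧ ∀ (τ : ℂ) (x₁ x₂ y₁ y₂ : ℝ), 1 ≤ τ.im → x₁ ∈ Set.Icc (0:ℝ) 1 → x₂ ∈ Set.Icc (0:ℝ) 1 →
      ‖FV m Φ τ x₁ x₂ y₁ y₂‖ ≤ S * Real.exp (-2 * Real.pi * (τ.im - 1)) := by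
  have hI : UHP I := by simp [UHP]
  let t : Z3 → ℝ := fun p => ‖coef Φ p.1 p.2.1 p.2.2‖ * Real.exp (-2 * Real.pi * p.1) *
    ((1 + Real.exp (-2 * Real.pi * p.2.1)) * (1 + Real.exp (-2 * Real.pi * p.2.2)))
  have ht : Summable t := by
    have h1 := (h.fz I 0 0 hI).summable.norm
    have h2 := (h.fz I I 0 hI).summable.norm
    have h3 := (h.fz I 0 I hI).summable.norm
    have h4 := (h.fz I I I hI).summable.norm
    refine (((h1.add h2).add h3).add h4).congr fun p => ?_
    simp only [norm_mul, norm_eC, t]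
    simp only [add_im, mul_im, intCast_re, intCast_im, I_im, I_re, mul_zero, mul_one, add_zero, zero_im, zero_re]
    simp only [mul_add, Real.exp_add]
    ring
  refine ⟨∑' p, t p, tsum_nonneg fun p => by positivity, fun τ x₁ x₂ y₁ y₂ hτ h1 h2 => ?_⟩
  have hU : UHP τ := by unfold UHP; linarith
  have hs := (h.fz τ (x₁ * τ + y₁) (x₂ * τ + y₂) hU).mul_left (eC (m * (x₁ ^ 2 + x₂ ^ 2) * τ))
  change HasSum _ (FV m Φ τ x₁ x₂ y₁ y₂) at hs
  rw [← hs.tsum_eq]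
  refine tsum_of_norm_bounded (ht.hasSum.mul_right _) ?_
  rintro ⟨n, a, b⟩
  simp only
  by_cases h0 : coef Φ n a b = 0
  · simp [h0, t]
  have hE : (1:ℝ) ≤ n + a * x₁ + b * x₂ + m * (x₁ ^ 2 + x₂ ^ 2) := by
    have h3 : a ^ 2 + b ^ 2 ≤ 4 * (n - 1) * m := by
      by_contra h5
      exact h0 (hc _ _ _ (not_le.1 h5))
    have h4 : (a:ℝ) ^ 2 + (b:ℝ) ^ 2 ≤ 4 * (n - 1) * m := by exact_mod_cast h3
    have h5 : (0:ℝ) < m := by exact_mod_cast hm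
    have h6 : 0 ≤ 4 * m * ((n - 1) + a * x₁ + b * x₂ + m * (x₁ ^ 2 + x₂ ^ 2)) := by
      nlinarith [sq_nonneg (a + 2 * m * x₁), sq_nonneg (b + 2 * m * x₂)]
    have h7 := nonneg_of_mul_nonneg_right h6 (by positivity : (0:ℝ) < 4 * m)
    linarith
  set E : ℝ := n + a * x₁ + b * x₂ + m * (x₁ ^ 2 + x₂ ^ 2) with hEd
  have e1 : ‖eC (m * (x₁ ^ 2 + x₂ ^ 2) * τ) * (coef Φ n a b * eC (n * τ + a * (x₁ * τ + y₁) + b * (x₂ * τ + y₂)))‖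
     = ‖coef Φ n a b‖ * Real.exp (-2 * Real.pi * (E * τ.im)) := by
    rw [mul_left_comm, norm_mul, ← eC_add, norm_eC]
    have : (m * (x₁ ^ 2 + x₂ ^ 2) * τ + (n * τ + a * (x₁ * τ + y₁) + b * (x₂ * τ + y₂)) : ℂ) = (E : ℂ) * τ + ((a * y₁ + b * y₂ : ℝ) : ℂ) := by
      rw [hEd]; push_cast; ring
    rw [this, add_im, ofReal_im, add_zero, im_ofReal_mul]
  rw [e1]
  have e0 : t (n, a, b) * Real.exp (-2 * Real.pi * (τ.im - 1)) = ‖coef Φ n a b‖ * (Real.exp (-2 * Real.pi * n) * (((1 + Real.exp (-2 * Real.pi * a)) * (1 + Real.exp (-2 * Real.pi * b))) * Real.exp (-2 * Real.pi * (τ.im - 1)))) := by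
    simp only [t]; ring
  rw [e0]
  refine mul_le_mul_of_nonneg_left ?_ (norm_nonneg _)
  have hpi := Real.pi_pos
  have e2 : Real.exp (-2 * Real.pi * (E * τ.im)) ≤ Real.exp (-2 * Real.pi * E) * Real.exp (-2 * Real.pi * (τ.im - 1)) := by
    rw [← Real.exp_add]
    apply Real.exp_le_exp.2
    have : 0 ≤ 2 * Real.pi * ((E - 1) * (τ.im - 1)) := by
      have := mul_nonneg (sub_nonneg.2 hE) (sub_nonneg.2 hτ); positivity
    nlinarith
  have e3 : ∀ (a : ℝ) (x : ℝ), x ∈ Set.Icc (0:ℝ) 1 → Real.exp (-2 * Real.pi * (a * x)) ≤ 1 + Real.exp (-2 * Real.pi * a) := by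
    intro a x hx
    rcases le_total 0 a with ha | ha
    · have : Real.exp (-2 * Real.pi * (a * x)) ≤ 1 := by
        apply Real.exp_le_one_iff.2
        have := mul_nonneg ha hx.1
        nlinarith
      have := Real.exp_pos (-2 * Real.pi * a)
      linarith
    · have : Real.exp (-2 * Real.pi * (a * x)) ≤ Real.exp (-2 * Real.pi * a) := by
        apply Real.exp_le_exp.2
        have := mul_nonneg (neg_nonneg.2 ha) (sub_nonneg.2 hx.2)
        nlinarith
      linarith
  have e4 : Real.exp (-2 * Real.pi * E) ≤ Real.exp (-2 * Real.pi * n) * ((1 + Real.exp (-2 * Real.pi * a)) * (1 + Real.exp (-2 * Real.pi * b))) := by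
    have : Real.exp (-2 * Real.pi * E) ≤ Real.exp (-2 * Real.pi * n) * (Real.exp (-2 * Real.pi * (a * x₁)) * Real.exp (-2 * Real.pi * (b * x₂))) := by
      rw [← Real.exp_add, ← Real.exp_add]
      apply Real.exp_le_exp.2
      have : (0:ℝ) ≤ 2 * Real.pi * (m * (x₁ ^ 2 + x₂ ^ 2)) := by positivity
      rw [hEd]; nlinarith
    refine this.trans ?_
    gcongr
    · exact e3 _ _ h1
    · exact e3 _ _ h2
  refine e2.trans ?_
  rw [← mul_assoc]
  gcongr

lemma fd_red (τ : ℂ) (hτ : UHP τ) : ∃ M : Matrix.SpecialLinearGroup (Fin 2) ℤ,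
    |((Ma M * τ + Mb M) / (Mc M * τ + Md M)).re| ≤ 1 / 2 ∧ 1 / 2 ≤ ((Ma M * τ + Mb M) / (Mc M * τ + Md M)).im := by
  obtain ⟨g, hg⟩ := ModularGroup.exists_smul_mem_fd ⟨τ, hτ⟩
  have h1 := ModularGroup.three_le_four_mul_im_sq_of_mem_fd hg
  have h2 := hg.2
  have h3 := (g • (⟨τ, hτ⟩ : UpperHalfPlane)).im_pos
  have e : ((g • (⟨τ, hτ⟩ : UpperHalfPlane) : UpperHalfPlane) : ℂ) = (Ma g * τ + Mb g) / (Mc g * τ + Md g) := by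
    rw [UpperHalfPlane.coe_specialLinearGroup_apply]
    simp [Ma, Mb, Mc, Md]
  refine ⟨g, ?_, ?_⟩
  · rw [← e]; exact h2
  · rw [← e]; change 1 / 2 ≤ (g • (⟨τ, hτ⟩ : UpperHalfPlane)).im
    nlinarith

lemma hV_red {k m : ℕ} {Φ : ℂ → ℂ → ℂ → ℂ} (h : IsK k m Φ) {τ : ℂ} (hτ : UHP τ) (x₁ x₂ y₁ y₂ : ℝ) :
    ∃ (τ' : ℂ) (a b c d : ℝ), |τ'.re| ≤ 1 / 2 ∧ 1 / 2 ≤ τ'.im ∧ a ∈ Set.Icc (0:ℝ) 1 ∧ b ∈ Set.Icc (0:ℝ) 1 ∧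
      c ∈ Set.Icc (0:ℝ) 1 ∧ d ∈ Set.Icc (0:ℝ) 1 ∧ hV k m Φ τ' a b c d = hV k m Φ τ x₁ x₂ y₁ y₂ := by
  obtain ⟨M, h1, h2⟩ := fd_red τ hτ
  have h3 := hV_mod h hτ x₁ x₂ y₁ y₂ M
  set τ' := (Ma M * τ + Mb M) / (Mc M * τ + Md M)
  have hU : UHP τ' := UHP_smul M hτ
  have fr : ∀ x : ℝ, x + ((-⌊x⌋ : ℤ) : ℝ) ∈ Set.Icc (0:ℝ) 1 := by
    intro x
    push_cast
    constructor <;> linarith [Int.floor_le x, Int.lt_floor_add_one x]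
  rw [← h3]
  exact ⟨τ', _, _, _, _, h1, h2, fr _, fr _, fr _, fr _, hV_shift h hU _ _ _ _ _ _ _ _⟩

lemma hV_decay {k m : ℕ} {Φ : ℂ → ℂ → ℂ → ℂ} (hm : 0 < m) (hk : k < 12) (h : IsK k m Φ)
    (hc : ∀ n a b : ℤ, 4 * (n - 1) * m < a ^ 2 + b ^ 2 → coef Φ n a b = 0) (h0 : ℝ) (hh0 : 0 < h0) :
    ∃ Y : ℝ, 1 ≤ Y ∧ ∀ (τ : ℂ) (x₁ x₂ y₁ y₂ : ℝ), Y ≤ τ.im → x₁ ∈ Set.Icc (0:ℝ) 1 → x₂ ∈ Set.Icc (0:ℝ) 1 →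
      hV k m Φ τ x₁ x₂ y₁ y₂ < h0 := by
  obtain ⟨S, hS, h1⟩ := FV_decay hm h hc
  obtain ⟨C, Y0, hC, h2⟩ := DD_low
  have hpi := Real.pi_pos
  set Q := S ^ 12 * Real.exp (24 * Real.pi) * C ^ k with hQ
  have hQ0 : 0 ≤ Q := by positivity
  have h3 : Filter.Tendsto (fun y : ℝ => Q * Real.exp (-(2 * Real.pi * y))) Filter.atTop (nhds (Q * 0)) := by
    apply Filter.Tendsto.const_mul
    exact Real.tendsto_exp_neg_atTop_nhds_zero.comp (Filter.tendsto_id.const_mul_atTop (by positivity))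
  rw [mul_zero] at h3
  obtain ⟨Y1, hY1⟩ := Filter.eventually_atTop.1 (h3.eventually (gt_mem_nhds hh0))
  refine ⟨max 1 (max Y0 Y1), le_max_left _ _, fun τ x₁ x₂ y₁ y₂ hτ hx1 hx2 => ?_⟩
  have a1 : 1 ≤ τ.im := (le_max_left _ _).trans hτ
  have a2 : Y0 ≤ τ.im := ((le_max_left _ _).trans (le_max_right _ _)).trans hτ
  have a3 : Y1 ≤ τ.im := ((le_max_right _ _).trans (le_max_right _ _)).trans hτ
  have hU : UHP τ := by unfold UHP; linarith
  refine lt_of_le_of_lt ?_ (hY1 _ a3)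
  unfold hV
  have hD : 0 < ‖DD τ‖ := norm_pos_iff.2 (DD_ne hU)
  rw [div_le_iff₀ (by positivity)]
  have b1 := pow_le_pow_left₀ (norm_nonneg _) (h1 τ x₁ x₂ y₁ y₂ a1 hx1 hx2) 12
  have b2 := pow_le_pow_left₀ (Real.exp_pos _).le (h2 τ hU a2) k
  refine b1.trans ?_
  rw [mul_pow] at b2 ⊢
  rw [← Real.exp_nat_mul] at b2 ⊢
  have b3 : Real.exp ((12:ℕ) * (-2 * Real.pi * (τ.im - 1))) ≤ Real.exp (24 * Real.pi) * (Real.exp (-(2 * Real.pi * τ.im)) * Real.exp (k * (-2 * Real.pi * τ.im))) := by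
    rw [← Real.exp_add, ← Real.exp_add]
    apply Real.exp_le_exp.2
    have : (k:ℝ) + 1 ≤ 12 := by exact_mod_cast hk
    have h7 : 0 ≤ 2 * Real.pi * τ.im * (12 - (k + 1)) := mul_nonneg (by positivity) (by linarith)
    push_cast
    nlinarith
  calc S ^ 12 * Real.exp ((12:ℕ) * (-2 * Real.pi * (τ.im - 1))) ≤ S ^ 12 * (Real.exp (24 * Real.pi) * (Real.exp (-(2 * Real.pi * τ.im)) * Real.exp (k * (-2 * Real.pi * τ.im)))) := by gcongr
    _ ≤ S ^ 12 * (Real.exp (24 * Real.pi) * (Real.exp (-(2 * Real.pi * τ.im)) * (C ^ k * ‖DD τ‖ ^ k))) := by gcongr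
    _ = _ := by rw [hQ]; ring

lemma FV_cont {k m : ℕ} {Φ : ℂ → ℂ → ℂ → ℂ} (h : IsK k m Φ) :
    ContinuousOn (fun p : ℂ × ℝ × ℝ × ℝ × ℝ => hV k m Φ p.1 p.2.1 p.2.2.1 p.2.2.2.1 p.2.2.2.2) {p | UHP p.1} := by
  unfold hV
  apply ContinuousOn.div
  · apply ContinuousOn.pow
    apply ContinuousOn.norm
    unfold FV
    apply ContinuousOn.mul
    · have := differentiable_eC.continuous
      fun_prop
    · have := h.holo.continuousOn
      exact this.comp (f := fun p : ℂ × ℝ × ℝ × ℝ × ℝ => ((p.1, p.2.1 * p.1 + p.2.2.2.1, p.2.2.1 * p.1 + p.2.2.2.2) : ℂ × ℂ × ℂ)) (by fun_prop) (fun p hp => hp)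
  · apply ContinuousOn.pow
    apply ContinuousOn.norm
    exact DD_MFS.holo.continuousOn.comp continuousOn_fst (fun p hp => hp)
  · intro p hp
    exact pow_ne_zero _ (norm_ne_zero_iff.2 (DD_ne hp))

lemma IsK.vanish {k m : ℕ} {Φ : ℂ → ℂ → ℂ → ℂ} (hm : 0 < m) (hk : k < 12) (h : IsK k m Φ)
    (hc : ∀ n a b : ℤ, 4 * (n - 1) * m < a ^ 2 + b ^ 2 → coef Φ n a b = 0) (τ u v : ℂ) (hτ : UHP τ) :
    Φ τ u v = 0 := by
  by_contra hne
  have him : τ.im ≠ 0 := ne_of_gt hτ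
  have sol : ∀ u : ℂ, ∃ x y : ℝ, (x * τ + y : ℂ) = u := by
    intro u
    refine ⟨u.im / τ.im, u.re - u.im / τ.im * τ.re, ?_⟩
    apply Complex.ext
    · simp
    · simp only [add_im, ofReal_im, add_zero, im_ofReal_mul]
      field_simp
  obtain ⟨x₁, y₁, e1⟩ := sol u
  obtain ⟨x₂, y₂, e2⟩ := sol v
  set h0 := hV k m Φ τ x₁ x₂ y₁ y₂ with hh
  have hpos : 0 < h0 := by
    rw [hh]; unfold hV FV
    rw [e1, e2]
    exact div_pos (pow_pos (norm_pos_iff.2 (mul_ne_zero (eC_ne _) hne)) _) (pow_pos (norm_pos_iff.2 (DD_ne hτ)) _)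
  obtain ⟨Y, hY, hdec⟩ := hV_decay hm hk h hc h0 hpos
  let K : Set (ℂ × ℝ × ℝ × ℝ × ℝ) := (Set.Icc (-(1/2):ℝ) (1/2) ×ℂ Set.Icc (1/2) Y) ×ˢ Set.Icc (0:ℝ) 1 ×ˢ Set.Icc (0:ℝ) 1 ×ˢ Set.Icc (0:ℝ) 1 ×ˢ Set.Icc (0:ℝ) 1
  have hK : IsCompact K := (isCompact_Icc.reProdIm isCompact_Icc).prod (isCompact_Icc.prod (isCompact_Icc.prod (isCompact_Icc.prod isCompact_Icc)))
  have hKU : K ⊆ {p | UHP p.1} := by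
    intro p hp
    have := hp.1.2.1
    change (0:ℝ) < p.1.im
    exact lt_of_lt_of_le (by norm_num) this
  have red : ∀ (σ : ℂ) (a b c d : ℝ), UHP σ → h0 ≤ hV k m Φ σ a b c d → ∃ p ∈ K, hV k m Φ p.1 p.2.1 p.2.2.1 p.2.2.2.1 p.2.2.2.2 = hV k m Φ σ a b c d := by
    intro σ a b c d hσ hle
    obtain ⟨σ', a', b', c', d', r1, r2, r3, r4, r5, r6, r7⟩ := hV_red h hσ a b c d
    refine ⟨(σ', a', b', c', d'), ⟨⟨abs_le.1 r1, r2, ?_⟩, r3, r4, r5, r6⟩, r7⟩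
    by_contra hh
    have := hdec σ' a' b' c' d' (not_le.1 hh).le r3 r4
    linarith
  obtain ⟨p0, hp0, hp0'⟩ := red τ x₁ x₂ y₁ y₂ hτ le_rfl
  obtain ⟨p, hp, hmax⟩ := hK.exists_isMaxOn ⟨p0, hp0⟩ ((FV_cont h).mono hKU)
  have hge : h0 ≤ hV k m Φ p.1 p.2.1 p.2.2.1 p.2.2.2.1 p.2.2.2.2 := by
    have := hmax hp0
    simp only [Set.mem_ofPred_eq] at this
    rw [← hh] at hp0'
    linarith
  have hall : ∀ σ, UHP σ → hV k m Φ σ p.2.1 p.2.2.1 p.2.2.2.1 p.2.2.2.2 ≤ hV k m Φ p.1 p.2.1 p.2.2.1 p.2.2.2.1 p.2.2.2.2 := by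
    intro σ hσ
    by_cases hle : h0 ≤ hV k m Φ σ p.2.1 p.2.2.1 p.2.2.2.1 p.2.2.2.2
    · obtain ⟨q, hq, hq'⟩ := red σ _ _ _ _ hσ hle
      have := hmax hq
      simp only [Set.mem_ofPred_eq] at this
      linarith
    · linarith
  let f : ℂ → ℂ := fun σ => FV m Φ σ p.2.1 p.2.2.1 p.2.2.2.1 p.2.2.2.2 ^ 12 / DD σ ^ k
  have hf : ∀ σ, ‖f σ‖ = hV k m Φ σ p.2.1 p.2.2.1 p.2.2.2.1 p.2.2.2.2 := by
    intro σ; simp [f, hV]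
  have hfd : DifferentiableOn ℂ f {σ | UHP σ} := by
    apply DifferentiableOn.div
    · apply DifferentiableOn.pow
      unfold FV
      apply DifferentiableOn.mul
      · have := differentiable_eC
        fun_prop
      · exact h.holo.comp (f := fun σ : ℂ => ((σ, p.2.1 * σ + p.2.2.2.1, p.2.2.1 * σ + p.2.2.2.2) : ℂ × ℂ × ℂ)) (by fun_prop) (fun p hp => hp)
    · exact DD_MFS.holo.pow k
    · intro σ hσ; exact pow_ne_zero _ (DD_ne hσ)
  have hconn : IsPreconnected {σ : ℂ | UHP σ} := (convex_halfSpace_im_gt 0).isPreconnected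
  have heq := Complex.norm_eqOn_of_isPreconnected_of_isMaxOn hconn isOpen_UHP hfd (hKU hp)
    (by intro σ hσ; simp only [Set.mem_ofPred_eq, Function.comp, hf]; exact hall σ hσ)
  have hYU : UHP (Y * I) := by simp [UHP]; linarith
  have h5 := heq hYU
  simp only [Function.comp, Function.const, hf] at h5
  have h6 := hdec (Y * I) p.2.1 p.2.2.1 p.2.2.2.1 p.2.2.2.2 (by simp) hp.2.1 hp.2.2.1
  linarith

def good (m : ℕ) (Φ : ℂ → ℂ → ℂ → ℂ) (a b : ℤ) : Prop :=
  ∀ n : ℤ, 4 * (n - 1) * m < a ^ 2 + b ^ 2 → coef Φ n a b = 0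

lemma good_shift {k m : ℕ} {Φ : ℂ → ℂ → ℂ → ℂ} (h : IsK k m Φ) (p q : ℤ) {a b : ℤ} (hg : good m Φ a b) :
    good m Φ (a + 2 * m * p) (b + 2 * m * q) := by
  intro n hn
  have := h.coef_shift p q (n - (p * a + q * b + m * (p ^ 2 + q ^ 2))) a b
  rw [show n - (p * a + q * b + m * (p ^ 2 + q ^ 2)) + p * a + q * b + m * (p ^ 2 + q ^ 2) = n by ring] at this
  rw [this]
  apply hg
  nlinarith

lemma good_rot {k m : ℕ} {Φ : ℂ → ℂ → ℂ → ℂ} (h : IsK k m Φ) {a b : ℤ} (hg : good m Φ a b) :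
    good m Φ (-b) a := by
  intro n hn
  have h1 := h.coef_rot n a b
  rw [hg n (by nlinarith)] at h1
  exact (mul_eq_zero.1 h1).resolve_left (pow_ne_zero _ I_ne_zero)

lemma good_all {k m : ℕ} {Φ : ℂ → ℂ → ℂ → ℂ} (hm : 0 < m) (h : IsK k m Φ)
    (h1 : ∀ a b : ℤ, 1 ≤ a → a ≤ m → 0 ≤ b → b < m → good m Φ a b) (h0 : good m Φ 0 0) (h2 : good m Φ m m)
    (a b : ℤ) : good m Φ a b := by
  have hm' : (0:ℤ) < m := by exact_mod_cast hm
  have r2 : ∀ {a b : ℤ}, good m Φ a b → good m Φ (-a) (-b) := fun hg => good_rot h (good_rot h hg)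
  have r3 : ∀ {a b : ℤ}, good m Φ a b → good m Φ b (-a) := fun hg => by simpa using r2 (good_rot h hg)
  have base : ∀ a b : ℤ, -m < a → a ≤ m → -m < b → b ≤ m → good m Φ a b := by
    intro a b ha1 ha2 hb1 hb2
    rcases lt_trichotomy a 0 with ha | ha | ha
    · rcases le_or_gt b 0 with hb | hb
      · simpa using r2 (h1 (-a) (-b) (by omega) (by omega) (by omega) (by omega))
      · simpa using good_rot h (h1 b (-a) (by omega) (by omega) (by omega) (by omega))
    · subst ha
      rcases lt_trichotomy b 0 with hb | hb | hb
      · simpa using r3 (h1 (-b) 0 (by omega) (by omega) (by omega) (by omega))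
      · subst hb; exact h0
      · simpa using good_rot h (h1 b 0 (by omega) (by omega) (by omega) (by omega))
    · rcases lt_or_ge b 0 with hb | hb
      · rcases lt_or_eq_of_le ha2 with hl | rfl
        · simpa using r3 (h1 (-b) a (by omega) (by omega) (by omega) (by omega))
        · have := good_shift h 1 0 (r2 (h1 m (-b) (by omega) (by omega) (by omega) (by omega)))
          convert this using 1 <;> ring
      · rcases lt_or_eq_of_le hb2 with hl | rfl
        · exact h1 a b (by omega) (by omega) (by omega) (by omega)
        · rcases lt_or_eq_of_le ha2 with hl | rfl
          · have := good_shift h 0 1 (r3 (h1 m a (by omega) (by omega) (by omega) (by omega)))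
            convert this using 1 <;> ring
          · exact h2
  have cen : ∀ a : ℤ, ∃ a' p : ℤ, a = a' + 2 * m * p ∧ -m < a' ∧ a' ≤ m := by
    intro a
    have e := Int.emod_add_mul_ediv a (2 * m)
    have e1 := Int.emod_nonneg a (by omega : (2 * (m:ℤ)) ≠ 0)
    have e2 := Int.emod_lt_of_pos a (by omega : 0 < (2 * (m:ℤ)))
    by_cases hle : a % (2 * m) ≤ m
    · exact ⟨_, _, e.symm, by omega, hle⟩
    · refine ⟨a % (2 * m) - 2 * m, a / (2 * m) + 1, ?_, by omega, by omega⟩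
      linear_combination -e
  obtain ⟨a', p, rfl, ha1, ha2⟩ := cen a
  obtain ⟨b', q, rfl, hb1, hb2⟩ := cen b
  exact good_shift h p q (base a' b' ha1 ha2 hb1 hb2)

lemma good_00 {k m : ℕ} {Φ : ℂ → ℂ → ℂ → ℂ} (hk : k % 4 = 2) (h : IsK k m Φ) : good m Φ 0 0 := by
  intro n _
  have h1 := h.coef_rot n 0 0
  have : I ^ k = -1 := by
    rw [← Nat.div_add_mod k 4, hk, pow_add, pow_mul, I_pow_four, one_pow, I_sq, one_mul]
  rw [this, neg_zero] at h1
  have h2 : 2 * coef Φ n 0 0 = 0 := by linear_combination -h1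
  simpa using h2

lemma good_mm {k m : ℕ} {Φ : ℂ → ℂ → ℂ → ℂ} (hk : k % 4 = 2) (h : IsK k m Φ) : good m Φ m m := by
  intro n _
  have h1 := h.coef_rot n m m
  have : I ^ k = -1 := by
    rw [← Nat.div_add_mod k 4, hk, pow_add, pow_mul, I_pow_four, one_pow, I_sq, one_mul]
  have h3 := h.coef_shift 1 0 n (-m) m
  rw [show n + 1 * (-(m:ℤ)) + 0 * m + m * (1 ^ 2 + 0 ^ 2) = n by ring, show -(m:ℤ) + 2 * m * 1 = m by ring,
    show (m:ℤ) + 2 * m * 0 = m by ring] at h3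
  rw [this, ← h3] at h1
  have h2 : 2 * coef Φ n m m = 0 := by linear_combination -h1
  simpa using h2

/-- The least `n` with `a² + b² ≤ 4 n m`. -/
def nn (m : ℕ) (a b : ℤ) : ℤ := (a ^ 2 + b ^ 2 + 4 * m - 1) / (4 * m)

lemma nn_le {m : ℕ} (hm : 0 < m) (a b n : ℤ) : a ^ 2 + b ^ 2 ≤ 4 * n * m ↔ nn m a b ≤ n := by
  have hm' : (0:ℤ) < 4 * m := by positivity
  unfold nn
  rw [← Int.lt_add_one_iff (a := (a ^ 2 + b ^ 2 + 4 * m - 1) / (4 * m)), Int.ediv_lt_iff_lt_mul hm']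
  constructor <;> intro h <;> nlinarith

lemma good_of_nn {k m : ℕ} {Φ : ℂ → ℂ → ℂ → ℂ} (hm : 0 < m) (h : IsK k m Φ) {a b : ℤ}
    (h0 : coef Φ (nn m a b) a b = 0) : good m Φ a b := by
  intro n hn
  rcases lt_trichotomy n (nn m a b) with h1 | h1 | h1
  · apply h.supp
    rw [← not_le] at h1 ⊢
    rwa [nn_le hm]
  · rwa [h1]
  · have := (nn_le hm a b (n - 1)).2 (by omega)
    omega

/-- Index set of representatives. -/
abbrev RepS (m c : ℕ) : Type := (Fin m × Fin m) ⊕ Fin (if c = 0 then 2 else 0)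

def rp (m c : ℕ) : RepS m c → ℤ × ℤ
  | .inl (i, j) => (i + 1, j)
  | .inr t => if t.1 = 0 then (0, 0) else (m, m)

def LL (m c : ℕ) (Φ : ℂ → ℂ → ℂ → ℂ) (s : RepS m c) : ℂ :=
  coef Φ (nn m (rp m c s).1 (rp m c s).2) (rp m c s).1 (rp m c s).2

lemma LL_good {k m c : ℕ} {Φ : ℂ → ℂ → ℂ → ℂ} (hm : 0 < m) (hc : c = 0 ∨ c = 2) (hk : k % 4 = c) (h : IsK k m Φ)
    (h0 : LL m c Φ = 0) (n a b : ℤ) (hn : 4 * (n - 1) * m < a ^ 2 + b ^ 2) : coef Φ n a b = 0 := by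
  have hs : ∀ s, good m Φ (rp m c s).1 (rp m c s).2 := fun s => good_of_nn hm h (congrFun h0 s)
  refine good_all hm h ?_ ?_ ?_ a b n hn
  · intro a b h1 h2 h3 h4
    have := hs (.inl (⟨(a - 1).toNat, by omega⟩, ⟨b.toNat, by omega⟩))
    simp only [rp] at this
    convert this using 1
    · omega
    · omega
  · rcases hc with rfl | rfl
    · exact hs (.inr ⟨0, by simp⟩)
    · exact good_00 hk h
  · rcases hc with rfl | rfl
    · exact hs (.inr ⟨1, by simp⟩)
    · exact good_mm hk h

lemma RepS_card (m c : ℕ) : Fintype.card (RepS m c) = m ^ 2 + if c = 0 then 2 else 0 := by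
  simp [RepS, sq]

lemma LL_mul {k m w c : ℕ} (hm : 0 < m) {f0 : ℂ} {f : ℂ → ℂ} {Φ : ℂ → ℂ → ℂ → ℂ} (h : IsK k m Φ)
    (hf : MFS w f0 f) : LL m c (fun τ u v => f τ * Φ τ u v) = f0 • LL m c Φ := by
  ext s
  refine h.coef_mul hf fun n' hn' => h.supp ?_
  rw [← not_le] at hn' ⊢
  rwa [nn_le hm]

lemma coef_congr {Φ Ψ : ℂ → ℂ → ℂ → ℂ} (h : ∀ τ u v, UHP τ → Φ τ u v = Ψ τ u v) : coef Φ = coef Ψ := by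
  ext n a b
  unfold coef
  have : ∀ x y z : ℝ, Φ (x + I) y z = Ψ (x + I) y z := fun x y z => h _ _ _ (by simp [UHP])
  simp only [this]

lemma LL_congr {m c : ℕ} {Φ Ψ : ℂ → ℂ → ℂ → ℂ} (h : ∀ τ u v, UHP τ → Φ τ u v = Ψ τ u v) : LL m c Φ = LL m c Ψ := by
  unfold LL; rw [coef_congr h]

def LW (m : ℕ) (hm : 0 < m) (c k : ℕ) : WK m hm k →ₗ[ℂ] (RepS m c → ℂ) where
  toFun Φ := LL m c Φ.1
  map_add' Φ Ψ := by ext s; exact IsK.coef_add Φ.2 Ψ.2 _ _ _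
  map_smul' t Φ := by ext s; exact IsK.coef_smul t Φ.2 _ _ _

lemma adapted {V : Type} [AddCommGroup V] [Module ℂ V] [FiniteDimensional ℂ V] (U : ℕ → Submodule ℂ V)
    (hU : Monotone U) : ∃ (n : ℕ) (e : Fin n → V) (d : Fin n → ℕ), n ≤ Module.finrank ℂ V ∧
      LinearIndependent ℂ e ∧ (∀ i, e i ∈ U (d i)) ∧
      ∀ j, ∀ x ∈ U j, ∃ a : Fin n → ℂ, (∀ i, j < d i → a i = 0) ∧ x = ∑ i, a i • e i := by
  let P : ℕ → Set V → Prop := fun j s => LinearIndepOn ℂ id s ∧ s ⊆ U j ∧ (U j : Set V) ⊆ Submodule.span ℂ s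
  have base : ∃ s, P 0 s := by
    obtain ⟨b, h1, h2, h3, h4⟩ := exists_linearIndepOn_id_extension (K := ℂ) (s := (∅ : Set V)) (t := U 0) (by simp) (by simp)
    exact ⟨b, h4, h1, h3⟩
  have step : ∀ j s, P j s → ∃ s', P (j + 1) s' ∧ s ⊆ s' := by
    intro j s hs
    obtain ⟨b, h1, h2, h3, h4⟩ := exists_linearIndepOn_id_extension (K := ℂ) (s := s) (t := U (j+1)) hs.1
      (hs.2.1.trans (hU (Nat.le_succ j)))
    exact ⟨b, ⟨h4, h1, h3⟩, h2⟩
  obtain ⟨s0, hs0⟩ := base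
  choose nxt hn1 hn2 using step
  let B : ∀ j, {s // P j s} := fun j => Nat.rec (motive := fun j => {s // P j s}) ⟨s0, hs0⟩ (fun j s => ⟨nxt j s.1 s.2, hn1 j s.1 s.2⟩) j
  have hB : Monotone fun j => (B j).1 := monotone_nat_of_le_succ fun j => hn2 j (B j).1 (B j).2
  let S : Set V := ⋃ j, (B j).1
  have hS : LinearIndepOn ℂ id S := linearIndepOn_iUnion_of_directed hB.directed_le (fun j => (B j).2.1)
  have hSli : LinearIndependent ℂ (fun x : S => (x : V)) := hS
  have : Finite S := hSli.finite
  have : Fintype S := Fintype.ofFinite S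
  have hd : ∀ x : S, ∃ j, x.1 ∈ (B j).1 := fun x => Set.mem_iUnion.1 x.2
  classical
  let d : S → ℕ := fun x => Nat.find (hd x)
  let eq := Fintype.equivFin S
  refine ⟨Fintype.card S, fun i => (eq.symm i).1, fun i => d (eq.symm i), hSli.fintype_card_le_finrank, ?_, ?_, ?_⟩
  · exact hSli.comp _ eq.symm.injective
  · intro i
    exact (B _).2.2.1 (Nat.find_spec (hd (eq.symm i)))
  · intro j x hx
    have h1 := (B j).2.2.2 hx
    have h2 : (B j).1 = (fun x : S => (x : V)) '' {x | x.1 ∈ (B j).1} := by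
      ext y
      simp only [Set.mem_image, Set.mem_ofPred_eq]
      constructor
      · intro hy; exact ⟨⟨y, Set.mem_iUnion.2 ⟨j, hy⟩⟩, hy, rfl⟩
      · rintro ⟨z, hz, rfl⟩; exact hz
    rw [h2] at h1
    obtain ⟨l, hl1, hl2⟩ := (Finsupp.mem_span_image_iff_linearCombination ℂ).1 h1
    refine ⟨fun i => l (eq.symm i), fun i hi => ?_, ?_⟩
    · by_contra hne
      have h3 : (eq.symm i).1 ∈ (B j).1 := hl1 (by simpa using hne)
      have h4 := Nat.find_min' (hd (eq.symm i)) h3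
      simp only [d] at hi
      omega
    · rw [← hl2, Finsupp.linearCombination_apply, Finsupp.sum_fintype _ _ (by simp)]
      exact (Equiv.sum_comp eq.symm (fun x : S => l x • (x:V))).symm

/-- Weight `k - v` polynomials in `E₄` and `X`. -/
def QQ (X : ℂ → ℂ) (v k : ℕ) : Submodule ℂ (ℂ → ℂ) :=
  Submodule.span ℂ {f | ∃ a b : ℕ, 4 * a + 12 * b + v = k ∧ f = fun τ => E4C τ ^ a * X τ ^ b}

lemma QQ_mono {X : ℂ → ℂ} {v k : ℕ} (a b : ℕ) (h : 4 * a + 12 * b + v = k) : (fun τ => E4C τ ^ a * X τ ^ b) ∈ QQ X v k :=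
  Submodule.subset_span ⟨a, b, h, rfl⟩

lemma QQ_conv {X : ℂ → ℂ} {v k : ℕ} (b : ℕ) : ∀ (a c : ℕ) (_ : 4 * a + 12 * b + 12 * c + v = k),
    (fun τ => E4C τ ^ a * (E4C τ ^ 3 - X τ) ^ b * X τ ^ c) ∈ QQ X v k := by
  induction b with
  | zero =>
    intro a c h
    simpa using QQ_mono (X := X) a c (by omega)
  | succ b ih =>
    intro a c h
    have h1 := ih (a + 3) c (by omega)
    have h2 := ih a (c + 1) (by omega)
    have h3 := Submodule.sub_mem _ h1 h2
    convert! h3 using 1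
    ext τ
    simp only [Pi.sub_apply]
    ring

lemma E6_eq (τ : ℂ) : E6C τ ^ 2 = E4C τ ^ 3 - DD τ := by unfold DD; ring

lemma DD_eq' (τ : ℂ) : DD τ = E4C τ ^ 3 - E6C τ ^ 2 := by unfold DD; ring

lemma QQ_eq (v k : ℕ) : QQ (fun τ => E6C τ ^ 2) v k = QQ DD v k := by
  apply le_antisymm
  · apply Submodule.span_le.2
    rintro f ⟨a, b, h, rfl⟩
    have := QQ_conv (X := DD) (v := v) (k := k) b a 0 (by omega)
    simpa [E6_eq] using this
  · apply Submodule.span_le.2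
    rintro f ⟨a, b, h, rfl⟩
    have := QQ_conv (X := fun τ => E6C τ ^ 2) (v := v) (k := k) b a 0 (by omega)
    simpa [DD_eq'] using this

lemma poly_iff (v k : ℕ) (f : ℂ → ℂ) : IsE4E6sqPoly v k f ↔ ∃ g ∈ QQ DD v k, ∀ τ, UHP τ → f τ = g τ := by
  rw [← QQ_eq]
  constructor
  · rintro ⟨lam, h⟩
    refine ⟨fun τ => ∑ p ∈ (Finset.range (k + 1) ×ˢ Finset.range (k + 1)).filter
        (fun p => 4 * p.1 + 12 * p.2 + v = k), lam p * E4C τ ^ p.1 * E6C τ ^ (2 * p.2), ?_, h⟩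
    have : (fun τ => ∑ p ∈ (Finset.range (k + 1) ×ˢ Finset.range (k + 1)).filter
        (fun p => 4 * p.1 + 12 * p.2 + v = k), lam p * E4C τ ^ p.1 * E6C τ ^ (2 * p.2)) =
        ∑ p ∈ (Finset.range (k + 1) ×ˢ Finset.range (k + 1)).filter
        (fun p => 4 * p.1 + 12 * p.2 + v = k), lam p • (fun τ => E4C τ ^ p.1 * (E6C τ ^ 2) ^ p.2) := by
      ext τ
      simp [Finset.sum_apply, pow_mul, mul_assoc]
    rw [this]
    refine Submodule.sum_mem _ fun p hp => Submodule.smul_mem _ _ (QQ_mono _ _ (Finset.mem_filter.1 hp).2)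
  · rintro ⟨g, hg, hfg⟩
    suffices IsE4E6sqPoly v k g by
      obtain ⟨lam, h⟩ := this
      exact ⟨lam, fun τ hτ => (hfg τ hτ).trans (h τ hτ)⟩
    clear hfg
    induction hg using Submodule.span_induction with
    | mem f hf =>
      obtain ⟨a, b, h, rfl⟩ := hf
      refine ⟨fun p => if p = (a, b) then 1 else 0, fun τ _ => ?_⟩
      rw [Finset.sum_eq_single (a, b)]
      · simp [pow_mul]
      · intro p _ hp; simp [hp]
      · intro hn; exfalso; apply hn
        simp; omega
    | zero => exact ⟨0, fun τ _ => by simp⟩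
    | add f g _ _ hf hg =>
      obtain ⟨l, hl⟩ := hf
      obtain ⟨l', hl'⟩ := hg
      refine ⟨l + l', fun τ hτ => ?_⟩
      rw [Pi.add_apply, hl τ hτ, hl' τ hτ, ← Finset.sum_add_distrib]
      exact Finset.sum_congr rfl fun p _ => by simp only [Pi.add_apply]; ring
    | smul t f _ hf =>
      obtain ⟨l, hl⟩ := hf
      refine ⟨t • l, fun τ hτ => ?_⟩
      rw [Pi.smul_apply, hl τ hτ, smul_eq_mul, Finset.mul_sum]
      exact Finset.sum_congr rfl fun p _ => by simp only [Pi.smul_apply, smul_eq_mul]; ring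

lemma QQ_DD {v k : ℕ} {f : ℂ → ℂ} (h : f ∈ QQ DD v k) : (fun τ => DD τ * f τ) ∈ QQ DD v (k + 12) := by
  induction h using Submodule.span_induction with
  | mem f hf =>
    obtain ⟨a, b, h, rfl⟩ := hf
    convert! QQ_mono (X := DD) (v := v) (k := k + 12) a (b + 1) (by omega) using 1
    ext τ; ring
  | zero =>
    convert! Submodule.zero_mem _ using 1
    ext τ; simp
  | add f g _ _ hf hg =>
    convert! Submodule.add_mem _ hf hg using 1
    ext τ; simp; ring
  | smul t f _ hf =>
    convert! Submodule.smul_mem _ t hf using 1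
    ext τ; simp; ring

lemma QQ_dec {v k : ℕ} {f : ℂ → ℂ} (h : f ∈ QQ DD v k) : ∃ (α : ℂ) (f' : ℂ → ℂ), (k < v → α = 0) ∧
    (k < 12 → f' = 0) ∧ f' ∈ QQ DD v (k - 12) ∧ f = fun τ => α * E4C τ ^ ((k - v) / 4) + DD τ * f' τ := by
  induction h using Submodule.span_induction with
  | mem f hf =>
    obtain ⟨a, b, h, rfl⟩ := hf
    rcases b with _ | b
    · refine ⟨1, 0, fun _ => by omega, fun _ => rfl, Submodule.zero_mem _, ?_⟩
      ext τ
      rw [show (k - v) / 4 = a by omega]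
      simp
    · refine ⟨0, fun τ => E4C τ ^ a * DD τ ^ b, fun _ => rfl, fun _ => by omega, QQ_mono _ _ (by omega), ?_⟩
      ext τ; ring
  | zero => exact ⟨0, 0, fun _ => rfl, fun _ => rfl, Submodule.zero_mem _, by ext; simp⟩
  | add f g _ _ hf hg =>
    obtain ⟨a, f', h1, h2, h3, rfl⟩ := hf
    obtain ⟨b, g', h1', h2', h3', rfl⟩ := hg
    refine ⟨a + b, f' + g', fun h => by rw [h1 h, h1' h, add_zero], fun h => by rw [h2 h, h2' h, add_zero],
      Submodule.add_mem _ h3 h3', ?_⟩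
    ext τ; simp; ring
  | smul t f _ hf =>
    obtain ⟨a, f', h1, h2, h3, rfl⟩ := hf
    refine ⟨t * a, t • f', fun h => by rw [h1 h, mul_zero], fun h => by rw [h2 h, smul_zero],
      Submodule.smul_mem _ _ h3, ?_⟩
    ext τ; simp; ring

lemma MFS.one : MFS 0 1 (fun _ => 1) := by
  refine ⟨differentiableOn_const _, fun M τ h => by simp, fun n => if n = 0 then 1 else 0, by simp, fun τ _ => ?_⟩
  convert! hasSum_ite_eq (0:ℕ) (1:ℂ) using 1
  ext n
  by_cases hn : n = 0
  · simp [hn, eC_zero]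
  · simp [hn]

lemma MFS.pow {w : ℕ} {a : ℂ} {f : ℂ → ℂ} (hf : MFS w a f) (n : ℕ) : MFS (w * n) (a ^ n) (fun τ => f τ ^ n) := by
  induction n with
  | zero => simpa using MFS.one
  | succ n ih => simpa [pow_succ, mul_add] using ih.mul hf

lemma I_pow4 (n : ℕ) : I ^ (4 * n) = 1 := by rw [pow_mul, I_pow_four, one_pow]

lemma QQ_mul {m v k : ℕ} (hm : 0 < m) {f : ℂ → ℂ} (h : f ∈ QQ DD v k) {Φ : ℂ → ℂ → ℂ → ℂ} (hΦ : IsK v m Φ) :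
    IsK k m (fun τ u v => f τ * Φ τ u v) := by
  induction h using Submodule.span_induction with
  | mem f hf =>
    obtain ⟨a, b, h, rfl⟩ := hf
    have h1 := hΦ.mul hm ((E4C_MFS.pow a).mul (DD_MFS.pow b)) (by
      rw [show 4 * a + 12 * b = 4 * (a + 3 * b) by ring]; exact I_pow4 _)
    rw [show v + (4 * a + 12 * b) = k by omega] at h1
    exact h1
  | zero =>
    convert! IsK.zero (k := k) hm using 1
    ext τ u v; simp
  | add f g _ _ hf hg =>
    convert! hf.add hm hg using 1
    ext τ u v; simp [add_mul]
  | smul t f _ hf =>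
    convert! hf.smul hm t using 1
    ext τ u v; simp [mul_assoc]

lemma sum_mem_IsK {m k n : ℕ} (hm : 0 < m) (F : Fin n → ℂ → ℂ → ℂ → ℂ) (h : ∀ i, IsK k m (F i)) : IsK k m (∑ i, F i) :=
  Submodule.sum_mem (WK m hm k) fun i _ => h i

lemma LL_sum {m k n c : ℕ} (hm : 0 < m) (F : Fin n → ℂ → ℂ → ℂ → ℂ) (h : ∀ i, IsK k m (F i)) :
    LL m c (∑ i, F i) = ∑ i, LL m c (F i) := by
  have := map_sum (LW m hm c k) (fun i => (⟨F i, h i⟩ : WK m hm k)) Finset.univ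
  simp only [LW, LinearMap.coe_mk, AddHom.coe_mk, AddSubmonoidClass.coe_finsetSum] at this
  exact this

lemma LL_smul {m k c : ℕ} (t : ℂ) {Φ : ℂ → ℂ → ℂ → ℂ} (h : IsK k m Φ) : LL m c (t • Φ) = t • LL m c Φ := by
  ext s; exact IsK.coef_smul t h _ _ _

lemma freeK (m : ℕ) (hm : 0 < m) (c : ℕ) (hc : c = 0 ∨ c = 2) :
    ∃ (n : ℕ) (w : Fin n → ℕ) (g : Fin n → ℂ → ℂ → ℂ → ℂ), n ≤ m ^ 2 + (if c = 0 then 2 else 0) ∧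
      (∀ i, w i % 4 = c ∧ IsK (w i) m (g i)) ∧
      (∀ k : ℕ, k % 4 = c → ∀ Φ, IsK k m Φ → ∃ f : Fin n → ℂ → ℂ, (∀ i, f i ∈ QQ DD (w i) k) ∧
        ∀ τ u v, UHP τ → Φ τ u v = ∑ i, f i τ * g i τ u v) ∧
      (∀ k : ℕ, k % 4 = c → ∀ f : Fin n → ℂ → ℂ, (∀ i, f i ∈ QQ DD (w i) k) →
        (∀ τ u v, UHP τ → ∑ i, f i τ * g i τ u v = 0) → ∀ i τ, UHP τ → f i τ = 0) := by
  have hc4 : c < 4 := by omega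
  let U : ℕ → Submodule ℂ (RepS m c → ℂ) := fun j => LinearMap.range (LW m hm c (4 * j + c))
  have hU : Monotone U := by
    apply monotone_nat_of_le_succ
    rintro j _ ⟨Φ, rfl⟩
    have h1 := Φ.2.mul hm E4C_MFS I_pow_four
    rw [show 4 * j + c + 4 = 4 * (j + 1) + c by ring] at h1
    refine ⟨⟨_, h1⟩, ?_⟩
    change LL m c _ = LL m c _
    rw [LL_mul hm Φ.2 E4C_MFS, one_smul]
  obtain ⟨n, e, d, hn, hli, hmem, hspan⟩ := adapted U hU
  have hlift : ∀ i, ∃ g : ℂ → ℂ → ℂ → ℂ, IsK (4 * d i + c) m g ∧ LL m c g = e i := by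
    intro i
    obtain ⟨g, hg⟩ := hmem i
    exact ⟨g.1, g.2, hg⟩
  choose g hg1 hg2 using hlift
  -- the lifts in higher weight
  have hE : ∀ (j : ℕ) (α : ℂ) (i : Fin n), (j < d i → α = 0) → IsK (4 * j + c) m (α • fun τ u v => E4C τ ^ (j - d i) * g i τ u v)
      ∧ LL m c (α • fun τ u v => E4C τ ^ (j - d i) * g i τ u v) = α • e i := by
    intro j α i h
    by_cases hj : j < d i
    · rw [h hj, zero_smul, zero_smul]
      refine ⟨IsK.zero hm, ?_⟩
      have := LL_smul (c := c) 0 (IsK.zero (k := 0) hm)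
      rwa [zero_smul, zero_smul] at this
    · have h1 := (hg1 i).mul hm (E4C_MFS.pow (j - d i)) (I_pow4 _)
      have h2 := LL_mul (c := c) hm (hg1 i) (E4C_MFS.pow (j - d i))
      rw [one_pow, one_smul, hg2] at h2
      rw [show 4 * d i + c + 4 * (j - d i) = 4 * j + c by omega] at h1
      refine ⟨h1.smul hm α, ?_⟩
      rw [LL_smul α h1, h2]
  have hcongr : ∀ {k : ℕ}, k % 4 = c → ∃ j, k = 4 * j + c := fun {k} h => ⟨k / 4, by omega⟩
  refine ⟨n, fun i => 4 * d i + c, g, ?_, fun i => ⟨by dsimp only; omega, hg1 i⟩, ?_, ?_⟩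
  · rw [Module.finrank_fintype_fun_eq_card, RepS_card] at hn
    exact hn
  · intro k hk
    obtain ⟨j, rfl⟩ := hcongr hk
    clear hk
    induction j using Nat.strong_induction_on with
    | _ j ih =>
    intro Φ hΦ
    obtain ⟨a, ha, hsum⟩ := hspan j (LL m c Φ) ⟨⟨Φ, hΦ⟩, rfl⟩
    let F : Fin n → ℂ → ℂ → ℂ → ℂ := fun i => a i • fun τ u v => E4C τ ^ (j - d i) * g i τ u v
    have hF := fun i => hE j (a i) i (ha i)
    let Ψ : ℂ → ℂ → ℂ → ℂ := Φ + (-1 : ℂ) • ∑ i, F i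
    have hS := sum_mem_IsK hm F (fun i => (hF i).1)
    have hΨ : IsK (4 * j + c) m Ψ := hΦ.add hm (hS.smul hm (-1))
    have hL : LL m c Ψ = 0 := by
      have h1 : LL m c Ψ = LL m c Φ + LL m c ((-1 : ℂ) • ∑ i, F i) := by
        ext s; exact IsK.coef_add hΦ (hS.smul hm (-1)) _ _ _
      rw [h1, LL_smul _ hS, LL_sum hm F (fun i => (hF i).1), hsum]
      have : ∑ i, LL m c (F i) = ∑ i, a i • e i := Finset.sum_congr rfl fun i _ => (hF i).2
      rw [this]; simp
    have hgood := LL_good hm hc (by omega) hΨ hL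
    have hmon : ∀ i, (fun τ => a i * E4C τ ^ (j - d i)) ∈ QQ DD (4 * d i + c) (4 * j + c) := by
      intro i
      by_cases hj : j < d i
      · rw [ha i hj]
        convert! Submodule.zero_mem _ using 1
        ext τ; simp
      · convert! Submodule.smul_mem _ (a i) (QQ_mono (X := DD) (v := 4 * d i + c) (k := 4 * j + c) (j - d i) 0 (by omega)) using 1
        ext τ; simp
    by_cases hj3 : j < 3
    · refine ⟨fun i τ => a i * E4C τ ^ (j - d i), hmon, fun τ u v hτ => ?_⟩
      have := hΨ.vanish hm (by omega) hgood τ u v hτ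
      simp only [Ψ, F, Pi.add_apply, Pi.smul_apply, Finset.sum_apply, smul_eq_mul] at this
      simp only [mul_assoc]
      linear_combination this
    · have h12 : 4 * j + c = 4 * (j - 3) + c + 12 := by omega
      rw [h12] at hΨ
      have hχ := hΨ.div hm hgood
      obtain ⟨f, hf1, hf2⟩ := ih (j - 3) (by omega) _ hχ
      refine ⟨fun i τ => a i * E4C τ ^ (j - d i) + DD τ * f i τ, fun i => ?_, fun τ u v hτ => ?_⟩
      · have h3 := QQ_DD (hf1 i)
        rw [← h12] at h3
        exact Submodule.add_mem _ (hmon i) h3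
      · have h4 := hf2 τ u v hτ
        rw [div_eq_iff (DD_ne hτ)] at h4
        simp only [Ψ, F, Pi.add_apply, Pi.smul_apply, Finset.sum_apply, smul_eq_mul] at h4
        simp only [add_mul, Finset.sum_add_distrib]
        simp only [mul_assoc, ← Finset.mul_sum]
        linear_combination h4
  · intro k hk
    obtain ⟨j, rfl⟩ := hcongr hk
    clear hk
    induction j using Nat.strong_induction_on with
    | _ j ih =>
    intro f hf hsum
    choose α f' hα hf0 hf' hff using fun i => QQ_dec (hf i)
    have hdv : ∀ i, (4 * j + c - (4 * d i + c)) / 4 = j - d i := fun i => by omega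
    simp only [hdv] at hff
    have hα' : ∀ i, j < d i → α i = 0 := fun i h => hα i (by dsimp only; omega)
    let F : Fin n → ℂ → ℂ → ℂ → ℂ := fun i => α i • fun τ u v => E4C τ ^ (j - d i) * g i τ u v
    have hF := fun i => hE j (α i) i (hα' i)
    have hLF := LL_sum (c := c) hm F (fun i => (hF i).1)
    have hrel : ∀ τ u v, UHP τ → (∑ i, F i) τ u v = - (DD τ * ∑ i, f' i τ * g i τ u v) := by
      intro τ u v hτ
      have h1 := hsum τ u v hτ
      rw [Finset.sum_congr rfl (fun i _ => by rw [hff i])] at h1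
      simp only [add_mul, Finset.sum_add_distrib, mul_assoc, ← Finset.mul_sum] at h1
      simp only [F, Pi.smul_apply, Finset.sum_apply, smul_eq_mul]
      linear_combination h1
    have hL0 : LL m c (∑ i, F i) = 0 := by
      by_cases hj3 : j < 3
      · have : LL m c (∑ i, F i) = LL m c ((0:ℂ) • (0 : ℂ → ℂ → ℂ → ℂ)) := by
          apply LL_congr
          intro τ u v hτ
          rw [hrel τ u v hτ]
          simp only [hf0 _ (by omega : 4 * j + c < 12)]
          simp
        rw [this, LL_smul 0 (IsK.zero (k := 0) hm), zero_smul]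
      · let G : Fin n → ℂ → ℂ → ℂ → ℂ := fun i τ u v => f' i τ * g i τ u v
        have hG : ∀ i, IsK (4 * j + c - 12) m (G i) := fun i => QQ_mul hm (hf' i) (hg1 i)
        have hGS := sum_mem_IsK hm G hG
        have h5 := LL_mul (c := c) hm hGS DD_MFS
        rw [zero_smul] at h5
        have h6 := hGS.mul hm DD_MFS (I_pow4 3)
        have : LL m c (∑ i, F i) = LL m c ((-1:ℂ) • (fun τ u v => DD τ * (∑ i, G i) τ u v)) := by
          apply LL_congr
          intro τ u v hτ
          rw [hrel τ u v hτ]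
          simp [G]
        rw [this, LL_smul _ h6, h5, smul_zero]
    rw [hLF] at hL0
    have hL1 : ∑ i, α i • e i = 0 := by
      rw [← hL0]
      exact Finset.sum_congr rfl fun i _ => (hF i).2.symm
    have hα0 := Fintype.linearIndependent_iff.1 hli α hL1
    have hf'0 : ∀ i τ, UHP τ → f' i τ = 0 := by
      by_cases hj3 : j < 3
      · intro i τ _
        rw [hf0 i (by omega)]; rfl
      · have h12 : 4 * j + c - 12 = 4 * (j - 3) + c := by omega
        refine ih (j - 3) (by omega) f' (fun i => h12 ▸ hf' i) fun τ u v hτ => ?_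
        have h7 := hrel τ u v hτ
        simp only [F, hα0, zero_smul, Finset.sum_const_zero, Pi.zero_apply] at h7
        exact (mul_eq_zero.1 (neg_eq_zero.1 h7.symm)).resolve_left (DD_ne hτ)
    intro i τ hτ
    rw [hff i]; simp [hα0 i, hf'0 i τ hτ]

lemma eC_cong {x y : ℂ} (j : ℤ) (h : x = y + j) : eC x = eC y := by
  rw [h, eC_add, eC_int, mul_one]

/-- Jacobi theta with characteristics. -/
def tt (α β : ℤ) (τ u : ℂ) : ℂ :=
  eC (α ^ 2 * τ / 8 + α * (u + β / 2) / 2) * jacobiTheta₂ (u + α * τ / 2 + β / 2) τ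

lemma tt_ser (α β : ℤ) {τ : ℂ} (u : ℂ) (hτ : UHP τ) :
    HasSum (fun n : ℤ => eC ((2 * n + α) * β / 4) * eC ((2 * n + α) ^ 2 * τ / 8 + (2 * n + α) * u / 2)) (tt α β τ u) := by
  refine ((hasSum_jacobiTheta₂_term (u + α * τ / 2 + β / 2) hτ).mul_left
    (eC (α ^ 2 * τ / 8 + α * (u + β / 2) / 2))).congr_fun (fun n => ?_)
  simp only [jacobiTheta₂_term, eC, ← Complex.exp_add]
  congr 1; ring

lemma tt_holo (α β : ℤ) : DifferentiableOn ℂ (fun p : ℂ × ℂ => tt α β p.1 p.2) {p | UHP p.1} := by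
  intro p hp
  refine DifferentiableAt.differentiableWithinAt ?_
  unfold tt
  refine DifferentiableAt.mul ?_ ?_
  · exact (differentiable_eC _).comp p (f := fun p : ℂ × ℂ => (α:ℂ) ^ 2 * p.1 / 8 + α * (p.2 + β / 2) / 2) (by fun_prop)
  · have h := (hasFDerivAt_jacobiTheta₂ (p.2 + α * p.1 / 2 + β / 2) (τ := p.1) hp).differentiableAt
    exact h.comp p (f := fun p : ℂ × ℂ => (p.2 + α * p.1 / 2 + β / 2, p.1)) (by fun_prop)

lemma tt_T0 (β : ℤ) {τ : ℂ} (u : ℂ) (hτ : UHP τ) : tt 0 β (τ + 1) u = tt 0 (β + 1) τ u := by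
  have h1 : UHP (τ + 1) := by simpa [UHP] using hτ
  refine (tt_ser 0 β u h1).unique ((tt_ser 0 (β+1) u hτ).congr_fun fun n => ?_)
  obtain ⟨j, hj⟩ : ∃ j : ℤ, n ^ 2 - n = 2 * j := by
    obtain ⟨j, hj⟩ := Int.even_mul_succ_self (n - 1)
    exact ⟨j, by linear_combination hj⟩
  have hj' : (n:ℂ) ^ 2 - n = 2 * j := by exact_mod_cast hj
  rw [← eC_add, ← eC_add]
  refine eC_cong j ?_
  push_cast; linear_combination hj' / 2

lemma tt_T1 (β : ℤ) {τ : ℂ} (u : ℂ) (hτ : UHP τ) : tt 1 β (τ + 1) u = eC (1/8) * tt 1 β τ u := by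
  have h1 : UHP (τ + 1) := by simpa [UHP] using hτ
  refine (tt_ser 1 β u h1).unique (((tt_ser 1 β u hτ).mul_left _).congr_fun fun n => ?_)
  obtain ⟨j, hj⟩ : ∃ j : ℤ, n ^ 2 + n = 2 * j := by
    obtain ⟨j, hj⟩ := Int.even_mul_succ_self n
    exact ⟨j, by linear_combination hj⟩
  have hj' : (n:ℂ) ^ 2 + n = 2 * j := by exact_mod_cast hj
  rw [← eC_add, ← eC_add, ← eC_add]
  refine eC_cong j ?_
  push_cast; linear_combination hj' / 2

lemma tt_b2 (τ u : ℂ) : tt 0 2 τ u = tt 0 0 τ u := by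
  simp only [tt]
  have := jacobiTheta₂_add_left u τ
  simp [this]

lemma tt_one (α β : ℤ) (τ u : ℂ) : tt α β τ (u + 1) = eC (α / 2) * tt α β τ u := by
  simp only [tt]
  rw [show u + 1 + α * τ / 2 + β / 2 = (u + α * τ / 2 + β / 2) + 1 by ring, jacobiTheta₂_add_left,
    ← mul_assoc, ← eC_add]
  congr 2; ring

lemma tt_tau (α β : ℤ) (τ u : ℂ) : tt α β τ (u + τ) = eC (-β / 2) * eC (-τ/2 - u) * tt α β τ u := by
  simp only [tt]
  rw [show u + τ + α * τ / 2 + β / 2 = (u + α * τ / 2 + β / 2) + τ by ring, jacobiTheta₂_add_left',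
    ← mul_assoc, ← mul_assoc]
  congr 1
  simp only [eC, ← Complex.exp_add]
  congr 1; ring

lemma tt_neg (α β : ℤ) {τ : ℂ} (u : ℂ) (hτ : UHP τ) : tt α β τ (-u) = eC (-α * β / 2) * tt α β τ u := by
  have h1 := (Equiv.subLeft (-α)).hasSum_iff.2 (tt_ser α β (-u) hτ)
  refine h1.unique (((tt_ser α β u hτ).mul_left _).congr_fun fun n => ?_)
  simp only [Function.comp, Equiv.subLeft_apply]
  rw [← eC_add, ← eC_add, ← eC_add]
  refine eC_cong (-n * β) ?_
  push_cast; ring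

lemma theta_int (z τ : ℂ) (n : ℤ) : jacobiTheta₂ (z + n) τ = jacobiTheta₂ z τ := by
  induction n with
  | zero => simp
  | succ i ih => rw [← ih, ← jacobiTheta₂_add_left (z + ((i:ℤ):ℂ))]; push_cast; congr 1; ring
  | pred i ih => rw [← ih, ← jacobiTheta₂_add_left]; push_cast; congr 1; ring

/-- the automorphy factor of weight one half -/
def rr (τ : ℂ) : ℂ := (-I * τ) ^ (1 / 2 : ℂ)

lemma rr_sq (τ : ℂ) : rr τ ^ 2 = -I * τ := by
  unfold rr; rw [← Complex.cpow_nat_mul]; simp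

lemma UHP.ne {τ : ℂ} (hτ : UHP τ) : τ ≠ 0 := by
  rintro rfl; simp [UHP] at hτ

lemma rr_ne {τ : ℂ} (hτ : UHP τ) : rr τ ≠ 0 := by
  intro h
  have := rr_sq τ
  rw [h] at this
  simp [hτ.ne, eq_comm] at this

lemma UHP.S {τ : ℂ} (hτ : UHP τ) : UHP (-1 / τ) := by
  have := UHP_smul ModularGroup.S hτ
  simpa [Ma, Mb, Mc, Md, ModularGroup.S] using this

lemma tt_S (α β : ℤ) {τ : ℂ} (u : ℂ) (hτ : UHP τ) :
    tt α β (-1 / τ) (u / τ) = rr τ * eC (u ^ 2 / (2 * τ)) * eC (-α * β / 4) * tt β α τ u := by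
  have hne := hτ.ne
  have hr := rr_ne hτ
  have h1 := jacobiTheta₂_functional_equation (u - α / 2 + β * τ / 2) τ
  rw [show (-I * τ) ^ (1/2 : ℂ) = rr τ from rfl] at h1
  have h2 : jacobiTheta₂ (u - α / 2 + β * τ / 2) τ = jacobiTheta₂ (u + β * τ / 2 + α / 2) τ := by
    rw [← theta_int _ _ α]; congr 1; ring
  simp only [tt]
  rw [← h2, h1]
  have h3 : u / τ + α * (-1 / τ) / 2 + β / 2 = (u - α / 2 + β * τ / 2) / τ := by field_simp; ring
  rw [h3]
  have h4 : eC (α ^ 2 * (-1 / τ) / 8 + α * (u / τ + β / 2) / 2) = eC (u ^ 2 / (2 * τ)) * eC (-α * β / 4) *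
    eC (β ^ 2 * τ / 8 + β * (u + α / 2) / 2) * cexp (-Real.pi * I * (u - α / 2 + β * τ / 2) ^ 2 / τ) := by
    simp only [eC, ← Complex.exp_add]
    congr 1
    field_simp
    ring
  rw [h4]
  field_simp

/-- Fourier family in one elliptic variable. -/
def Fam1 (M : ℕ) (F : ℂ → ℂ → ℂ) : Prop :=
  ∃ (ι : Type) (_ : Countable ι) (c : ι → ℂ) (n a : ι → ℤ), (∀ i, 0 ≤ n i ∧ a i ^ 2 ≤ M * n i) ∧
    ∀ τ u, UHP τ → HasSum (fun i => c i * eC (n i * τ / 8 + a i * u / 2)) (F τ u)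

lemma Fam1.mul {M N : ℕ} {F G : ℂ → ℂ → ℂ} (hF : Fam1 M F) (hG : Fam1 N G) :
    Fam1 (M + N) (fun τ u => F τ u * G τ u) := by
  obtain ⟨ι, _, c, n, a, h1, h2⟩ := hF
  obtain ⟨κ, _, d, n', a', h1', h2'⟩ := hG
  refine ⟨ι × κ, inferInstance, fun x => c x.1 * d x.2, fun x => n x.1 + n' x.2, fun x => a x.1 + a' x.2, ?_, ?_⟩
  · rintro ⟨i, j⟩
    obtain ⟨p, q⟩ := h1 i
    obtain ⟨p', q'⟩ := h1' j
    refine ⟨by positivity, ?_⟩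
    push_cast
    have hM : (0:ℤ) ≤ M := by positivity
    have hN : (0:ℤ) ≤ N := by positivity
    have e : (a i * a' j) ^ 2 ≤ (M * n' j) * (N * n i) := by nlinarith [mul_nonneg hM p, mul_nonneg hN p', sq_nonneg (a i), sq_nonneg (a' j)]
    have e2 : 2 * (a i * a' j) ≤ M * n' j + N * n i := by
      have := mul_nonneg hM p'
      have := mul_nonneg hN p
      nlinarith [sq_nonneg (M * n' j - N * n i)]
    show (a i + a' j) ^ 2 ≤ (M + N) * (n i + n' j)
    nlinarith
  · intro τ u hτ
    have A := h2 τ u hτ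
    have B := h2' τ u hτ
    have C := summable_mul_of_summable_norm A.summable.norm B.summable.norm
    have D := A.mul B C
    refine D.congr_fun fun x => ?_
    dsimp only
    rw [mul_mul_mul_comm, ← eC_add]; congr 2; push_cast; ring

lemma Fam1.add {M : ℕ} {F G : ℂ → ℂ → ℂ} (hF : Fam1 M F) (hG : Fam1 M G) :
    Fam1 M (fun τ u => F τ u + G τ u) := by
  obtain ⟨ι, _, c, n, a, h1, h2⟩ := hF
  obtain ⟨κ, _, d, n', a', h1', h2'⟩ := hG
  refine ⟨ι ⊕ κ, inferInstance, Sum.elim c d, Sum.elim n n', Sum.elim a a', ?_, ?_⟩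
  · rintro (i | i)
    · exact h1 i
    · exact h1' i
  · intro τ u hτ
    exact HasSum.sum (f := fun x : ι ⊕ κ => Sum.elim c d x * eC (((Sum.elim n n' x : ℤ):ℂ) * τ / 8 + ((Sum.elim a a' x : ℤ):ℂ) * u / 2)) (h2 τ u hτ) (h2' τ u hτ)

lemma Fam1.tt (α β : ℤ) : Fam1 1 (tt α β) :=
  ⟨ℤ, inferInstance, fun n => eC ((2 * n + α) * β / 4), fun n => (2 * n + α) ^ 2, fun n => 2 * n + α,
    fun i => ⟨by positivity, by simp⟩, fun τ u hτ => by simpa using tt_ser α β u hτ⟩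

lemma Fam1.tt0 (α β : ℤ) : Fam1 0 (fun τ _ => _root_.tt α β τ 0) :=
  ⟨ℤ, inferInstance, fun n => eC ((2 * n + α) * β / 4), fun n => (2 * n + α) ^ 2, fun n => 0,
    fun i => ⟨by positivity, by simp⟩, fun τ u hτ => by simpa using tt_ser α β 0 hτ⟩

lemma Fam1.tt2 (α β : ℤ) : Fam1 4 (fun τ u => _root_.tt α β τ (2 * u)) :=
  ⟨ℤ, inferInstance, fun n => eC ((2 * n + α) * β / 4), fun n => (2 * n + α) ^ 2, fun n => 2 * (2 * n + α),
    fun i => ⟨by positivity, by push_cast; apply le_of_eq; ring⟩, fun τ u hτ => by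
      refine (tt_ser α β (2 * u) hτ).congr_fun fun n => ?_
      congr 2; push_cast; ring⟩

lemma Fam1.ser {w : ℕ} {f0 : ℂ} {f : ℂ → ℂ} (h : MFS w f0 f) : Fam1 0 (fun τ _ => f τ) := by
  obtain ⟨c, _, h⟩ := h.ser
  exact ⟨ℕ, inferInstance, c, fun n => 8 * n, fun _ => 0, fun i => ⟨by positivity, by simp⟩, fun τ u hτ => by
    refine (h τ hτ).congr_fun fun n => ?_
    congr 2; push_cast; ring⟩

lemma Fam1.pow {M : ℕ} {F : ℂ → ℂ → ℂ} (hF : Fam1 M F) (j : ℕ) : Fam1 (j * M) (fun τ u => F τ u ^ j) := by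
  induction j with
  | zero => exact ⟨Unit, inferInstance, fun _ => 1, fun _ => 0, fun _ => 0, by simp, fun τ u _ => by
      simpa [eC_zero] using hasSum_unique (fun _ : Unit => (1:ℂ))⟩
  | succ j ih =>
    have := ih.mul hF
    rw [show (j + 1) * M = j * M + M by ring]
    simpa [pow_succ] using this

/-- Jacobi forms in one elliptic variable, presented by generators. -/
structure J1 (k m : ℕ) (ε : ℂ) (F : ℂ → ℂ → ℂ) : Prop where
  holo : DifferentiableOn ℂ (fun p : ℂ × ℂ => F p.1 p.2) {p | UHP p.1}
  S : ∀ τ u, UHP τ → F (-1 / τ) (u / τ) = τ ^ k * eC (m * u ^ 2 / τ) * F τ u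
  T : ∀ τ u, UHP τ → F (τ + 1) u = F τ u
  one : ∀ τ u, UHP τ → F τ (u + 1) = F τ u
  tau : ∀ τ u, UHP τ → F τ (u + τ) = eC (-m * (τ + 2 * u)) * F τ u
  neg : ∀ τ u, UHP τ → F τ (-u) = ε * F τ u
  fam : Fam1 (2 * m) F

lemma J1.mul {k m k' m' : ℕ} {ε ε' : ℂ} {F G : ℂ → ℂ → ℂ} (h : J1 k m ε F) (h' : J1 k' m' ε' G) :
    J1 (k + k') (m + m') (ε * ε') (fun τ u => F τ u * G τ u) where
  holo := h.holo.mul h'.holo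
  S τ u hτ := by
    rw [h.S τ u hτ, h'.S τ u hτ, show ((m + m' : ℕ) : ℂ) * u ^ 2 / τ = m * u^2/τ + m' * u^2/τ by push_cast; ring, eC_add]
    ring
  T τ u hτ := by rw [h.T τ u hτ, h'.T τ u hτ]
  one τ u hτ := by rw [h.one τ u hτ, h'.one τ u hτ]
  tau τ u hτ := by
    rw [h.tau τ u hτ, h'.tau τ u hτ, show -((m + m' : ℕ) : ℂ) * (τ + 2 * u) = -m * (τ + 2 * u) + -m' * (τ + 2 * u) by push_cast; ring, eC_add]
    ring
  neg τ u hτ := by rw [h.neg τ u hτ, h'.neg τ u hτ]; ring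
  fam := by rw [mul_add]; exact h.fam.mul h'.fam

lemma J1.pow {k m : ℕ} {ε : ℂ} {F : ℂ → ℂ → ℂ} (h : J1 k m ε F) (j : ℕ) :
    J1 (j * k) (j * m) (ε ^ j) (fun τ u => F τ u ^ j) := by
  induction j with
  | zero =>
    refine ⟨by simp only [pow_zero]; fun_prop, ?_, ?_, ?_, ?_, ?_, ?_⟩
    · intro τ u _; simp [eC_zero]
    · intro τ u _; simp
    · intro τ u _; simp
    · intro τ u _; simp [eC_zero]
    · intro τ u _; simp
    · have := h.fam.pow 0
      simpa using this
  | succ j ih =>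
    have := ih.mul h
    rw [show (j + 1) * k = j * k + k by ring, show (j + 1) * m = j * m + m by ring]
    simpa [pow_succ] using this

lemma J1.ser {w : ℕ} {f0 : ℂ} {f : ℂ → ℂ} (h : MFS w f0 f) : J1 w 0 1 (fun τ _ => f τ) where
  holo := h.holo.comp (differentiable_fst.differentiableOn) (fun p hp => hp)
  S τ u hτ := by
    have := h.transf ModularGroup.S τ hτ
    simpa [Ma, Mb, Mc, Md, ModularGroup.S, eC_zero] using this
  T τ u hτ := by
    have := h.transf ModularGroup.T τ hτ
    simpa [Ma, Mb, Mc, Md, ModularGroup.T] using this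
  one τ u hτ := rfl
  tau τ u hτ := by simp [eC_zero]
  neg τ u hτ := by simp
  fam := by simpa using Fam1.ser h

lemma eC_quarter : eC (-1/4) = -I := by
  unfold eC
  rw [show 2 * (Real.pi:ℂ) * I * (-1/4) = (-(Real.pi/2:ℝ):ℂ) * I by push_cast; ring]
  rw [Complex.exp_mul_I]
  rw [Complex.cos_neg, Complex.sin_neg]
  rw [← Complex.ofReal_cos, ← Complex.ofReal_sin]
  simp

lemma eC_half : eC (1/2) = -1 := by
  unfold eC
  rw [show 2 * (Real.pi:ℂ) * I * (1/2) = Real.pi * I by ring, Complex.exp_pi_mul_I]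

lemma eC_half' : eC (-1/2) = -1 := by
  rw [show (-1/2:ℂ) = -(1/2) by ring, eC_neg, eC_half]; norm_num

lemma eC_eighth : eC (1/8) ^ 8 = 1 := by
  rw [← eC_nat_mul]
  have := eC_int 1
  norm_num at this ⊢
  exact this

lemma tt_S0 (α β : ℤ) {τ : ℂ} (hτ : UHP τ) :
    tt α β (-1 / τ) 0 = rr τ * eC (-α * β / 4) * tt β α τ 0 := by
  have := tt_S α β 0 hτ
  simpa [eC_zero] using this

lemma tt_holo0 (α β : ℤ) : DifferentiableOn ℂ (fun p : ℂ × ℂ => tt α β p.1 0) {p | UHP p.1} :=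
  (tt_holo α β).comp (g := fun p : ℂ × ℂ => tt α β p.1 p.2) (f := fun p : ℂ × ℂ => (p.1, 0))
    (by fun_prop) (fun p hp => hp)

lemma tt_holo2 (α β : ℤ) : DifferentiableOn ℂ (fun p : ℂ × ℂ => tt α β p.1 (2 * p.2)) {p | UHP p.1} :=
  (tt_holo α β).comp (g := fun p : ℂ × ℂ => tt α β p.1 p.2) (f := fun p : ℂ × ℂ => (p.1, 2 * p.2))
    (by fun_prop) (fun p hp => hp)

lemma rr8 (τ : ℂ) : rr τ ^ 8 = τ ^ 4 := by
  rw [show rr τ ^ 8 = (rr τ ^ 2) ^ 4 by ring, rr_sq, mul_pow]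
  rw [show (-I)^4 = 1 by rw [neg_pow, I_pow_four]; norm_num, one_mul]

def BB (τ u : ℂ) : ℂ := tt 0 0 τ 0 ^ 6 * tt 0 0 τ u ^ 2 + tt 0 1 τ 0 ^ 6 * tt 0 1 τ u ^ 2 + tt 1 0 τ 0 ^ 6 * tt 1 0 τ u ^ 2

def PP (τ : ℂ) : ℂ := tt 0 0 τ 0 * tt 0 1 τ 0 * tt 1 0 τ 0

def AA (τ u : ℂ) : ℂ := PP τ ^ 6 * tt 1 1 τ u ^ 2

def CC (τ u : ℂ) : ℂ := PP τ ^ 7 * tt 1 1 τ (2 * u)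

lemma e2 (w : ℂ) : eC w ^ 2 = eC (2 * w) := by
  rw [← eC_nat_mul]; norm_num

lemma BB_J1 : J1 4 1 1 BB where
  holo := by
    unfold BB
    exact (((tt_holo0 0 0).pow 6).mul ((tt_holo 0 0).pow 2)).add (((tt_holo0 0 1).pow 6).mul ((tt_holo 0 1).pow 2))
      |>.add (((tt_holo0 1 0).pow 6).mul ((tt_holo 1 0).pow 2))
  S τ u hτ := by
    simp only [BB]
    have h : eC (((1:ℕ):ℂ) * u ^ 2 / τ) = eC (u ^ 2 / (2 * τ)) ^ 2 := by
      rw [e2]; congr 1; have := hτ.ne; field_simp; simp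
    rw [h, ← rr8]
    simp only [tt_S0 _ _ hτ, tt_S _ _ _ hτ]
    simp [eC_zero]
    ring
  T τ u hτ := by
    simp only [BB, tt_T0 _ _ hτ, tt_T1 _ _ hτ]
    simp only [zero_add, show (1:ℤ)+1 = 2 by norm_num, tt_b2]
    linear_combination (tt 1 0 τ 0 ^ 6 * tt 1 0 τ u ^ 2) * eC_eighth
  one τ u hτ := by
    simp only [BB, tt_one]
    push_cast
    simp [eC_zero, -one_div, eC_half]
  tau τ u hτ := by
    simp only [BB, tt_tau]
    have h : eC (-((1:ℕ):ℂ) * (τ + 2 * u)) = eC (-τ/2 - u) ^ 2 := by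
      rw [e2]; congr 1; push_cast; ring
    rw [h]
    push_cast
    simp [eC_zero, eC_half']
    ring
  neg τ u hτ := by
    simp only [BB, tt_neg _ _ _ hτ]
    simp [eC_zero]
  fam := by
    unfold BB
    have h (α β : ℤ) : Fam1 (2 * 1) (fun τ u => tt α β τ 0 ^ 6 * tt α β τ u ^ 2) := by
      simpa using ((Fam1.tt0 α β).pow 6).mul ((Fam1.tt α β).pow 2)
    exact ((h 0 0).add (h 0 1)).add (h 1 0)

lemma PP_S {τ : ℂ} (hτ : UHP τ) : PP (-1/τ) = rr τ ^ 3 * PP τ := by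
  simp only [PP, tt_S0 _ _ hτ]
  simp [eC_zero]
  ring

lemma PP_T {τ : ℂ} (hτ : UHP τ) : PP (τ + 1) = eC (1/8) * PP τ := by
  simp only [PP, tt_T0 _ _ hτ, tt_T1 _ _ hτ]
  simp only [zero_add, show (1:ℤ)+1 = 2 by norm_num, tt_b2]
  ring

lemma PP_holo : DifferentiableOn ℂ (fun p : ℂ × ℂ => PP p.1) {p | UHP p.1} :=
  ((tt_holo0 0 0).mul (tt_holo0 0 1)).mul (tt_holo0 1 0)

lemma PP_fam : Fam1 0 (fun τ _ => PP τ) :=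
  ((Fam1.tt0 0 0).mul (Fam1.tt0 0 1)).mul (Fam1.tt0 1 0)

lemma AA_J1 : J1 10 1 1 AA where
  holo := (PP_holo.pow 6).mul ((tt_holo 1 1).pow 2)
  S τ u hτ := by
    simp only [AA]
    have h : eC (((1:ℕ):ℂ) * u ^ 2 / τ) = eC (u ^ 2 / (2 * τ)) ^ 2 := by
      rw [e2]; congr 1; have := hτ.ne; field_simp; simp
    rw [h, PP_S hτ, tt_S _ _ _ hτ]
    push_cast
    rw [show (-1 * 1 / 4 : ℂ) = -1/4 by norm_num, eC_quarter]
    have h2 : rr τ ^ 20 * (-I)^2 = τ ^ 10 := by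
      rw [show rr τ ^ 20 = (rr τ ^ 2) ^ 10 by ring, rr_sq, mul_pow, mul_right_comm, ← pow_add,
        show (-I) ^ (10+2) = ((-I)^4)^3 by ring, show (-I)^4 = 1 by rw [neg_pow, I_pow_four]; norm_num]
      simp
    linear_combination (eC (u ^ 2 / (2 * τ)) ^ 2 * PP τ ^ 6 * tt 1 1 τ u ^ 2) * h2
  T τ u hτ := by
    simp only [AA, PP_T hτ, tt_T1 _ _ hτ]
    linear_combination (PP τ ^ 6 * tt 1 1 τ u ^ 2) * eC_eighth
  one τ u hτ := by
    simp only [AA, tt_one]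
    push_cast
    simp [-one_div, eC_half]
  tau τ u hτ := by
    simp only [AA, tt_tau]
    have h : eC (-((1:ℕ):ℂ) * (τ + 2 * u)) = eC (-τ/2 - u) ^ 2 := by
      rw [e2]; congr 1; push_cast; ring
    rw [h]
    push_cast
    simp [eC_half']
    ring
  neg τ u hτ := by
    simp only [AA, tt_neg _ _ _ hτ]
    push_cast
    simp [eC_half']
  fam := by
    unfold AA
    simpa using (PP_fam.pow 6).mul ((Fam1.tt 1 1).pow 2)

lemma CC_J1 : J1 11 2 (-1) CC where
  holo := (PP_holo.pow 7).mul (tt_holo2 1 1)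
  S τ u hτ := by
    simp only [CC]
    have h : eC (((2:ℕ):ℂ) * u ^ 2 / τ) = eC ((2 * u) ^ 2 / (2 * τ)) := by
      congr 1; have := hτ.ne; push_cast; field_simp
    rw [h, PP_S hτ, show 2 * (u / τ) = (2 * u) / τ by ring, tt_S _ _ _ hτ]
    push_cast
    rw [show (-1 * 1 / 4 : ℂ) = -1/4 by norm_num, eC_quarter]
    have h2 : rr τ ^ 22 * (-I) = τ ^ 11 := by
      rw [show rr τ ^ 22 = (rr τ ^ 2) ^ 11 by ring, rr_sq, mul_pow, mul_right_comm, ← pow_succ,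
        show (-I) ^ (11+1) = ((-I)^4)^3 by ring, show (-I)^4 = 1 by rw [neg_pow, I_pow_four]; norm_num]
      simp
    linear_combination (eC ((2 * u) ^ 2 / (2 * τ)) * PP τ ^ 7 * tt 1 1 τ (2 * u)) * h2
  T τ u hτ := by
    simp only [CC, PP_T hτ, tt_T1 _ _ hτ]
    linear_combination (PP τ ^ 7 * tt 1 1 τ (2 * u)) * eC_eighth
  one τ u hτ := by
    simp only [CC]
    rw [show 2 * (u + 1) = 2 * u + 1 + 1 by ring]
    simp only [tt_one]
    push_cast
    simp [-one_div, eC_half]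
  tau τ u hτ := by
    simp only [CC]
    rw [show 2 * (u + τ) = 2 * u + τ + τ by ring]
    simp only [tt_tau]
    have h : eC (-((2:ℕ):ℂ) * (τ + 2 * u)) = eC (-τ/2 - (2 * u + τ)) * eC (-τ/2 - 2 * u) := by
      rw [← eC_add]; congr 1; push_cast; ring
    rw [h]
    push_cast
    simp [eC_half']
    ring
  neg τ u hτ := by
    simp only [CC, mul_neg, tt_neg _ _ _ hτ]
    push_cast
    simp [eC_half']
  fam := by
    unfold CC
    simpa using (PP_fam.pow 7).mul (Fam1.tt2 1 1)

lemma ell1 {m : ℕ} {τ : ℂ} {G : ℂ → ℂ} (h1 : ∀ u, G (u + 1) = G u)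
    (h2 : ∀ u, G (u + τ) = eC (-m * (τ + 2 * u)) * G u) (p p' : ℤ) (u : ℂ) :
    G (u + p * τ + p') = eC (-m * (p ^ 2 * τ + 2 * p * u)) * G u := by
  have h3 : ∀ (p' : ℤ) u, G (u + p') = G u := by
    intro p'
    induction p' with
    | zero => simp
    | succ i ih => intro u; rw [← ih u, ← h1 (u + ((i:ℤ):ℂ))]; push_cast; congr 1; ring
    | pred i ih => intro u; rw [← ih u, ← h1]; push_cast; congr 1; ring
  rw [h3]
  induction p with
  | zero => simp [eC_zero]
  | succ i ih =>
    rw [show u + ((i + 1 : ℤ) : ℂ) * τ = (u + ((i:ℤ):ℂ) * τ) + τ by push_cast; ring, h2, ih, ← mul_assoc, ← eC_add]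
    congr 2; push_cast; ring
  | pred i ih =>
    have := h2 (u + ((-i - 1 : ℤ) : ℂ) * τ)
    rw [show u + ((-i - 1 : ℤ) : ℂ) * τ + τ = u + ((-i:ℤ):ℂ) * τ by push_cast; ring, ih] at this
    rw [← mul_right_inj' (eC_ne (-m * (τ + 2 * (u + ((-i - 1 : ℤ):ℂ) * τ)))), ← this, ← mul_assoc, ← eC_add]
    congr 2; push_cast; ring

/-- the modular transformation law for one matrix -/
def MdLaw (k m : ℕ) (Φ : ℂ → ℂ → ℂ → ℂ) (M : Matrix.SpecialLinearGroup (Fin 2) ℤ) : Prop :=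
  ∀ τ u v : ℂ, UHP τ →
      Φ ((Ma M * τ + Mb M) / (Mc M * τ + Md M)) (u / (Mc M * τ + Md M)) (v / (Mc M * τ + Md M))
      = (Mc M * τ + Md M) ^ k * eC ((m : ℂ) * Mc M * (u ^ 2 + v ^ 2) / (Mc M * τ + Md M)) * Φ τ u v

lemma MdLaw.mul {k m : ℕ} {Φ : ℂ → ℂ → ℂ → ℂ} {M N : Matrix.SpecialLinearGroup (Fin 2) ℤ}
    (hM : MdLaw k m Φ M) (hN : MdLaw k m Φ N) : MdLaw k m Φ (M * N) := by
  intro τ u v hτ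
  have ha : Ma (M * N) = Ma M * Ma N + Mb M * Mc N := by simp [Ma, Mb, Mc, Matrix.mul_apply, Fin.sum_univ_two]
  have hb : Mb (M * N) = Ma M * Mb N + Mb M * Md N := by simp [Ma, Mb, Md, Matrix.mul_apply, Fin.sum_univ_two]
  have hc : Mc (M * N) = Mc M * Ma N + Md M * Mc N := by simp [Ma, Md, Mc, Matrix.mul_apply, Fin.sum_univ_two]
  have hd : Md (M * N) = Mc M * Mb N + Md M * Md N := by simp [Md, Mb, Mc, Matrix.mul_apply, Fin.sum_univ_two]
  have j1 := M_den_ne N hτ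
  have j2 := M_den_ne M (UHP_smul N hτ)
  have h1 := hM _ (u / (Mc N * τ + Md N)) (v / (Mc N * τ + Md N)) (UHP_smul N hτ)
  rw [hN τ u v hτ] at h1
  have j3 : Mc (M * N) * τ + Md (M * N) = (Mc M * ((Ma N * τ + Mb N) / (Mc N * τ + Md N)) + Md M) * (Mc N * τ + Md N) := by
    rw [hc, hd]; field_simp; ring
  have j4 : (Ma (M * N) * τ + Mb (M * N)) / (Mc (M * N) * τ + Md (M * N)) =
     (Ma M * ((Ma N * τ + Mb N) / (Mc N * τ + Md N)) + Mb M) / (Mc M * ((Ma N * τ + Mb N) / (Mc N * τ + Md N)) + Md M) := by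
    rw [j3, ha, hb]
    rw [div_eq_div_iff (mul_ne_zero j2 j1) j2]
    field_simp; ring
  have j5 : (m:ℂ) * Mc (M * N) * (u ^ 2 + v ^ 2) / (Mc (M * N) * τ + Md (M * N)) =
      m * Mc M * ((u / (Mc N * τ + Md N)) ^ 2 + (v / (Mc N * τ + Md N)) ^ 2) / (Mc M * ((Ma N * τ + Mb N) / (Mc N * τ + Md N)) + Md M)
      + m * Mc N * (u ^ 2 + v ^ 2) / (Mc N * τ + Md N) := by
    have hdet := det_M N
    rw [j3, hc]
    have key : (Mc M * Ma N + Md M * Mc N) * (Mc N * τ + Md N) = Mc M + Mc N * ((Mc M * ((Ma N * τ + Mb N) / (Mc N * τ + Md N)) + Md M) * (Mc N * τ + Md N)) := by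
      field_simp
      linear_combination Mc M * hdet
    generalize (Mc M * ((Ma N * τ + Mb N) / (Mc N * τ + Md N)) + Md M) = J at *
    field_simp
    linear_combination (m * (u ^ 2 + v ^ 2)) * key
  rw [j4, j5, eC_add, show u / (Mc (M * N) * τ + Md (M * N)) = u / (Mc N * τ + Md N) / (Mc M * ((Ma N * τ + Mb N) / (Mc N * τ + Md N)) + Md M) by rw [j3, div_div, mul_comm],
    show v / (Mc (M * N) * τ + Md (M * N)) = v / (Mc N * τ + Md N) / (Mc M * ((Ma N * τ + Mb N) / (Mc N * τ + Md N)) + Md M) by rw [j3, div_div, mul_comm], h1, j3, mul_pow]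
  ring

lemma MdLaw.one {k m : ℕ} {Φ : ℂ → ℂ → ℂ → ℂ} : MdLaw k m Φ 1 := by
  intro τ u v hτ
  simp [Ma, Mb, Mc, Md, eC_zero]

lemma MdLaw.inv {k m : ℕ} {Φ : ℂ → ℂ → ℂ → ℂ} {N : Matrix.SpecialLinearGroup (Fin 2) ℤ}
    (hN : MdLaw k m Φ N) : MdLaw k m Φ N⁻¹ := by
  intro τ u v hτ
  have ha : Ma N⁻¹ = Md N := by simp [Ma, Md, Matrix.SpecialLinearGroup.coe_inv, Matrix.adjugate_fin_two]
  have hb : Mb N⁻¹ = -Mb N := by simp [Mb, Matrix.SpecialLinearGroup.coe_inv, Matrix.adjugate_fin_two]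
  have hc : Mc N⁻¹ = -Mc N := by simp [Mc, Matrix.SpecialLinearGroup.coe_inv, Matrix.adjugate_fin_two]
  have hd : Md N⁻¹ = Ma N := by simp [Ma, Md, Matrix.SpecialLinearGroup.coe_inv, Matrix.adjugate_fin_two]
  have j1 := M_den_ne N⁻¹ hτ
  have h1 := hN _ (u / (Mc N⁻¹ * τ + Md N⁻¹)) (v / (Mc N⁻¹ * τ + Md N⁻¹)) (UHP_smul N⁻¹ hτ)
  rw [ha, hb, hc, hd] at *
  have hdet := det_M N
  have j2 : Mc N * ((Md N * τ + -Mb N) / (-Mc N * τ + Ma N)) + Md N = (-Mc N * τ + Ma N)⁻¹ := by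
    generalize hJ : (-Mc N * τ + Ma N) = J at *
    field_simp
    linear_combination hdet - Md N * hJ
  have j3 : Ma N * ((Md N * τ + -Mb N) / (-Mc N * τ + Ma N)) + Mb N = τ * (-Mc N * τ + Ma N)⁻¹ := by
    generalize hJ : (-Mc N * τ + Ma N) = J at *
    field_simp
    linear_combination τ * hdet - Mb N * hJ
  rw [j2, j3] at h1
  generalize (Md N * τ + -Mb N) / (-Mc N * τ + Ma N) = τ' at *
  generalize (-Mc N * τ + Ma N) = J at *
  rw [mul_div_assoc, div_self (inv_ne_zero j1), mul_one, div_inv_eq_mul, div_inv_eq_mul, div_mul_cancel₀ _ j1, div_mul_cancel₀ _ j1] at h1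
  rw [h1, show (m:ℂ) * -Mc N * (u ^ 2 + v ^ 2) / J = -((m:ℂ) * Mc N * ((u / J) ^ 2 + (v / J) ^ 2) / J⁻¹) by field_simp, eC_neg]
  have := eC_ne ((m:ℂ) * Mc N * ((u / J) ^ 2 + (v / J) ^ 2) / J⁻¹)
  generalize eC ((m:ℂ) * Mc N * ((u / J) ^ 2 + (v / J) ^ 2) / J⁻¹) = E at *
  rw [inv_pow]
  field_simp

lemma MdLaw.all {k m : ℕ} {Φ : ℂ → ℂ → ℂ → ℂ} (hS : MdLaw k m Φ ModularGroup.S) (hT : MdLaw k m Φ ModularGroup.T)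
    (M : Matrix.SpecialLinearGroup (Fin 2) ℤ) : MdLaw k m Φ M := by
  have hM : M ∈ Subgroup.closure {ModularGroup.S, ModularGroup.T} := by
    rw [SpecialLinearGroup.SL2Z_generators]; trivial
  induction hM using Subgroup.closure_induction with
  | mem x hx => rcases hx with rfl | rfl <;> assumption
  | one => exact MdLaw.one
  | mul x y _ _ hx hy => exact hx.mul hy
  | inv x _ hx => exact hx.inv

/-- Fourier family in two elliptic variables. -/
def Fam2 (m : ℕ) (Φ : ℂ → ℂ → ℂ → ℂ) : Prop :=
  ∃ (ι : Type) (_ : Countable ι) (c : ι → ℂ) (n a b : ι → ℤ), (∀ i, a i ^ 2 + b i ^ 2 ≤ 2 * m * n i) ∧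
    ∀ τ u v, UHP τ → HasSum (fun i => c i * eC (n i * τ / 8 + a i * u / 2 + b i * v / 2)) (Φ τ u v)

lemma eC_one_iff {n : ℤ} {d : ℤ} (hd : d ≠ 0) (h : eC (n / d) = 1) : d ∣ n := by
  unfold eC at h
  rw [Complex.exp_eq_one_iff] at h
  obtain ⟨j, hj⟩ := h
  have h2 : (2 * (Real.pi:ℂ) * I) ≠ 0 := by simp [Real.pi_ne_zero]
  rw [mul_comm (j:ℂ)] at hj
  have h3 := mul_left_cancel₀ h2 hj
  have hd' : (d:ℂ) ≠ 0 := by exact_mod_cast hd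
  rw [div_eq_iff hd'] at h3
  exact ⟨j, by rw [mul_comm]; exact_mod_cast h3⟩

lemma Fam2.four {m : ℕ} (hm : 0 < m) {Φ : ℂ → ℂ → ℂ → ℂ} (h : Fam2 m Φ)
    (hT : ∀ τ u v, UHP τ → Φ (τ + 1) u v = Φ τ u v)
    (hu : ∀ τ u v, UHP τ → Φ τ (u + 1) v = Φ τ u v)
    (hv : ∀ τ u v, UHP τ → Φ τ u (v + 1) = Φ τ u v) :
    ∃ c : ℕ → ℤ → ℤ → ℂ,
      (∀ (n : ℕ) (a b : ℤ), 4 * (n : ℤ) * m < a ^ 2 + b ^ 2 → c n a b = 0) ∧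
      FS (fun p : ℕ × ℤ × ℤ => c p.1 p.2.1 p.2.2) (fun p => p.1) (fun p => p.2.1) (fun p => p.2.2) Φ := by
  obtain ⟨ι, _, c, n, a, b, h1, h2⟩ := h
  set Ψ : ℂ → ℂ → ℂ → ℂ := fun τ u v => Φ (8 * τ) (2 * u) (2 * v) with hΨ
  have u8 : ∀ {τ}, UHP τ → UHP (8 * τ) := fun {τ} h => by
    have h' : 0 < τ.im := h
    show 0 < (8 * τ).im
    simp [Complex.mul_im]; linarith
  have u8' : ∀ {τ}, UHP τ → UHP (τ / 8) := fun {τ} h => by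
    have h' : 0 < τ.im := h
    show 0 < (τ / 8).im
    rw [show τ / 8 = ((1/8:ℝ):ℂ) * τ by push_cast; ring, Complex.im_ofReal_mul]
    positivity
  have f1 : FS c n a b Ψ := by
    intro τ u v hτ
    refine (h2 (8 * τ) (2 * u) (2 * v) (u8 hτ)).congr_fun fun i => ?_
    congr 2; ring
  have f2 : FZ (coef Ψ) Ψ := f1.toFZ
  have d8 : ∀ n a b, coef Ψ n a b ≠ 0 → (8:ℤ) ∣ n := by
    intro n a b hc
    have f3 : FZ (fun n a b => eC (n / (8:ℤ)) * coef Ψ n a b) Ψ := by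
      intro τ u v hτ
      have h8 : UHP (τ + 1/8) := by
        have h' : 0 < τ.im := hτ
        show 0 < (τ + 1/8).im
        simpa using h'
      have := f2 (τ + 1/8) u v h8
      have e : Ψ (τ + 1/8) u v = Ψ τ u v := by
        simp only [hΨ]; rw [← hT _ _ _ (u8 hτ)]; congr 1; ring
      rw [e] at this
      refine this.congr_fun fun x => ?_
      dsimp only
      rw [mul_comm (eC _), mul_assoc, ← eC_add]; congr 2; push_cast; ring
    have := FZ.coef f3 n a b
    refine eC_one_iff (by norm_num) ?_
    exact mul_right_cancel₀ hc (by rw [one_mul]; exact this.symm)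
  have da : ∀ n a b, coef Ψ n a b ≠ 0 → (2:ℤ) ∣ a := by
    intro n a b hc
    have f3 : FZ (fun n a b => eC (a / (2:ℤ)) * coef Ψ n a b) Ψ := by
      intro τ u v hτ
      have := f2 τ (u + 1/2) v hτ
      have e : Ψ τ (u + 1/2) v = Ψ τ u v := by
        simp only [hΨ]; rw [← hu (8 * τ) (2 * u) (2 * v) (u8 hτ)]; congr 1; ring
      rw [e] at this
      refine this.congr_fun fun x => ?_
      dsimp only
      rw [mul_comm (eC _), mul_assoc, ← eC_add]; congr 2; push_cast; ring
    have := FZ.coef f3 n a b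
    refine eC_one_iff (by norm_num) ?_
    exact mul_right_cancel₀ hc (by rw [one_mul]; exact this.symm)
  have db : ∀ n a b, coef Ψ n a b ≠ 0 → (2:ℤ) ∣ b := by
    intro n a b hc
    have f3 : FZ (fun n a b => eC (b / (2:ℤ)) * coef Ψ n a b) Ψ := by
      intro τ u v hτ
      have := f2 τ u (v + 1/2) hτ
      have e : Ψ τ u (v + 1/2) = Ψ τ u v := by
        simp only [hΨ]; rw [← hv (8 * τ) (2 * u) (2 * v) (u8 hτ)]; congr 1; ring
      rw [e] at this
      refine this.congr_fun fun x => ?_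
      dsimp only
      rw [mul_comm (eC _), mul_assoc, ← eC_add]; congr 2; push_cast; ring
    have := FZ.coef f3 n a b
    refine eC_one_iff (by norm_num) ?_
    exact mul_right_cancel₀ hc (by rw [one_mul]; exact this.symm)
  let g : Z3 → Z3 := fun x => (8 * x.1, 2 * x.2.1, 2 * x.2.2)
  have hg : Function.Injective g := by
    rintro ⟨x, y, z⟩ ⟨x', y', z'⟩ h
    simp [g] at h
    simp [h]
  have f4 : FS (fun x : Z3 => coef Ψ (8 * x.1) (2 * x.2.1) (2 * x.2.2)) (fun x => x.1) (fun x => x.2.1) (fun x => x.2.2) Φ := by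
    intro τ u v hτ
    have h3 := f2 (τ / 8) (u / 2) (v / 2) (u8' hτ)
    rw [show Ψ (τ / 8) (u / 2) (v / 2) = Φ τ u v by simp only [hΨ]; congr 1 <;> ring] at h3
    rw [← hg.hasSum_iff] at h3
    · refine h3.congr_fun fun x => ?_
      simp only [Function.comp, g]
      congr 2; push_cast; ring
    · intro x hx
      have : coef Ψ x.1 x.2.1 x.2.2 = 0 := by
        by_contra hc
        obtain ⟨j1, h1⟩ := d8 _ _ _ hc
        obtain ⟨j2, h2⟩ := da _ _ _ hc
        obtain ⟨j3, h3⟩ := db _ _ _ hc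
        exact hx ⟨(j1, j2, j3), by simp only [g]; rw [← h1, ← h2, ← h3]⟩
      simp [this]
  refine four_of hm f4 fun x hx => ?_
  by_contra hcon
  refine hx (f1.coef_eq_zero ?_)
  rintro i - ⟨e1, e2, e3⟩
  have := h1 i
  rw [e1, e2, e3] at this
  apply hcon
  linarith

lemma Fam1.tensor {m : ℕ} {F G : ℂ → ℂ → ℂ} (hF : Fam1 (2 * m) F) (hG : Fam1 (2 * m) G) (s : ℂ) :
    Fam2 m (fun τ u v => s * (F τ u * G τ v)) := by
  obtain ⟨ι, _, c, n, a, h1, h2⟩ := hF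
  obtain ⟨κ, _, d, n', a', h1', h2'⟩ := hG
  refine ⟨ι × κ, inferInstance, fun x => s * (c x.1 * d x.2), fun x => n x.1 + n' x.2, fun x => a x.1, fun x => a' x.2, ?_, ?_⟩
  · rintro ⟨i, j⟩
    have h3 := (h1 i).2
    have h4 := (h1' j).2
    push_cast at *
    linarith
  · intro τ u v hτ
    have A := h2 τ u hτ
    have B := h2' τ v hτ
    have C := summable_mul_of_summable_norm A.summable.norm B.summable.norm
    have D := (A.mul B C).mul_left s
    refine D.congr_fun fun x => ?_
    dsimp only
    have e : eC (((n x.1 + n' x.2 : ℤ):ℂ) * τ / 8 + a x.1 * u / 2 + a' x.2 * v / 2) =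
      eC (n x.1 * τ / 8 + a x.1 * u / 2) * eC (n' x.2 * τ / 8 + a' x.2 * v / 2) := by
      rw [← eC_add]; congr 1; push_cast; ring
    rw [e]; ring

lemma Fam2.add {m : ℕ} {F G : ℂ → ℂ → ℂ → ℂ} (hF : Fam2 m F) (hG : Fam2 m G) :
    Fam2 m (fun τ u v => F τ u v + G τ u v) := by
  obtain ⟨ι, _, c, n, a, b, h1, h2⟩ := hF
  obtain ⟨κ, _, d, n', a', b', h1', h2'⟩ := hG
  refine ⟨ι ⊕ κ, inferInstance, Sum.elim c d, Sum.elim n n', Sum.elim a a', Sum.elim b b', ?_, ?_⟩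
  · rintro (i | i)
    · exact h1 i
    · exact h1' i
  · intro τ u v hτ
    exact HasSum.sum (f := fun x : ι ⊕ κ => Sum.elim c d x * eC (((Sum.elim n n' x : ℤ):ℂ) * τ / 8 + ((Sum.elim a a' x : ℤ):ℂ) * u / 2 + ((Sum.elim b b' x : ℤ):ℂ) * v / 2)) (h2 τ u v hτ) (h2' τ u v hτ)

lemma J1.isK {k k' m : ℕ} (hm : 0 < m) {ε s : ℂ} {F G : ℂ → ℂ → ℂ} (hF : J1 k m ε F) (hG : J1 k' m ε G)
    (h1 : ε = I ^ (k + k') * s) (h2 : s * ε = I ^ (k + k')) :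
    IsK (k + k') m (fun τ u v => F τ u * G τ v + s * (G τ u * F τ v)) := by
  have hT : ∀ τ u v, UHP τ → F (τ + 1) u * G (τ + 1) v + s * (G (τ + 1) u * F (τ + 1) v) = F τ u * G τ v + s * (G τ u * F τ v) := by
    intro τ u v hτ
    simp only [hF.T _ _ hτ, hG.T _ _ hτ]
  have c1 : Differentiable ℂ (fun p : ℂ × ℂ × ℂ => (p.1, p.2.1)) := by fun_prop
  have c2 : Differentiable ℂ (fun p : ℂ × ℂ × ℂ => (p.1, p.2.2)) := by fun_prop
  refine ⟨?_, ?_, ?_, ?_, ?_⟩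
  · have a1 := hF.holo.comp c1.differentiableOn (fun p (hp : p ∈ {p : ℂ × ℂ × ℂ | UHP p.1}) => hp)
    have a2 := hF.holo.comp c2.differentiableOn (fun p (hp : p ∈ {p : ℂ × ℂ × ℂ | UHP p.1}) => hp)
    have a3 := hG.holo.comp c1.differentiableOn (fun p (hp : p ∈ {p : ℂ × ℂ × ℂ | UHP p.1}) => hp)
    have a4 := hG.holo.comp c2.differentiableOn (fun p (hp : p ∈ {p : ℂ × ℂ × ℂ | UHP p.1}) => hp)
    exact (a1.mul a4).add ((a3.mul a2).const_mul s)
  · intro M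
    refine MdLaw.all (k := k + k') (m := m) (Φ := fun τ u v => F τ u * G τ v + s * (G τ u * F τ v)) ?_ ?_ M
    · intro τ u v hτ
      have e1 : Ma ModularGroup.S = 0 := by simp [Ma, ModularGroup.S]
      have e2 : Mb ModularGroup.S = -1 := by simp [Mb, ModularGroup.S]
      have e3 : Mc ModularGroup.S = 1 := by simp [Mc, ModularGroup.S]
      have e4 : Md ModularGroup.S = 0 := by simp [Md, ModularGroup.S]
      rw [e1, e2, e3, e4]
      simp only [zero_mul, zero_add, one_mul, add_zero, mul_one]
      rw [hF.S _ _ hτ, hG.S _ _ hτ, hF.S _ _ hτ, hG.S _ _ hτ,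
        show (m:ℂ) * (u ^ 2 + v ^ 2) / τ = m * u ^ 2 / τ + m * v ^ 2 / τ by ring, eC_add]
      ring
    · intro τ u v hτ
      have e1 : Ma ModularGroup.T = 1 := by simp [Ma, ModularGroup.T]
      have e2 : Mb ModularGroup.T = 1 := by simp [Mb, ModularGroup.T]
      have e3 : Mc ModularGroup.T = 0 := by simp [Mc, ModularGroup.T]
      have e4 : Md ModularGroup.T = 1 := by simp [Md, ModularGroup.T]
      rw [e1, e2, e3, e4]
      simp only [zero_mul, zero_add, one_mul, mul_zero, div_one, one_pow, eC_zero]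
      exact hT τ u v hτ
  · intro τ u v hτ
    rw [hF.neg _ _ hτ, hG.neg _ _ hτ]
    linear_combination (F τ v * G τ u) * h1 + (F τ u * G τ v) * h2
  · intro p p' q q' τ u v hτ
    have E1 := fun p p' u => ell1 (m := m) (G := F τ) (fun u => hF.one τ u hτ) (fun u => hF.tau τ u hτ) p p' u
    have E2 := fun p p' u => ell1 (m := m) (G := G τ) (fun u => hG.one τ u hτ) (fun u => hG.tau τ u hτ) p p' u
    rw [E1, E1, E2, E2]
    have : eC (-(m:ℂ) * (((p:ℂ) ^ 2 + (q:ℂ) ^ 2) * τ + 2 * p * u + 2 * q * v)) = eC (-m * (p ^ 2 * τ + 2 * p * u)) * eC (-m * (q ^ 2 * τ + 2 * q * v)) := by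
      rw [← eC_add]; congr 1; ring
    rw [this]
    ring
  · refine Fam2.four hm ?_ hT ?_ ?_
    · simpa using (hF.fam.tensor hG.fam 1).add (hG.fam.tensor hF.fam s)
    · intro τ u v hτ
      simp only [hF.one _ _ hτ, hG.one _ _ hτ]
    · intro τ u v hτ
      simp only [hF.one _ _ hτ, hG.one _ _ hτ]

lemma MFS.lim {w : ℕ} {f0 : ℂ} {f : ℂ → ℂ} (h : MFS w f0 f) :
    Filter.Tendsto (fun y : ℝ => f (y * I)) Filter.atTop (nhds f0) := by
  obtain ⟨c, c0, hc⟩ := h.ser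
  have hI : UHP I := by simp [UHP]
  have hb := (hc I hI).summable.norm
  have key := tendsto_tsum_of_dominated_convergence (𝓕 := Filter.atTop) (f := fun (y : ℝ) (n : ℕ) => c n * eC (n * (y * I)))
    (g := fun n => if n = 0 then c 0 else 0) hb ?_ ?_
  · rw [tsum_ite_eq, c0] at key
    refine key.congr' ?_
    filter_upwards [Filter.eventually_gt_atTop 0] with y hy
    exact (hc _ (by simpa [UHP] using hy)).tsum_eq
  · intro n
    by_cases hn : n = 0
    · subst hn; simp [eC_zero]
    · simp only [hn, if_false]
      rw [tendsto_zero_iff_norm_tendsto_zero]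
      simp only [norm_mul, norm_eC]
      rw [← mul_zero ‖c n‖]
      refine Filter.Tendsto.const_mul _ ?_
      refine Real.tendsto_exp_atBot.comp ?_
      have : (fun y : ℝ => -2 * Real.pi * ((n:ℂ) * (y * I)).im) = fun y : ℝ => -(2 * Real.pi * n * y) := by
        funext y; simp; ring
      rw [this]
      refine Filter.tendsto_neg_atTop_atBot.comp ?_
      refine Filter.Tendsto.const_mul_atTop ?_ Filter.tendsto_id
      have : (0:ℝ) < n := by positivity
      positivity
  · filter_upwards [Filter.eventually_ge_atTop 1] with y hy n
    simp only [norm_mul, norm_eC]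
    refine mul_le_mul_of_nonneg_left (Real.exp_le_exp.2 ?_) (norm_nonneg _)
    have h1 : ((n:ℂ) * (y * I)).im = n * y := by simp
    have h2 : ((n:ℂ) * I).im = n := by simp
    rw [h1, h2]
    have := Real.pi_pos
    have : (0:ℝ) ≤ 2 * Real.pi * n := by positivity
    nlinarith

lemma eC_real (x : ℝ) : eC (x * I) = ((Real.exp (-2 * Real.pi * x) : ℝ) : ℂ) := by
  unfold eC
  push_cast
  congr 1
  linear_combination (2 * Real.pi * x) * I_mul_I

lemma tt_pos (α : ℤ) {y : ℝ} (hy : 0 < y) : ∃ x : ℝ, 0 < x ∧ tt α 0 (y * I) 0 = x := by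
  have hτ : UHP (y * I) := by simpa [UHP] using hy
  have h := tt_ser α 0 0 hτ
  have h2 : HasSum (fun n : ℤ => ((Real.exp (-2 * Real.pi * ((2 * n + α) ^ 2 * y / 8)) : ℝ) : ℂ)) (tt α 0 (y * I) 0) := by
    refine h.congr_fun fun n => ?_
    rw [← eC_real]
    simp [eC_zero]
    congr 1; ring
  have h3 := Complex.hasSum_re h2
  have h4 := Complex.hasSum_im h2
  simp only [ofReal_im, ofReal_re] at h3 h4
  refine ⟨(tt α 0 (y * I) 0).re, ?_, ?_⟩
  · rw [← h3.tsum_eq]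
    exact h3.summable.tsum_pos (fun i => (Real.exp_pos _).le) 0 (Real.exp_pos _)
  · exact Complex.ext (by simp) (by rw [ofReal_im]; exact h4.unique hasSum_zero)

lemma tt01_real {y : ℝ} (hy : 0 < y) : ∃ x : ℝ, tt 0 1 (y * I) 0 = x := by
  have hτ : UHP (y * I) := by simpa [UHP] using hy
  have h := tt_ser 0 1 0 hτ
  have h4 := Complex.hasSum_im h
  refine ⟨(tt 0 1 (y * I) 0).re, Complex.ext (by simp) ?_⟩
  rw [ofReal_im]
  refine h4.unique ?_
  refine hasSum_zero.congr_fun fun n => ?_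
  have e1 : eC ((2 * n + ((0:ℤ):ℂ)) ^ 2 * (y * I) / 8 + (2 * n + ((0:ℤ):ℂ)) * 0 / 2) = ((Real.exp (-2 * Real.pi * (n ^ 2 * y / 2)) : ℝ) : ℂ) := by
    rw [← eC_real]; congr 1; push_cast; ring
  have e2 : eC ((2 * n + ((0:ℤ):ℂ)) * ((1:ℤ):ℂ) / 4) ^ 2 = 1 := by
    rw [_root_.e2, ← eC_int n]; congr 1; push_cast; ring
  rw [e1, Complex.im_mul_ofReal]
  rcases mul_self_eq_one_iff.1 ((sq _).symm.trans e2) with h | h <;> rw [h] <;> simp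

lemma tt01_ne {y : ℝ} (hy : 1 ≤ y) : tt 0 1 (y * I) 0 ≠ 0 := by
  have hτ : UHP (y * I) := by simp [UHP]; linarith
  have hτ1 : UHP (y * I + 1) := by simp [UHP]; linarith
  have h0 := tt_T0 0 0 hτ
  have h1 := norm_jacobiTheta_sub_one_le hτ1
  intro hz
  rw [zero_add, hz] at h0
  have h2 : jacobiTheta (y * I + 1) = 0 := by
    have h3 : tt 0 0 (y * I + 1) 0 = jacobiTheta₂ 0 (y * I + 1) := by simp [tt, eC_zero]
    rw [jacobiTheta_eq_jacobiTheta₂, ← h3, h0]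
  rw [h2] at h1
  simp at h1
  have hq : Real.exp (-(Real.pi * y)) < 1/4 := by
    rw [Real.exp_neg, inv_lt_comm₀ (Real.exp_pos _) (by norm_num)]
    have := Real.add_one_le_exp (Real.pi * y)
    nlinarith [Real.pi_gt_three]
  have hq0 := Real.exp_pos (-(Real.pi * y))
  rw [div_mul_eq_mul_div, le_div_iff₀ (by linarith)] at h1
  linarith

lemma exists_tau : ∃ τ, UHP τ ∧ E6C τ ≠ 0 ∧ PP τ ≠ 0 ∧ BB τ 0 ≠ 0 := by
  have h := E6C_MFS.lim.eventually_ne one_ne_zero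
  obtain ⟨y, hy6, hy⟩ := (h.and (Filter.eventually_ge_atTop 1)).exists
  have hy0 : 0 < y := by linarith
  obtain ⟨a, ha, ha'⟩ := tt_pos 0 hy0
  obtain ⟨c, hc, hc'⟩ := tt_pos 1 hy0
  obtain ⟨b, hb'⟩ := tt01_real hy0
  have hb := tt01_ne hy
  refine ⟨y * I, by simpa [UHP] using hy0, hy6, ?_, ?_⟩
  · unfold PP
    rw [ha', hc']
    refine mul_ne_zero (mul_ne_zero ?_ hb) ?_
    · exact_mod_cast ha.ne'
    · exact_mod_cast hc.ne'
  · unfold BB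
    rw [ha', hb', hc']
    have : (0:ℝ) < a ^ 6 * a ^ 2 + b ^ 6 * b ^ 2 + c ^ 6 * c ^ 2 := by
      have : 0 ≤ b ^ 6 * b ^ 2 := by positivity
      positivity
    exact_mod_cast this.ne'

lemma an_of {f : ℂ → ℂ} (h : Differentiable ℂ f) : AnalyticOnNhd ℂ f Set.univ :=
  fun z _ => h.analyticAt z

lemma mul_zero_an {f g : ℂ → ℂ} (hf : Differentiable ℂ f) (hg : Differentiable ℂ g) (h : ∀ u, f u * g u = 0)
    (hne : ∃ u, f u ≠ 0) : ∀ u, g u = 0 := by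
  rcases (an_of hf).eq_zero_or_eq_zero_of_mul_eq_zero (an_of hg) (fun z _ => h z) isPreconnected_univ with h1 | h1
  · obtain ⟨u, hu⟩ := hne
    exact absurd (h1 u trivial) hu
  · exact fun u => h1 u trivial

lemma li_AB {A B : ℂ → ℂ} (hA : Differentiable ℂ A) (hB : Differentiable ℂ B) (hA0 : A 0 = 0) (hB0 : B 0 ≠ 0)
    (hA1 : ∃ u, A u ≠ 0) (n : ℕ) : ∀ c : ℕ → ℂ, (∀ u, ∑ a ∈ Finset.range (n + 1), c a * (A u ^ a * B u ^ (n - a)) = 0) →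
      ∀ a < n + 1, c a = 0 := by
  induction n with
  | zero => intro c h a ha; have := h 0; simp at this; simpa [show a = 0 by omega] using this
  | succ n ih =>
    intro c h
    have h0 : c 0 = 0 := by
      have := h 0
      rw [Finset.sum_range_succ'] at this
      simpa [hA0, hB0] using this
    have h1 : ∀ u, A u * ∑ a ∈ Finset.range (n + 1), c (a + 1) * (A u ^ a * B u ^ (n - a)) = 0 := by
      intro u
      have := h u
      rw [Finset.sum_range_succ', h0, zero_mul, add_zero] at this
      rw [← this, Finset.mul_sum]
      refine Finset.sum_congr rfl fun a _ => ?_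
      rw [Nat.add_sub_add_right]; ring
    have h2 := mul_zero_an hA (by fun_prop) h1 hA1
    have h3 := ih _ h2
    intro a ha
    rcases a with _ | a
    · exact h0
    · exact h3 a (by omega)

/-- tensor independence -/
lemma tens {ι : Type} [Fintype ι] {f : ι → ℂ → ℂ} (hf : LinearIndependent ℂ f) (c : ι × ι → ℂ)
    (h : ∀ u v, ∑ x, c x * (f x.1 u * f x.2 v) = 0) : ∀ x, c x = 0 := by
  rw [Fintype.linearIndependent_iff] at hf
  have h1 : ∀ v p, ∑ q, c (p, q) * f q v = 0 := by
    intro v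
    refine hf (fun p => ∑ q, c (p, q) * f q v) ?_
    funext u
    simp only [Finset.sum_apply, Pi.smul_apply, smul_eq_mul, Pi.zero_apply]
    rw [← h u v, Fintype.sum_prod_type]
    refine Finset.sum_congr rfl fun p _ => ?_
    rw [Finset.sum_mul]
    refine Finset.sum_congr rfl fun q _ => ?_
    ring
  rintro ⟨p, q⟩
  refine hf (fun q => c (p, q)) ?_ q
  funext v
  simpa using h1 v p

lemma tens2 {ι κ : Type} [Fintype ι] [Fintype κ] {f : ι → ℂ → ℂ} {g : κ → ℂ → ℂ} (hf : LinearIndependent ℂ f)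
    (hg : LinearIndependent ℂ g) (he : ∀ i u, f i (-u) = f i u) (ho : ∀ i u, g i (-u) = -g i u) :
    LinearIndependent ℂ (Sum.elim (fun x : ι × ι => fun y : ℂ × ℂ => f x.1 y.1 * f x.2 y.2)
      (fun x : κ × κ => fun y : ℂ × ℂ => g x.1 y.1 * g x.2 y.2)) := by
  rw [Fintype.linearIndependent_iff]
  intro c hc
  have h1 : ∀ u v, ∑ x, c (Sum.inl x) * (f x.1 u * f x.2 v) + ∑ x, c (Sum.inr x) * (g x.1 u * g x.2 v) = 0 := by
    intro u v
    have := congrFun hc (u, v)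
    simpa [Fintype.sum_sum_type] using this
  have h2 : ∀ u v, ∑ x, c (Sum.inl x) * (f x.1 u * f x.2 v) - ∑ x, c (Sum.inr x) * (g x.1 u * g x.2 v) = 0 := by
    intro u v
    have := h1 (-u) v
    simpa [he, ho, sub_eq_add_neg] using this
  rintro (x | x)
  · exact tens hf (fun x => c (Sum.inl x)) (fun u v => by linear_combination (h1 u v + h2 u v) / 2) x
  · exact tens hg (fun x => c (Sum.inr x)) (fun u v => by linear_combination (h1 u v - h2 u v) / 2) x

lemma J1.cast {k m k' m' : ℕ} {ε ε' : ℂ} {F F' : ℂ → ℂ → ℂ} (h : J1 k m ε F) (h1 : k = k') (h2 : m = m') (h3 : ε = ε')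
    (h4 : F = F') : J1 k' m' ε' F' := by subst h1 h2 h3 h4; exact h

lemma J1.diff {k m : ℕ} {ε : ℂ} {F : ℂ → ℂ → ℂ} (h : J1 k m ε F) {τ : ℂ} (hτ : UHP τ) : Differentiable ℂ (F τ) := by
  intro u
  have ho : IsOpen {p : ℂ × ℂ | UHP p.1} := by
    have : {p : ℂ × ℂ | UHP p.1} = (fun p : ℂ × ℂ => p.1.im) ⁻¹' Set.Ioi 0 := by ext; simp [UHP]
    rw [this]
    exact isOpen_Ioi.preimage (by fun_prop)
  have h1 : DifferentiableAt ℂ (fun p : ℂ × ℂ => F p.1 p.2) (τ, u) := h.holo.differentiableAt (ho.mem_nhds hτ)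
  exact h1.comp u (f := fun u => (τ, u)) (by fun_prop)

lemma tens_mem {m : ℕ} (hm : 0 < m) {τ : ℂ} (hE : E6C τ ≠ 0) {V : Submodule ℂ (ℂ × ℂ → ℂ)}
    (hV : ∀ k Φ, k % 2 = 0 → IsK k m Φ → (fun y : ℂ × ℂ => Φ τ y.1 y.2) ∈ V)
    {k k' : ℕ} {ε : ℂ} (hε : ε ^ 2 = 1) (hk : (k + k') % 2 = 0) {F G : ℂ → ℂ → ℂ} (hF : J1 k m ε F) (hG : J1 k' m ε G) :
    (fun y : ℂ × ℂ => F τ y.1 * G τ y.2) ∈ V := by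
  set η := I ^ (k + k') with hη
  have hη2 : η ^ 2 = 1 := by
    obtain ⟨l, hl⟩ := Nat.dvd_of_mod_eq_zero hk
    rw [hη, hl, pow_mul, I_sq, ← pow_mul, mul_comm, pow_mul]; norm_num
  have h1 := hV _ _ hk (J1.isK hm hF hG (s := ε * η) (by linear_combination (-ε) * hη2) (by linear_combination η * hε))
  have hF' : J1 (k + 6) m ε (fun τ u => F τ u * E6C τ) :=
    (hF.mul (J1.ser E6C_MFS)).cast rfl (by simp) (by simp) rfl
  have hη' : I ^ (k + 6 + k') = -η := by
    rw [hη, show k + 6 + k' = (k + k') + 6 by ring, pow_add, show (6:ℕ) = 2 * 3 by norm_num, pow_mul I, I_sq]; norm_num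
  have h2 := hV _ _ (by omega) (J1.isK hm hF' hG (s := - (ε * η)) (by rw [hη']; linear_combination (-ε) * hη2)
    (by rw [hη']; linear_combination (-η) * hε))
  have h3 := V.smul_mem (1/2) (V.add_mem h1 (V.smul_mem (E6C τ)⁻¹ h2))
  convert h3 using 1
  funext y
  simp only [Pi.smul_apply, Pi.add_apply, smul_eq_mul]
  field_simp
  ring

def fA (m a : ℕ) (τ u : ℂ) : ℂ := AA τ u ^ a * BB τ u ^ (m - a)
def fC (m b : ℕ) (τ u : ℂ) : ℂ := CC τ u * (AA τ u ^ b * BB τ u ^ (m - 2 - b))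

lemma fA_J1 {m a : ℕ} (h : a ≤ m) : J1 (a * 10 + (m - a) * 4) m 1 (fA m a) :=
  ((AA_J1.pow a).mul (BB_J1.pow (m - a))).cast rfl (by omega) (by simp) rfl

lemma fC_J1 {m b : ℕ} (h : b < m - 1) : J1 (11 + (b * 10 + (m - 2 - b) * 4)) m (-1) (fC m b) :=
  (CC_J1.mul ((AA_J1.pow b).mul (BB_J1.pow (m - 2 - b)))).cast rfl (by omega) (by simp) rfl

lemma tt11_ne {τ : ℂ} (hP : PP τ ≠ 0) : ∃ u, tt 1 1 τ u ≠ 0 := by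
  have h0 : tt 0 0 τ 0 ≠ 0 := by
    intro h; exact hP (by simp [PP, h])
  refine ⟨-(τ / 2) - 1 / 2, ?_⟩
  unfold tt
  refine mul_ne_zero (eC_ne _) ?_
  have h1 : tt 0 0 τ 0 = jacobiTheta₂ 0 τ := by simp [tt, eC_zero]
  rw [h1] at h0
  convert h0 using 2
  push_cast; ring

lemma tt11_zero {τ : ℂ} (hτ : UHP τ) : tt 1 1 τ 0 = 0 := by
  have := tt_neg 1 1 0 hτ
  rw [show (-((1:ℤ):ℂ) * ((1:ℤ):ℂ) / 2) = -1/2 by push_cast; ring, eC_half', neg_zero] at this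
  linear_combination this / 2

lemma rank_lower {m : ℕ} (hm : 0 < m) {τ : ℂ} (hτ : UHP τ) (hE : E6C τ ≠ 0) (hP : PP τ ≠ 0) (hB : BB τ 0 ≠ 0)
    {V : Submodule ℂ (ℂ × ℂ → ℂ)} [Module.Finite ℂ V]
    (hV : ∀ k Φ, k % 2 = 0 → IsK k m Φ → (fun y : ℂ × ℂ => Φ τ y.1 y.2) ∈ V) : 2 * m ^ 2 + 2 ≤ Module.finrank ℂ V := by
  have dA := AA_J1.diff hτ
  have dB := BB_J1.diff hτ
  have dC := CC_J1.diff hτ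
  obtain ⟨u0, hu0⟩ := tt11_ne hP
  have hA1 : ∃ u, AA τ u ≠ 0 := ⟨u0, mul_ne_zero (pow_ne_zero _ hP) (pow_ne_zero _ hu0)⟩
  have hC1 : ∃ u, CC τ u ≠ 0 := ⟨u0 / 2, by
    refine mul_ne_zero (pow_ne_zero _ hP) ?_
    rwa [mul_div_cancel₀ _ (two_ne_zero)]⟩
  have hA0 : AA τ 0 = 0 := by simp [AA, tt11_zero hτ]
  have key := li_AB dA dB hA0 hB hA1
  have l1 : LinearIndependent ℂ (fun a : Fin (m + 1) => fA m a τ) := by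
    rw [Fintype.linearIndependent_iff]
    intro c hc i
    have := key m (fun a => if h : a < m + 1 then c ⟨a, h⟩ else 0) (fun u => by
      rw [Finset.sum_range]
      have := congrFun hc u
      simp only [Finset.sum_apply, Pi.smul_apply, smul_eq_mul, Pi.zero_apply, fA] at this
      rw [← this]
      refine Finset.sum_congr rfl fun a _ => ?_
      simp only [Fin.is_lt, dite_true, Fin.eta]) i i.2
    simpa only [Fin.is_lt, dite_true, Fin.eta] using this
  have l2 : LinearIndependent ℂ (fun a : Fin (m - 1) => fC m a τ) := by
    rw [Fintype.linearIndependent_iff]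
    intro c hc i
    have hi := i.2
    have hm1 : m - 2 + 1 = m - 1 := by omega
    have := key (m - 2) (fun a => if h : a < m - 1 then c ⟨a, h⟩ else 0) (mul_zero_an dC (by fun_prop) (fun u => by
      rw [hm1, Finset.sum_range]
      have := congrFun hc u
      simp only [Finset.sum_apply, Pi.smul_apply, smul_eq_mul, Pi.zero_apply, fC] at this
      rw [← this, Finset.mul_sum]
      refine Finset.sum_congr rfl fun a _ => ?_
      simp only [Fin.is_lt, dite_true, Fin.eta]
      ring) hC1) i (by omega)
    simpa using this
  have l3 := tens2 l1 l2 (fun i u => by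
      rw [(fA_J1 (by omega : (i:ℕ) ≤ m)).neg τ u hτ, one_mul]) (fun i u => by
      rw [(fC_J1 i.2).neg τ u hτ, neg_one_mul])
  have hr : ∀ x, (Sum.elim (fun x : Fin (m + 1) × Fin (m + 1) => fun y : ℂ × ℂ => fA m x.1 τ y.1 * fA m x.2 τ y.2)
      (fun x : Fin (m - 1) × Fin (m - 1) => fun y : ℂ × ℂ => fC m x.1 τ y.1 * fC m x.2 τ y.2)) x ∈ V := by
    rintro (x | x)
    · exact tens_mem hm hE hV (by norm_num) (by omega) (fA_J1 (by omega : (x.1:ℕ) ≤ m)) (fA_J1 (by omega : (x.2:ℕ) ≤ m))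
    · exact tens_mem hm hE hV (by norm_num) (by omega) (fC_J1 x.1.2) (fC_J1 x.2.2)
  have h1 := finrank_span_eq_card l3
  have h2 := Submodule.finrank_mono (Submodule.span_le.2 (Set.range_subset_iff.2 hr))
  rw [h1] at h2
  simp only [Fintype.card_sum, Fintype.card_prod, Fintype.card_fin] at h2
  refine le_trans (le_of_eq ?_) h2
  obtain ⟨l, rfl⟩ : ∃ l, m = l + 1 := ⟨m - 1, by omega⟩
  simp only [Nat.add_sub_cancel]
  ring

structure FreeP (m c : ℕ) {ι : Type} [Fintype ι] (w : ι → ℕ) (g : ι → ℂ → ℂ → ℂ → ℂ) : Prop where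
  mem : ∀ i, w i % 4 = c ∧ IsHJF (w i) m (g i)
  gen : ∀ k, k % 4 = c → ∀ φ, IsHJF k m φ → ∃ f : ι → ℂ → ℂ, (∀ i, IsE4E6sqPoly (w i) k (f i)) ∧
    ∀ τ z₁ z₂ : ℂ, UHP τ → φ τ z₁ z₂ = ∑ i, f i τ * g i τ z₁ z₂
  uni : ∀ k, k % 4 = c → ∀ f f' : ι → (ℂ → ℂ),
          (∀ i, IsE4E6sqPoly (w i) k (f i)) → (∀ i, IsE4E6sqPoly (w i) k (f' i)) →
          (∀ τ z₁ z₂ : ℂ, UHP τ →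
            ∑ i, f i τ * g i τ z₁ z₂ = ∑ i, f' i τ * g i τ z₁ z₂) →
          ∀ i, ∀ τ : ℂ, UHP τ → f i τ = f' i τ

lemma two_free (m : ℕ) (hm : 0 < m) : (∃ w g, FreeP m 0 (ι := Fin (m ^ 2 + 2)) w g) ∧ (∃ w g, FreeP m 2 (ι := Fin (m ^ 2)) w g) := by
  obtain ⟨n0, w0, g0, hn0, hw0, hg0, hu0⟩ := freeK m hm 0 (Or.inl rfl)
  obtain ⟨n2, w2, g2, hn2, hw2, hg2, hu2⟩ := freeK m hm 2 (Or.inr rfl)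
  obtain ⟨τ, hτ, hE, hP, hB⟩ := exists_tau
  have hr : 2 * m ^ 2 + 2 ≤ n0 + n2 := by
    set e : Fin n0 ⊕ Fin n2 → ℂ × ℂ → ℂ := Sum.elim (fun i y => g0 i τ y.1 y.2) (fun i y => g2 i τ y.1 y.2) with he
    have hf : Module.Finite ℂ (Submodule.span ℂ (Set.range e)) :=
      Module.Finite.span_of_finite ℂ (Set.finite_range e)
    have h1 := rank_lower hm hτ hE hP hB (V := Submodule.span ℂ (Set.range e)) (by
      intro k Φ hk hΦ
      have : k % 4 = 0 ∨ k % 4 = 2 := by omega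
      rcases this with h | h
      · obtain ⟨f, _, hf⟩ := hg0 k h Φ hΦ
        have : (fun y : ℂ × ℂ => Φ τ y.1 y.2) = ∑ i, f i τ • e (Sum.inl i) := by
          funext y; rw [hf _ _ _ hτ]; simp [he]
        rw [this]
        exact Submodule.sum_mem _ fun i _ => Submodule.smul_mem _ _ (Submodule.subset_span ⟨_, rfl⟩)
      · obtain ⟨f, _, hf⟩ := hg2 k h Φ hΦ
        have : (fun y : ℂ × ℂ => Φ τ y.1 y.2) = ∑ i, f i τ • e (Sum.inr i) := by
          funext y; rw [hf _ _ _ hτ]; simp [he]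
        rw [this]
        exact Submodule.sum_mem _ fun i _ => Submodule.smul_mem _ _ (Submodule.subset_span ⟨_, rfl⟩))
    have h2 := finrank_range_le_card (R := ℂ) e
    simp only [Fintype.card_sum, Fintype.card_fin] at h2
    exact h1.trans h2
  simp only [if_true] at hn0
  norm_num at hn2
  obtain rfl : n0 = m ^ 2 + 2 := by omega
  obtain rfl : n2 = m ^ 2 := by omega
  have conv : ∀ (n c : ℕ) (w : Fin n → ℕ) (g : Fin n → ℂ → ℂ → ℂ → ℂ), (∀ i, w i % 4 = c ∧ IsK (w i) m (g i)) →
      (∀ k, k%4=c → ∀ Φ, IsK k m Φ → ∃ f : Fin n → ℂ → ℂ, (∀ i, f i ∈ QQ DD (w i) k) ∧ ∀ τ u v, UHP τ → Φ τ u v = ∑ i, f i τ * g i τ u v) →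
      (∀ k, k%4=c → ∀ f : Fin n → ℂ → ℂ, (∀ i, f i ∈ QQ DD (w i) k) → (∀ τ u v, UHP τ → ∑ i, f i τ * g i τ u v = 0) → ∀ i τ, UHP τ → f i τ = 0) →
      FreeP m c w (fun i => ofK (g i)) := by
    intro n c w g h1 h2 h3
    refine ⟨fun i => ⟨(h1 i).1, (h1 i).2.ofK⟩, ?_, ?_⟩
    · intro k hk φ hφ
      obtain ⟨f, hf, h⟩ := h2 k hk _ hφ.toK
      refine ⟨f, fun i => (poly_iff _ _ _).2 ⟨f i, hf i, fun _ _ => rfl⟩, fun τ z₁ z₂ hτ => ?_⟩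
      rw [← ofK_toK φ]
      exact h τ _ _ hτ
    · intro k hk f f' hf hf' h i τ hτ
      choose q hq hfq using fun i => (poly_iff _ _ _).1 (hf i)
      choose q' hq' hfq' using fun i => (poly_iff _ _ _).1 (hf' i)
      have := h3 k hk (fun i => q i - q' i) (fun i => Submodule.sub_mem _ (hq i) (hq' i)) (fun τ u v hτ => by
        have := h τ (u - I * v) (u + I * v) hτ
        have e : ∀ i, ofK (g i) τ (u - I * v) (u + I * v) = g i τ u v := fun i =>
          congrFun (congrFun (congrFun (toK_ofK (g i)) τ) u) v
        simp only [e] at this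
        simp only [Pi.sub_apply, sub_mul, Finset.sum_sub_distrib]
        rw [sub_eq_zero]
        simpa only [hfq _ τ hτ, hfq' _ τ hτ] using this) i τ hτ
      rw [hfq i τ hτ, hfq' i τ hτ]
      exact sub_eq_zero.1 this
  exact ⟨⟨_, _, conv _ _ _ _ hw0 hg0 hu0⟩, ⟨_, _, conv _ _ _ _ hw2 hg2 hu2⟩⟩

lemma poly_zero (v k : ℕ) : IsE4E6sqPoly v k (fun _ => 0) := ⟨0, fun τ _ => by simp⟩

lemma poly_eq_zero {v k : ℕ} (h : v % 4 ≠ k % 4) {f : ℂ → ℂ} (hf : IsE4E6sqPoly v k f) {τ : ℂ} (hτ : UHP τ) : f τ = 0 := by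
  obtain ⟨l, hl⟩ := hf
  rw [hl τ hτ]
  refine Finset.sum_eq_zero fun p hp => ?_
  have := (Finset.mem_filter.1 hp).2
  omega

lemma main_i (m : ℕ) (hm : 0 < m) : ∃ (w : Fin (2 * (m ^ 2 + 1)) → ℕ) (g : Fin (2 * (m ^ 2 + 1)) → (ℂ → ℂ → ℂ → ℂ)),
      (∀ i, w i % 2 = 0 ∧ IsHJF (w i) m (g i)) ∧
      ∀ k : ℕ, k % 2 = 0 → ∀ φ : ℂ → ℂ → ℂ → ℂ, IsHJF k m φ →
        (∃ f : Fin (2 * (m ^ 2 + 1)) → (ℂ → ℂ),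
          (∀ i, IsE4E6sqPoly (w i) k (f i)) ∧
          ∀ τ z₁ z₂ : ℂ, UHP τ → φ τ z₁ z₂ = ∑ i, f i τ * g i τ z₁ z₂) ∧
        (∀ f f' : Fin (2 * (m ^ 2 + 1)) → (ℂ → ℂ),
          (∀ i, IsE4E6sqPoly (w i) k (f i)) → (∀ i, IsE4E6sqPoly (w i) k (f' i)) →
          (∀ τ z₁ z₂ : ℂ, UHP τ →
            ∑ i, f i τ * g i τ z₁ z₂ = ∑ i', f' i' τ * g i' τ z₁ z₂) →
          ∀ i, ∀ τ : ℂ, UHP τ → f i τ = f' i τ) := by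
  obtain ⟨⟨w0, g0, h0⟩, w2, g2, h2⟩ := two_free m hm
  let E : Fin (2 * (m ^ 2 + 1)) ≃ Fin (m ^ 2 + 2) ⊕ Fin (m ^ 2) :=
    Fintype.equivOfCardEq (by simp; ring)
  have hw : ∀ x, Sum.elim w0 w2 x % 2 = 0 ∧ IsHJF (Sum.elim w0 w2 x) m (Sum.elim g0 g2 x) := by
    rintro (i | i)
    · exact ⟨by have := (h0.mem i).1; simp; omega, (h0.mem i).2⟩
    · exact ⟨by have := (h2.mem i).1; simp; omega, (h2.mem i).2⟩
  have hs : ∀ (f : Fin (2 * (m ^ 2 + 1)) → ℂ → ℂ) (τ z₁ z₂ : ℂ), ∑ i, f i τ * Sum.elim g0 g2 (E i) τ z₁ z₂ =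
      ∑ i, f (E.symm (Sum.inl i)) τ * g0 i τ z₁ z₂ + ∑ i, f (E.symm (Sum.inr i)) τ * g2 i τ z₁ z₂ := by
    intro f τ z₁ z₂
    rw [← E.symm.sum_comp, Fintype.sum_sum_type]
    simp
  refine ⟨fun i => Sum.elim w0 w2 (E i), fun i => Sum.elim g0 g2 (E i), fun i => hw (E i), ?_⟩
  intro k hk φ hφ
  have hk4 : k % 4 = 0 ∨ k % 4 = 2 := by omega
  constructor
  · rcases hk4 with h | h
    · obtain ⟨f, hf, h⟩ := h0.gen k h φ hφ
      refine ⟨fun i => Sum.elim f (fun _ _ => 0) (E i), fun i => ?_, fun τ z₁ z₂ hτ => ?_⟩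
      · beta_reduce; rcases E i with i | i
        · exact hf i
        · exact poly_zero _ _
      · rw [hs, h τ z₁ z₂ hτ]; simp
    · obtain ⟨f, hf, h⟩ := h2.gen k h φ hφ
      refine ⟨fun i => Sum.elim (fun _ _ => 0) f (E i), fun i => ?_, fun τ z₁ z₂ hτ => ?_⟩
      · beta_reduce; rcases E i with i | i
        · exact poly_zero _ _
        · exact hf i
      · rw [hs, h τ z₁ z₂ hτ]; simp
  · intro f f' hf hf' hff i τ hτ
    have a0 : ∀ F : Fin (2 * (m ^ 2 + 1)) → ℂ → ℂ, (∀ i, IsE4E6sqPoly (Sum.elim w0 w2 (E i)) k (F i)) →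
        ∀ i, IsE4E6sqPoly (w0 i) k (F (E.symm (Sum.inl i))) := fun F hF i => by
      simpa using hF (E.symm (Sum.inl i))
    have a2 : ∀ F : Fin (2 * (m ^ 2 + 1)) → ℂ → ℂ, (∀ i, IsE4E6sqPoly (Sum.elim w0 w2 (E i)) k (F i)) →
        ∀ i, IsE4E6sqPoly (w2 i) k (F (E.symm (Sum.inr i))) := fun F hF i => by
      simpa using hF (E.symm (Sum.inr i))
    simp only [hs] at hff
    obtain ⟨x, rfl⟩ := E.symm.surjective i
    rcases hk4 with h | h
    · have z : ∀ F : Fin (2 * (m ^ 2 + 1)) → ℂ → ℂ, (∀ i, IsE4E6sqPoly (Sum.elim w0 w2 (E i)) k (F i)) →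
          ∀ i τ, UHP τ → F (E.symm (Sum.inr i)) τ = 0 := fun F hF i τ hτ =>
        poly_eq_zero (by rw [(h2.mem i).1, h]; norm_num) (a2 F hF i) hτ
      rcases x with i | i
      · refine h0.uni k h (fun i => f (E.symm (Sum.inl i))) (fun i => f' (E.symm (Sum.inl i))) (a0 f hf) (a0 f' hf') (fun τ z₁ z₂ hτ => ?_) i τ hτ
        have := hff τ z₁ z₂ hτ
        simpa [z f hf _ τ hτ, z f' hf' _ τ hτ] using this
      · rw [z f hf i τ hτ, z f' hf' i τ hτ]
    · have z : ∀ F : Fin (2 * (m ^ 2 + 1)) → ℂ → ℂ, (∀ i, IsE4E6sqPoly (Sum.elim w0 w2 (E i)) k (F i)) →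
          ∀ i τ, UHP τ → F (E.symm (Sum.inl i)) τ = 0 := fun F hF i τ hτ =>
        poly_eq_zero (by rw [(h0.mem i).1, h]; norm_num) (a0 F hF i) hτ
      rcases x with i | i
      · rw [z f hf i τ hτ, z f' hf' i τ hτ]
      · refine h2.uni k h (fun i => f (E.symm (Sum.inr i))) (fun i => f' (E.symm (Sum.inr i))) (a2 f hf) (a2 f' hf') (fun τ z₁ z₂ hτ => ?_) i τ hτ
        have := hff τ z₁ z₂ hτ
        simpa [z f hf _ τ hτ, z f' hf' _ τ hτ] using this

/-- `J_{4*,m}(O_K)` is a free module of rank `m² + 2` over `ℂ[E₄, E₆²]`,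
and `J_{2*,m}(O_K)` is a free module of rank `2(m² + 1)` over `ℂ[E₄, E₆²]`; freeness is
expressed by the existence of homogeneous generators with unique coefficients in
`ℂ[E₄, E₆²]`. -/
theorem stmt19 (m : ℕ) (hm : 0 < m) :
    (∃ (w : Fin (m ^ 2 + 2) → ℕ) (g : Fin (m ^ 2 + 2) → (ℂ → ℂ → ℂ → ℂ)),
      (∀ i, w i % 4 = 0 ∧ IsHJF (w i) m (g i)) ∧
      ∀ k : ℕ, k % 4 = 0 → ∀ φ : ℂ → ℂ → ℂ → ℂ, IsHJF k m φ →
        (∃ f : Fin (m ^ 2 + 2) → (ℂ → ℂ),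
          (∀ i, IsE4E6sqPoly (w i) k (f i)) ∧
          ∀ τ z₁ z₂ : ℂ, UHP τ → φ τ z₁ z₂ = ∑ i, f i τ * g i τ z₁ z₂) ∧
        (∀ f f' : Fin (m ^ 2 + 2) → (ℂ → ℂ),
          (∀ i, IsE4E6sqPoly (w i) k (f i)) → (∀ i, IsE4E6sqPoly (w i) k (f' i)) →
          (∀ τ z₁ z₂ : ℂ, UHP τ →
            ∑ i, f i τ * g i τ z₁ z₂ = ∑ i, f' i τ * g i τ z₁ z₂) →
          ∀ i, ∀ τ : ℂ, UHP τ → f i τ = f' i τ)) ∧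
    (∃ (w : Fin (2 * (m ^ 2 + 1)) → ℕ) (g : Fin (2 * (m ^ 2 + 1)) → (ℂ → ℂ → ℂ → ℂ)),
      (∀ i, w i % 2 = 0 ∧ IsHJF (w i) m (g i)) ∧
      ∀ k : ℕ, k % 2 = 0 → ∀ φ : ℂ → ℂ → ℂ → ℂ, IsHJF k m φ →
        (∃ f : Fin (2 * (m ^ 2 + 1)) → (ℂ → ℂ),
          (∀ i, IsE4E6sqPoly (w i) k (f i)) ∧
          ∀ τ z₁ z₂ : ℂ, UHP τ → φ τ z₁ z₂ = ∑ i, f i τ * g i τ z₁ z₂) ∧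
        (∀ f f' : Fin (2 * (m ^ 2 + 1)) → (ℂ → ℂ),
          (∀ i, IsE4E6sqPoly (w i) k (f i)) → (∀ i, IsE4E6sqPoly (w i) k (f' i)) →
          (∀ τ z₁ z₂ : ℂ, UHP τ →
            ∑ i, f i τ * g i τ z₁ z₂ = ∑ i', f' i' τ * g i' τ z₁ z₂) →
          ∀ i, ∀ τ : ℂ, UHP τ → f i τ = f' i τ)) := by
  refine ⟨?_, main_i m hm⟩
  obtain ⟨⟨w, g, h⟩, -⟩ := two_free m hm
  exact ⟨w, g, h.mem, fun k hk φ hφ => ⟨h.gen k hk φ hφ, h.uni k hk⟩⟩
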